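/- arXiv:2404.10398 — 3 statements merged into one kernel-verified Lean document; each statement's English description precedes it below -/
import Mathlib

section
/- There exists a unique ϱ̄ ∈ (−∞, 0) such that the blow-up time of the Riccati equation satisfies t_{ϱ̄} = 0. Moreover, the limit matrix lim_{t ↓ 0} K_t(ϱ̄)⁻¹ exists, is symmetric positive semidefinite, and has a nontrivial kernel (its kernel has dimension at least 1 and at most n). -/
open Filter Matrix Set

attribute [local instance] Matrix.normedAddCommGroup Matrix.normedSpace

/-- Right-hand side of the matrix Riccati equation `−K̇ = Ric ϱ t K`. -/
noncomputable def Ric {n : ℕ}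
    (H11 H12 H13 H14 H21 H22 H23 H24 H31 H32 H33 H41 H42 H44 :
      ℝ → Matrix (Fin n) (Fin n) ℝ) (ϱ t : ℝ)
    (K : Matrix (Fin n) (Fin n) ℝ) : Matrix (Fin n) (Fin n) ℝ :=
  K * H21 t + H12 t * K + H11 t + ϱ • (K * H22 t * K)
    + (ϱ ^ 2) • ((K * H23 t + H13 t) * ((1 - K * H33 t)⁻¹ * K) * (H31 t + H32 t * K))
    + (ϱ ^ 2) • ((K * H24 t + H14 t) * ((1 - K * H44 t)⁻¹ * K) * (H41 t + H42 t * K))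

section Alg
variable {n : ℕ}

theorem dp_mv_sym {A B : Matrix (Fin n) (Fin n) ℝ} (h : Aᵀ = B) (x y : Fin n → ℝ) :
    x ⬝ᵥ (A *ᵥ y) = (B *ᵥ x) ⬝ᵥ y := by
  rw [← h, mulVec_transpose, dotProduct_mulVec]

theorem psd_symm {K : Matrix (Fin n) (Fin n) ℝ} (h : K.PosSemidef) : Kᵀ = K := by
  have := h.isHermitian
  rwa [IsHermitian, conjTranspose_eq_transpose_of_trivial] at this

theorem psd_nonneg {K : Matrix (Fin n) (Fin n) ℝ} (h : K.PosSemidef) (x : Fin n → ℝ) :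
    0 ≤ x ⬝ᵥ (K *ᵥ x) := by
  simpa using h.dotProduct_mulVec_nonneg x

theorem psd_of {K : Matrix (Fin n) (Fin n) ℝ} (hs : Kᵀ = K)
    (h : ∀ x : Fin n → ℝ, 0 ≤ x ⬝ᵥ (K *ᵥ x)) : K.PosSemidef := by
  refine PosSemidef.of_dotProduct_mulVec_nonneg ?_ (by simpa using h)
  rwa [IsHermitian, conjTranspose_eq_transpose_of_trivial]

theorem dp_self_nonneg (x : Fin n → ℝ) : 0 ≤ x ⬝ᵥ x :=
  Finset.sum_nonneg fun i _ => mul_self_nonneg _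

theorem dp_self_pos {x : Fin n → ℝ} (h : x ≠ 0) : 0 < x ⬝ᵥ x :=
  lt_of_le_of_ne (dp_self_nonneg x) fun h' => h (dotProduct_self_eq_zero.1 h'.symm)

theorem dp_cs (x y : Fin n → ℝ) : (x ⬝ᵥ y) ^ 2 ≤ (x ⬝ᵥ x) * (y ⬝ᵥ y) := by
  have := Finset.sum_mul_sq_le_sq_mul_sq Finset.univ x y
  simpa [dotProduct, sq] using this

/-- weighted AM-GM -/
theorem dp_amgm (x y : Fin n → ℝ) {c : ℝ} (hc : 0 < c) :
    -(y ⬝ᵥ y) / c ≤ 2 * (x ⬝ᵥ y) + c * (x ⬝ᵥ x) := by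
  have h := dp_self_nonneg (c • x + y)
  have e : (c • x + y) ⬝ᵥ (c • x + y) = c * (c * (x ⬝ᵥ x) + 2 * (x ⬝ᵥ y)) + y ⬝ᵥ y := by
    simp only [add_dotProduct, dotProduct_add, smul_dotProduct, dotProduct_smul, smul_eq_mul,
      dotProduct_comm y x]
    ring
  rw [div_le_iff₀ hc]
  linarith

/-- the kernel of a psd form -/
theorem psd_ker {K : Matrix (Fin n) (Fin n) ℝ} (h : K.PosSemidef) {v : Fin n → ℝ}
    (hv : v ⬝ᵥ (K *ᵥ v) = 0) : K *ᵥ v = 0 := by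
  by_contra hne
  have hp := dp_self_pos hne
  set w := K *ᵥ v with hw
  have hq := psd_nonneg h w
  set a := w ⬝ᵥ (K *ᵥ w)
  set b := w ⬝ᵥ w
  have key : ∀ s : ℝ, 0 ≤ s * s * a + 2 * s * b := by
    intro s
    have := psd_nonneg h (v + s • w)
    have e1 : v ⬝ᵥ (K *ᵥ w) = b := by rw [dp_mv_sym (psd_symm h)]
    have e2 : w ⬝ᵥ (K *ᵥ v) = b := rfl
    simp only [mulVec_add, mulVec_smul, add_dotProduct, dotProduct_add, smul_dotProduct,
      dotProduct_smul, smul_eq_mul, e1, e2] at this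
    change 0 ≤ v ⬝ᵥ w + s * b + s * (b + s * a) at this
    rw [hv] at this
    linarith
  rcases hq.eq_or_lt with h0 | h0
  · have := key (-1); rw [← h0] at this; linarith
  · have := key (-(b / a))
    have e : -(b / a) * -(b / a) * a + 2 * -(b / a) * b = - (b * b / a) := by
      field_simp; ring
    rw [e] at this
    have : 0 < b * b / a := by positivity
    linarith

/-- The operator `F`. -/
noncomputable def FF (K H : Matrix (Fin n) (Fin n) ℝ) : Matrix (Fin n) (Fin n) ℝ :=
  (1 - K * H)⁻¹ * K

variable {β : ℝ} {K K' H : Matrix (Fin n) (Fin n) ℝ}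

theorem FF_unit (hβ : 0 < β) (hK : K.PosSemidef)
    (hH : ∀ u : Fin n → ℝ, u ⬝ᵥ (H *ᵥ u) ≤ -β * (u ⬝ᵥ u)) : IsUnit (1 - K * H).det := by
  rw [isUnit_iff_ne_zero]
  intro h
  obtain ⟨u, hu, hu0⟩ := Matrix.exists_mulVec_eq_zero_iff.mpr h
  rw [sub_mulVec, one_mulVec, sub_eq_zero, ← mulVec_mulVec] at hu0
  have h1 := psd_nonneg hK (H *ᵥ u)
  rw [← hu0, dotProduct_comm] at h1
  have := hH u
  have := dp_self_pos hu
  nlinarith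

theorem FF_left (hβ : 0 < β) (hK : K.PosSemidef)
    (hH : ∀ u : Fin n → ℝ, u ⬝ᵥ (H *ᵥ u) ≤ -β * (u ⬝ᵥ u)) :
    FF K H = K + K * H * FF K H := by
  have h := FF_unit hβ hK hH
  have : (1 - K * H) * FF K H = K := by
    rw [FF, ← mul_assoc, mul_nonsing_inv _ h, one_mul]
  rw [sub_mul, one_mul, sub_eq_iff_eq_add] at this
  exact this

theorem FF_right (hβ : 0 < β) (hK : K.PosSemidef)
    (hH : ∀ u : Fin n → ℝ, u ⬝ᵥ (H *ᵥ u) ≤ -β * (u ⬝ᵥ u)) :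
    FF K H = K + FF K H * H * K := by
  have h := FF_unit hβ hK hH
  have e : (1 - K * H) * K = K * (1 - H * K) := by noncomm_ring
  have : FF K H * (1 - H * K) = K := by
    rw [FF, mul_assoc, ← e, ← mul_assoc, nonsing_inv_mul _ h, one_mul]
  rw [mul_sub, mul_one, sub_eq_iff_eq_add] at this
  rw [mul_assoc]
  exact this

theorem FF_sub (hβ : 0 < β) (hK : K.PosSemidef) (hK' : K'.PosSemidef)
    (hH : ∀ u : Fin n → ℝ, u ⬝ᵥ (H *ᵥ u) ≤ -β * (u ⬝ᵥ u)) :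
    FF K H - FF K' H = (1 + FF K H * H) * (K - K') * (1 + H * FF K' H) := by
  have h1 : (1 + FF K H * H) * K = FF K H := by
    rw [add_mul, one_mul, ← FF_right hβ hK hH]
  have h2 : K' * (1 + H * FF K' H) = FF K' H := by
    rw [mul_add, mul_one, ← mul_assoc, ← FF_left hβ hK' hH]
  have : (1 + FF K H * H) * (K - K') * (1 + H * FF K' H)
    = ((1 + FF K H * H) * K) * (1 + H * FF K' H)
      - (1 + FF K H * H) * (K' * (1 + H * FF K' H)) := by noncomm_ring
  rw [this, h1, h2]
  noncomm_ring

theorem FF_vec (hβ : 0 < β) (hK : K.PosSemidef)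
    (hH : ∀ u : Fin n → ℝ, u ⬝ᵥ (H *ᵥ u) ≤ -β * (u ⬝ᵥ u)) (w : Fin n → ℝ) :
    FF K H *ᵥ w = K *ᵥ (w + H *ᵥ (FF K H *ᵥ w)) := by
  conv_lhs => rw [FF_left hβ hK hH]
  rw [add_mulVec, mulVec_add, mulVec_mulVec, mulVec_mulVec, mul_assoc]

theorem FF_bd (hβ : 0 < β) (hK : K.PosSemidef)
    (hH : ∀ u : Fin n → ℝ, u ⬝ᵥ (H *ᵥ u) ≤ -β * (u ⬝ᵥ u)) (w : Fin n → ℝ) :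
    β * ((FF K H *ᵥ w) ⬝ᵥ (FF K H *ᵥ w)) ≤ w ⬝ᵥ (FF K H *ᵥ w) := by
  have h1 := psd_nonneg hK (w + H *ᵥ (FF K H *ᵥ w))
  rw [← FF_vec hβ hK hH, add_dotProduct, dotProduct_comm (H *ᵥ _)] at h1
  have := hH (FF K H *ᵥ w)
  linarith

theorem FF_nonneg (hβ : 0 < β) (hK : K.PosSemidef)
    (hH : ∀ u : Fin n → ℝ, u ⬝ᵥ (H *ᵥ u) ≤ -β * (u ⬝ᵥ u)) (w : Fin n → ℝ) :
    0 ≤ w ⬝ᵥ (FF K H *ᵥ w) :=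
  le_trans (mul_nonneg hβ.le (dp_self_nonneg _)) (FF_bd hβ hK hH w)

theorem FF_bd2 (hβ : 0 < β) (hK : K.PosSemidef)
    (hH : ∀ u : Fin n → ℝ, u ⬝ᵥ (H *ᵥ u) ≤ -β * (u ⬝ᵥ u)) (w : Fin n → ℝ) :
    β ^ 2 * ((FF K H *ᵥ w) ⬝ᵥ (FF K H *ᵥ w)) ≤ w ⬝ᵥ w := by
  have h1 := FF_bd hβ hK hH w
  have h2 := dp_cs w (FF K H *ᵥ w)
  set u := FF K H *ᵥ w
  have h3 := dp_self_nonneg u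
  have h4 := dp_self_nonneg w
  rcases h3.eq_or_lt with h0 | h0
  · rw [← h0]; simpa using h4
  · have h5 : (β * (u ⬝ᵥ u)) ^ 2 ≤ (w ⬝ᵥ w) * (u ⬝ᵥ u) :=
      le_trans (pow_le_pow_left₀ (by positivity) h1 2) h2
    refine le_of_mul_le_mul_right ?_ h0
    linarith [h5]

theorem FF_mono (hβ : 0 < β) (hK : K.PosSemidef) (hK' : K'.PosSemidef) (hHs : Hᵀ = H)
    (hH : ∀ u : Fin n → ℝ, u ⬝ᵥ (H *ᵥ u) ≤ -β * (u ⬝ᵥ u))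
    (hle : ∀ u : Fin n → ℝ, u ⬝ᵥ (K' *ᵥ u) ≤ u ⬝ᵥ (K *ᵥ u)) (w : Fin n → ℝ) :
    w ⬝ᵥ (FF K' H *ᵥ w) ≤ w ⬝ᵥ (FF K H *ᵥ w) := by
  have e1 := FF_vec hβ hK hH w
  have e2 := FF_vec hβ hK' hH w
  set u1 := FF K H *ᵥ w
  set u2 := FF K' H *ᵥ w
  have a1 := hle (w + H *ᵥ u1)
  have a2 := psd_nonneg hK' ((w + H *ᵥ u1) - (w + H *ᵥ u2))
  have a3 := hH (u1 - u2)
  have a4 := dp_self_nonneg (u1 - u2)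
  rw [← e1] at a1
  have s1 : (w + H *ᵥ u2) ⬝ᵥ (K' *ᵥ (w + H *ᵥ u1)) = u2 ⬝ᵥ (w + H *ᵥ u1) := by
    rw [dp_mv_sym (psd_symm hK'), ← e2]
  have s2 : u1 ⬝ᵥ (H *ᵥ u2) = u2 ⬝ᵥ (H *ᵥ u1) := by
    rw [dp_mv_sym hHs, dotProduct_comm]
  rw [mulVec_sub, sub_dotProduct, dotProduct_sub, dotProduct_sub, ← e2, s1] at a2
  simp only [mulVec_sub, sub_dotProduct, dotProduct_sub, add_dotProduct, dotProduct_add,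
    dotProduct_comm (H *ᵥ _), dotProduct_comm u2 w, dotProduct_comm u1 w] at a1 a2 a3
  have := mul_nonneg hβ.le a4
  rw [sub_dotProduct, dotProduct_sub, dotProduct_sub] at this
  linarith

end Alg

/-- The data of the problem. -/
structure Dat (n : ℕ) (T β : ℝ) where
  (H11 H12 H13 H14 H21 H22 H23 H24 H31 H32 H33 H41 H42 H44 : ℝ → Matrix (Fin n) (Fin n) ℝ)
  hc11 : Continuous H11
  hc12 : Continuous H12
  hc13 : Continuous H13
  hc14 : Continuous H14
  hc21 : Continuous H21
  hc22 : Continuous H22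
  hc23 : Continuous H23
  hc24 : Continuous H24
  hc31 : Continuous H31
  hc32 : Continuous H32
  hc33 : Continuous H33
  hc41 : Continuous H41
  hc42 : Continuous H42
  hc44 : Continuous H44
  hsym : ∀ t : ℝ, (H11 t)ᵀ = H11 t ∧ (H12 t)ᵀ = H21 t ∧ (H13 t)ᵀ = H31 t ∧
      (H14 t)ᵀ = H41 t ∧ (H22 t)ᵀ = H22 t ∧ (H23 t)ᵀ = H32 t ∧
      (H24 t)ᵀ = H42 t ∧ (H33 t)ᵀ = H33 t ∧ (H44 t)ᵀ = H44 t
  h11 : ∀ t ≤ T, ∀ u : Fin n → ℝ, β * (u ⬝ᵥ u) ≤ u ⬝ᵥ (H11 t *ᵥ u)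
  h22 : ∀ t ≤ T, ∀ u : Fin n → ℝ, u ⬝ᵥ (H22 t *ᵥ u) ≤ -β * (u ⬝ᵥ u)
  h33 : ∀ t ≤ T, ∀ u : Fin n → ℝ, u ⬝ᵥ (H33 t *ᵥ u) ≤ -β * (u ⬝ᵥ u)
  h44 : ∀ t ≤ T, ∀ u : Fin n → ℝ, u ⬝ᵥ (H44 t *ᵥ u) ≤ -β * (u ⬝ᵥ u)

namespace Dat
variable {n : ℕ} {T β : ℝ} (d : Dat n T β)

/-- The Riccati right-hand side. -/
noncomputable def R (ϱ t : ℝ) (K : Matrix (Fin n) (Fin n) ℝ) : Matrix (Fin n) (Fin n) ℝ :=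
  Ric d.H11 d.H12 d.H13 d.H14 d.H21 d.H22 d.H23 d.H24 d.H31 d.H32 d.H33 d.H41 d.H42 d.H44 ϱ t K

theorem form {ϱ t : ℝ} {K : Matrix (Fin n) (Fin n) ℝ} (hK : K.PosSemidef) (v : Fin n → ℝ) :
    v ⬝ᵥ (d.R ϱ t K *ᵥ v) = 2 * ((K *ᵥ v) ⬝ᵥ (d.H21 t *ᵥ v)) + v ⬝ᵥ (d.H11 t *ᵥ v)
      + ϱ * ((K *ᵥ v) ⬝ᵥ (d.H22 t *ᵥ (K *ᵥ v)))
      + ϱ ^ 2 * ((d.H31 t *ᵥ v + d.H32 t *ᵥ (K *ᵥ v)) ⬝ᵥ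
          (FF K (d.H33 t) *ᵥ (d.H31 t *ᵥ v + d.H32 t *ᵥ (K *ᵥ v))))
      + ϱ ^ 2 * ((d.H41 t *ᵥ v + d.H42 t *ᵥ (K *ᵥ v)) ⬝ᵥ
          (FF K (d.H44 t) *ᵥ (d.H41 t *ᵥ v + d.H42 t *ᵥ (K *ᵥ v)))) := by
  obtain ⟨s11, s12, s13, s14, s22, s23, s24, s33, s44⟩ := d.hsym t
  have sK := psd_symm hK
  have e1 : ∀ A B A' B' F : Matrix (Fin n) (Fin n) ℝ, Aᵀ = A' → Bᵀ = B' →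
      v ⬝ᵥ (((K * A + B) * F * (B' + A' * K)) *ᵥ v)
      = (B' *ᵥ v + A' *ᵥ (K *ᵥ v)) ⬝ᵥ (F *ᵥ (B' *ᵥ v + A' *ᵥ (K *ᵥ v))) := by
    intro A B A' B' F hA hB
    have : (K * A + B)ᵀ = B' + A' * K := by
      rw [transpose_add, transpose_mul, hA, hB, sK, add_comm]
    rw [mul_assoc, ← mulVec_mulVec, dp_mv_sym this, ← mulVec_mulVec, add_mulVec, mulVec_mulVec]
  have e2 : v ⬝ᵥ ((K * d.H21 t) *ᵥ v) = (K *ᵥ v) ⬝ᵥ (d.H21 t *ᵥ v) := by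
    rw [← mulVec_mulVec, dp_mv_sym sK]
  have e3 : v ⬝ᵥ ((d.H12 t * K) *ᵥ v) = (K *ᵥ v) ⬝ᵥ (d.H21 t *ᵥ v) := by
    rw [← mulVec_mulVec, dp_mv_sym s12, dotProduct_comm]
  have e4 : v ⬝ᵥ ((K * d.H22 t * K) *ᵥ v) = (K *ᵥ v) ⬝ᵥ (d.H22 t *ᵥ (K *ᵥ v)) := by
    rw [mul_assoc, ← mulVec_mulVec, dp_mv_sym sK, mulVec_mulVec]
  rw [R, Ric]
  simp only [add_mulVec, smul_mulVec, dotProduct_add, dotProduct_smul, smul_eq_mul, e2, e3, e4]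
  rw [e1 _ _ _ _ _ s23 s13, e1 _ _ _ _ _ s24 s14]
  simp only [FF]
  ring

theorem mono_rho (hβ : 0 < β) {ϱ₁ ϱ₂ t : ℝ} (ht : t ≤ T) (h1 : ϱ₁ ≤ ϱ₂) (h2 : ϱ₂ ≤ 0)
    {K : Matrix (Fin n) (Fin n) ℝ} (hK : K.PosSemidef) (v : Fin n → ℝ) :
    v ⬝ᵥ (d.R ϱ₂ t K *ᵥ v) ≤ v ⬝ᵥ (d.R ϱ₁ t K *ᵥ v) := by
  rw [d.form hK, d.form hK]
  have a := d.h22 t ht (K *ᵥ v)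
  have a' := mul_nonneg hβ.le (dp_self_nonneg (K *ᵥ v))
  have sq : ϱ₂ ^ 2 ≤ ϱ₁ ^ 2 := by nlinarith
  have b := mul_le_mul_of_nonneg_right sq
    (FF_nonneg hβ hK (d.h33 t ht) (d.H31 t *ᵥ v + d.H32 t *ᵥ (K *ᵥ v)))
  have c := mul_le_mul_of_nonneg_right sq
    (FF_nonneg hβ hK (d.h44 t ht) (d.H41 t *ᵥ v + d.H42 t *ᵥ (K *ᵥ v)))
  have e : ϱ₂ * ((K *ᵥ v) ⬝ᵥ (d.H22 t *ᵥ (K *ᵥ v))) ≤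
      ϱ₁ * ((K *ᵥ v) ⬝ᵥ (d.H22 t *ᵥ (K *ᵥ v))) :=
    mul_le_mul_of_nonpos_right h1 (by linarith)
  linarith

theorem mono_K (hβ : 0 < β) {ϱ t : ℝ} (ht : t ≤ T)
    {K K' : Matrix (Fin n) (Fin n) ℝ} (hK : K.PosSemidef) (hK' : K'.PosSemidef)
    (hle : ∀ u : Fin n → ℝ, u ⬝ᵥ (K' *ᵥ u) ≤ u ⬝ᵥ (K *ᵥ u))
    (v : Fin n → ℝ) (hv : K *ᵥ v = K' *ᵥ v) :
    v ⬝ᵥ (d.R ϱ t K' *ᵥ v) ≤ v ⬝ᵥ (d.R ϱ t K *ᵥ v) := by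
  rw [d.form hK, d.form hK', hv]
  obtain ⟨s11, s12, s13, s14, s22, s23, s24, s33, s44⟩ := d.hsym t
  gcongr
  · exact FF_mono hβ hK hK' s33 (d.h33 t ht) hle _
  · exact FF_mono hβ hK hK' s44 (d.h44 t ht) hle _

theorem lower (hβ : 0 < β) {ϱ t : ℝ} (ht : t ≤ T) (h : ϱ ≤ 0)
    {K : Matrix (Fin n) (Fin n) ℝ} (hK : K.PosSemidef) (v : Fin n → ℝ) :
    2 * ((K *ᵥ v) ⬝ᵥ (d.H21 t *ᵥ v)) + β * (v ⬝ᵥ v) + (-ϱ) * β * ((K *ᵥ v) ⬝ᵥ (K *ᵥ v))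
      ≤ v ⬝ᵥ (d.R ϱ t K *ᵥ v) := by
  rw [d.form hK]
  have a := d.h22 t ht (K *ᵥ v)
  have b := mul_nonneg (sq_nonneg ϱ)
    (FF_nonneg hβ hK (d.h33 t ht) (d.H31 t *ᵥ v + d.H32 t *ᵥ (K *ᵥ v)))
  have c := mul_nonneg (sq_nonneg ϱ)
    (FF_nonneg hβ hK (d.h44 t ht) (d.H41 t *ᵥ v + d.H42 t *ᵥ (K *ᵥ v)))
  have e := mul_le_mul_of_nonpos_left a h
  have f := d.h11 t ht v
  linarith

end Dat

section Norm
variable {n : ℕ}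

theorem mnorm_mul_le (A B : Matrix (Fin n) (Fin n) ℝ) : ‖A * B‖ ≤ n * (‖A‖ * ‖B‖) := by
  rw [Matrix.norm_le_iff (by positivity)]
  intro i j
  rw [mul_apply]
  refine (norm_sum_le _ _).trans ?_
  refine (Finset.sum_le_card_nsmul _ _ (‖A‖ * ‖B‖) ?_).trans (by simp)
  intro k _
  rw [norm_mul]
  exact mul_le_mul (norm_entry_le_entrywise_sup_norm A) (norm_entry_le_entrywise_sup_norm B)
    (norm_nonneg _) (norm_nonneg _)

/-- uniformly bounded and Lipschitz families -/
def BL (I : Set ℝ) (s : Set (ℝ × Matrix (Fin n) (Fin n) ℝ))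
    (f : ℝ → ℝ × Matrix (Fin n) (Fin n) ℝ → Matrix (Fin n) (Fin n) ℝ) : Prop :=
  ∃ C : ℝ, 0 ≤ C ∧ (∀ t ∈ I, ∀ x ∈ s, ‖f t x‖ ≤ C) ∧
    ∀ t ∈ I, ∀ x ∈ s, ∀ y ∈ s, ‖f t x - f t y‖ ≤ C * ‖x - y‖

variable {I : Set ℝ} {s : Set (ℝ × Matrix (Fin n) (Fin n) ℝ)}
  {f g : ℝ → ℝ × Matrix (Fin n) (Fin n) ℝ → Matrix (Fin n) (Fin n) ℝ}

theorem BL.const {h : ℝ → Matrix (Fin n) (Fin n) ℝ} (hI : IsCompact I) (hh : Continuous h) :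
    BL I s (fun t _ => h t) := by
  obtain ⟨C, hC⟩ := hI.exists_bound_of_continuousOn hh.continuousOn
  refine ⟨|C|, abs_nonneg _, fun t ht x _ => (hC t ht).trans (le_abs_self _), ?_⟩
  intro t ht x _ y _
  simp only [sub_self, norm_zero]
  positivity

theorem BL.snd {r : ℝ} (hs : ∀ x ∈ s, ‖x‖ ≤ r) : BL I s (fun _ x => x.2) := by
  refine ⟨max r 1, by positivity, fun t _ x hx => ?_, fun t _ x _ y _ => ?_⟩
  · exact (norm_snd_le x).trans ((hs x hx).trans (le_max_left _ _))
  · calc ‖x.2 - y.2‖ ≤ ‖x - y‖ := norm_snd_le (x - y)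
      _ ≤ max r 1 * ‖x - y‖ := le_mul_of_one_le_left (norm_nonneg _) (le_max_right _ _)

theorem BL.add (hf : BL I s f) (hg : BL I s g) : BL I s (fun t x => f t x + g t x) := by
  obtain ⟨C, hC, h1, h2⟩ := hf
  obtain ⟨D, hD, k1, k2⟩ := hg
  refine ⟨C + D, by positivity, fun t ht x hx => ?_, fun t ht x hx y hy => ?_⟩
  · exact (norm_add_le _ _).trans (add_le_add (h1 t ht x hx) (k1 t ht x hx))
  · rw [add_sub_add_comm, add_mul]
    exact (norm_add_le _ _).trans (add_le_add (h2 t ht x hx y hy) (k2 t ht x hx y hy))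

theorem BL.mul (hf : BL I s f) (hg : BL I s g) : BL I s (fun t x => f t x * g t x) := by
  obtain ⟨C, hC, h1, h2⟩ := hf
  obtain ⟨D, hD, k1, k2⟩ := hg
  refine ⟨2 * n * (C * D), by positivity, fun t ht x hx => ?_, fun t ht x hx y hy => ?_⟩
  · have : ‖f t x * g t x‖ ≤ n * (C * D) := by
      refine (mnorm_mul_le _ _).trans ?_
      gcongr
      · exact h1 t ht x hx
      · exact k1 t ht x hx
    have : 0 ≤ n * (C * D) := by positivity
    linarith
  · have e : f t x * g t x - f t y * g t y = f t x * (g t x - g t y) + (f t x - f t y) * g t y := by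
      noncomm_ring
    rw [e]
    have a : ‖f t x * (g t x - g t y)‖ ≤ n * (C * (D * ‖x - y‖)) := by
      refine (mnorm_mul_le _ _).trans ?_
      gcongr
      · exact h1 t ht x hx
      · exact k2 t ht x hx y hy
    have b : ‖(f t x - f t y) * g t y‖ ≤ n * ((C * ‖x - y‖) * D) := by
      refine (mnorm_mul_le _ _).trans ?_
      gcongr
      · exact h2 t ht x hx y hy
      · exact k1 t ht y hy
    refine (norm_add_le _ _).trans ((add_le_add a b).trans (le_of_eq (by ring)))

theorem BL.smul {r : ℝ} (hs : ∀ x ∈ s, ‖x‖ ≤ r) (hf : BL I s f) :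
    BL I s (fun t x => x.1 • f t x) := by
  obtain ⟨C, hC, h1, h2⟩ := hf
  refine ⟨(|r| + 1) * C, by positivity, fun t ht x hx => ?_, fun t ht x hx y hy => ?_⟩
  · rw [norm_smul]
    have : ‖x.1‖ ≤ |r| + 1 := by
      have := (norm_fst_le x).trans (hs x hx)
      linarith [le_abs_self r]
    gcongr
    exact h1 t ht x hx
  · have e : x.1 • f t x - y.1 • f t y = x.1 • (f t x - f t y) + (x.1 - y.1) • f t y := by
      rw [smul_sub, sub_smul]; abel
    rw [e]
    have hx1 : ‖x.1‖ ≤ |r| := ((norm_fst_le x).trans (hs x hx)).trans (le_abs_self r)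
    have a : ‖x.1 • (f t x - f t y)‖ ≤ |r| * (C * ‖x - y‖) := by
      rw [norm_smul]
      gcongr
      exact h2 t ht x hx y hy
    have b : ‖(x.1 - y.1) • f t y‖ ≤ ‖x - y‖ * C := by
      rw [norm_smul]
      gcongr
      · exact norm_fst_le (x - y)
      · exact h1 t ht y hy
    refine (norm_add_le _ _).trans ((add_le_add a b).trans (le_of_eq (by ring)))

theorem norm_le_of_vec {F : Matrix (Fin n) (Fin n) ℝ} {β : ℝ} (hβ : 0 < β)
    (h : ∀ w : Fin n → ℝ, β ^ 2 * ((F *ᵥ w) ⬝ᵥ (F *ᵥ w)) ≤ w ⬝ᵥ w) : ‖F‖ ≤ 1 / β := by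
  rw [Matrix.norm_le_iff (by positivity)]
  intro i j
  have := h (Pi.single j 1)
  rw [mulVec_single_one] at this
  have e : (Pi.single j (1 : ℝ) : Fin n → ℝ) ⬝ᵥ Pi.single j 1 = 1 := by simp
  rw [e] at this
  have h2 : F i j * F i j ≤ F.col j ⬝ᵥ F.col j :=
    Finset.single_le_sum (f := fun k => F k j * F k j) (fun k _ => mul_self_nonneg _)
      (Finset.mem_univ i)
  rw [Real.norm_eq_abs, le_div_iff₀ hβ]
  have h3 : (|F i j| * β) ^ 2 ≤ 1 ^ 2 := by
    rw [mul_pow, sq_abs]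
    nlinarith [mul_le_mul_of_nonneg_left h2 (sq_nonneg β)]
  exact (pow_le_pow_iff_left₀ (by positivity) (by norm_num) (by norm_num)).1 h3

theorem BL.FF {h : ℝ → Matrix (Fin n) (Fin n) ℝ} {β r : ℝ} (hβ : 0 < β)
    (hI : IsCompact I) (hh : Continuous h) (hs : ∀ x ∈ s, ‖x‖ ≤ r)
    (hp : ∀ x ∈ s, x.2.PosSemidef)
    (hH : ∀ t ∈ I, ∀ u : Fin n → ℝ, u ⬝ᵥ (h t *ᵥ u) ≤ -β * (u ⬝ᵥ u)) :
    BL I s (fun t x => FF x.2 (h t)) := by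
  obtain ⟨C, hC⟩ := hI.exists_bound_of_continuousOn hh.continuousOn
  set c0 : ℝ := ‖(1 : Matrix (Fin n) (Fin n) ℝ)‖
  set D := c0 + n * (1 / β * |C|) with hD
  have hD0 : 0 ≤ D := by positivity
  have hF : ∀ t ∈ I, ∀ x ∈ s, ‖_root_.FF x.2 (h t)‖ ≤ 1 / β := fun t ht x hx =>
    norm_le_of_vec hβ (FF_bd2 hβ (hp x hx) (hH t ht))
  have hC' : ∀ t ∈ I, ‖h t‖ ≤ |C| := fun t ht => (hC t ht).trans (le_abs_self _)
  refine ⟨1 / β + n * (n * (D * 1) * D), by positivity, fun t ht x hx => ?_,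
    fun t ht x hx y hy => ?_⟩
  · have := hF t ht x hx
    have : 0 ≤ n * (n * (D * 1) * D) := by positivity
    linarith
  · rw [FF_sub hβ (hp x hx) (hp y hy) (hH t ht)]
    have a : ‖1 + _root_.FF x.2 (h t) * h t‖ ≤ D := by
      refine (norm_add_le _ _).trans (add_le_add le_rfl ((mnorm_mul_le _ _).trans ?_))
      gcongr
      · exact hF t ht x hx
      · exact hC' t ht
    have b : ‖1 + h t * _root_.FF y.2 (h t)‖ ≤ D := by
      refine (norm_add_le _ _).trans (add_le_add le_rfl ((mnorm_mul_le _ _).trans ?_))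
      rw [mul_comm ‖h t‖]
      gcongr
      · exact hF t ht y hy
      · exact hC' t ht
    have c : ‖x.2 - y.2‖ ≤ ‖x - y‖ := norm_snd_le (x - y)
    refine (mnorm_mul_le _ _).trans ?_
    have e : ‖(1 + _root_.FF x.2 (h t) * h t) * (x.2 - y.2)‖ ≤ n * (D * ‖x - y‖) := by
      refine (mnorm_mul_le _ _).trans ?_
      gcongr
    have e2 : (n : ℝ) * (‖(1 + _root_.FF x.2 (h t) * h t) * (x.2 - y.2)‖
        * ‖1 + h t * _root_.FF y.2 (h t)‖) ≤ n * ((n * (D * ‖x - y‖)) * D) := by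
      gcongr
    refine e2.trans ?_
    have : 0 ≤ 1 / β * ‖x - y‖ := by positivity
    nlinarith

end Norm

namespace Dat
variable {n : ℕ} {T β : ℝ} (d : Dat n T β)

theorem lip (hβ : 0 < β) (a r : ℝ) : ∃ C : ℝ, 0 ≤ C ∧ ∀ t, a ≤ t → t ≤ T → ∀ ϱ ϱ' : ℝ,
    |ϱ| ≤ r → |ϱ'| ≤ r → ∀ K K' : Matrix (Fin n) (Fin n) ℝ, K.PosSemidef → K'.PosSemidef →
    ‖K‖ ≤ r → ‖K'‖ ≤ r → ‖d.R ϱ t K - d.R ϱ' t K'‖ ≤ C * (|ϱ - ϱ'| + ‖K - K'‖) := by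
  set I := Icc a T with hI
  set s : Set (ℝ × Matrix (Fin n) (Fin n) ℝ) := {x | ‖x‖ ≤ r ∧ x.2.PosSemidef} with hs
  have hIc : IsCompact I := isCompact_Icc
  have hr : ∀ x ∈ s, ‖x‖ ≤ r := fun x hx => hx.1
  have hp : ∀ x ∈ s, x.2.PosSemidef := fun x hx => hx.2
  have bK : BL I s (fun _ x => x.2) := BL.snd hr
  have b33 := BL.FF (s := s) hβ hIc d.hc33 hr hp (fun t ht => d.h33 t ht.2)
  have b44 := BL.FF (s := s) hβ hIc d.hc44 hr hp (fun t ht => d.h44 t ht.2)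
  have c : ∀ {h : ℝ → Matrix (Fin n) (Fin n) ℝ}, Continuous h → BL I s (fun t _ => h t) :=
    fun hh => BL.const hIc hh
  have main : BL I s (fun t x => x.2 * d.H21 t + d.H12 t * x.2 + d.H11 t
      + x.1 • (x.2 * d.H22 t * x.2)
      + x.1 • (x.1 • ((x.2 * d.H23 t + d.H13 t) * (FF x.2 (d.H33 t)) * (d.H31 t + d.H32 t * x.2)))
      + x.1 • (x.1 • ((x.2 * d.H24 t + d.H14 t) * (FF x.2 (d.H44 t))
        * (d.H41 t + d.H42 t * x.2)))) := by
    refine ((((BL.add (BL.mul bK (c d.hc21)) (BL.mul (c d.hc12) bK)).add (c d.hc11)).add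
      (BL.smul hr ((bK.mul (c d.hc22)).mul bK))).add (BL.smul hr (BL.smul hr ?_))).add
      (BL.smul hr (BL.smul hr ?_))
    · exact (((bK.mul (c d.hc23)).add (c d.hc13)).mul b33).mul
        ((c d.hc31).add ((c d.hc32).mul bK))
    · exact (((bK.mul (c d.hc24)).add (c d.hc14)).mul b44).mul
        ((c d.hc41).add ((c d.hc42).mul bK))
  obtain ⟨C, hC, -, h2⟩ := main
  refine ⟨C, hC, fun t h1t htT ϱ ϱ' hϱ hϱ' K K' hK hK' hKr hKr' => ?_⟩
  have := h2 t ⟨h1t, htT⟩ (ϱ, K) ⟨by rw [Prod.norm_def]; exact max_le hϱ hKr, hK⟩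
    (ϱ', K') ⟨by rw [Prod.norm_def]; exact max_le hϱ' hKr', hK'⟩
  simp only [smul_smul, ← sq, FF] at this
  refine le_trans this ?_
  gcongr
  rw [Prod.norm_def]
  exact max_le (le_add_of_nonneg_right (norm_nonneg _)) (le_add_of_nonneg_left (abs_nonneg _))

theorem lin0 (a : ℝ) : ∃ C : ℝ, 0 ≤ C ∧ ∀ t, a ≤ t → t ≤ T →
    ∀ K : Matrix (Fin n) (Fin n) ℝ, ‖d.R 0 t K‖ ≤ C * (1 + ‖K‖) := by
  have hI : IsCompact (Icc a T) := isCompact_Icc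
  obtain ⟨A, hA⟩ := hI.exists_bound_of_continuousOn d.hc21.continuousOn
  obtain ⟨B, hB⟩ := hI.exists_bound_of_continuousOn d.hc12.continuousOn
  obtain ⟨D, hD⟩ := hI.exists_bound_of_continuousOn d.hc11.continuousOn
  refine ⟨n * |A| + n * |B| + |D|, by positivity, fun t h1 h2 K => ?_⟩
  have e : d.R 0 t K = K * d.H21 t + d.H12 t * K + d.H11 t := by simp [R, Ric]
  rw [e]
  have a1 := (hA t ⟨h1, h2⟩).trans (le_abs_self A)
  have a2 := (hB t ⟨h1, h2⟩).trans (le_abs_self B)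
  have a3 := (hD t ⟨h1, h2⟩).trans (le_abs_self D)
  have b1 : ‖K * d.H21 t‖ ≤ n * (‖K‖ * |A|) := (mnorm_mul_le _ _).trans (by gcongr)
  have b2 : ‖d.H12 t * K‖ ≤ n * (|B| * ‖K‖) := (mnorm_mul_le _ _).trans (by gcongr)
  have c1 : ‖K * d.H21 t + d.H12 t * K + d.H11 t‖ ≤
    n * (‖K‖ * |A|) + n * (|B| * ‖K‖) + |D| :=
    (norm_add_le _ _).trans (add_le_add ((norm_add_le _ _).trans (add_le_add b1 b2)) a3)
  refine c1.trans ?_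
  have : 0 ≤ n * |A| + n * |B| + |D| * ‖K‖ := by positivity
  nlinarith

end Dat

section Scalar

theorem le_of_deriv_nonneg' {f f' : ℝ → ℝ} {a b : ℝ} (hab : a ≤ b)
    (hf : ContinuousOn f (Icc a b)) (hd : ∀ t ∈ Ioo a b, HasDerivAt f (f' t) t)
    (h0 : ∀ t ∈ Ioo a b, 0 ≤ f' t) : f a ≤ f b := by
  have : MonotoneOn f (Icc a b) := by
    refine monotoneOn_of_deriv_nonneg (convex_Icc a b) hf ?_ ?_
    · rw [interior_Icc]
      exact fun t ht => (hd t ht).differentiableAt.differentiableWithinAt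
    · rw [interior_Icc]
      intro t ht
      rw [(hd t ht).deriv]
      exact h0 t ht
  exact this (left_mem_Icc.2 hab) (right_mem_Icc.2 hab) hab

theorem gron {E E' : ℝ → ℝ} {a T c d : ℝ} (haT : a ≤ T) (hc : 0 ≤ c) (hd : 0 ≤ d)
    (hE : ContinuousOn E (Icc a T)) (hder : ∀ t ∈ Ioo a T, HasDerivAt E (E' t) t)
    (h : ∀ t ∈ Ioo a T, -(c * E t) - d ≤ E' t) (hT : E T = 0) :
    E a ≤ d * (Real.exp (c * (T - a)) * (T - a)) := by
  have hexp : ∀ t, HasDerivAt (fun t => Real.exp (c * t)) (Real.exp (c * t) * c) t := by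
    intro t
    have := ((hasDerivAt_id t).const_mul c).exp
    simpa using this
  have key := le_of_deriv_nonneg' (f := fun t => Real.exp (c * t) * E t + d * Real.exp (c * T) * t)
    (f' := fun t => (Real.exp (c * t) * c * E t + Real.exp (c * t) * E' t) + d * Real.exp (c * T))
    haT ?_ ?_ ?_
  · simp only [hT, mul_zero, zero_add] at key
    have e : Real.exp (c * T) = Real.exp (c * a) * Real.exp (c * (T - a)) := by
      rw [← Real.exp_add]; ring_nf
    rw [e] at key
    have hp := Real.exp_pos (c * a)
    refine le_of_mul_le_mul_left ?_ hp
    linarith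
  · refine ContinuousOn.add (ContinuousOn.mul ?_ hE) ?_
    · exact Continuous.continuousOn (by fun_prop)
    · exact Continuous.continuousOn (by fun_prop)
  · intro t ht
    refine ((hexp t).mul (hder t ht)).add ?_
    simpa using (hasDerivAt_id t).const_mul (d * Real.exp (c * T))
  · intro t ht
    have h1 := h t ht
    have h2 : Real.exp (c * t) ≤ Real.exp (c * T) := by
      apply Real.exp_le_exp.2
      exact mul_le_mul_of_nonneg_left ht.2.le hc
    have h3 := Real.exp_pos (c * t)
    have h4 := mul_le_mul_of_nonneg_left h1 h3.le
    have h5 := mul_le_mul_of_nonneg_left h2 hd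
    nlinarith

theorem blow {y y' : ℝ → ℝ} {a b C k : ℝ} (hab : a ≤ b) (hC : 0 ≤ C) (hk : 0 ≤ k)
    (hy : ContinuousOn y (Icc a b)) (hder : ∀ t ∈ Ioo a b, HasDerivAt y (y' t) t)
    (h : ∀ t ∈ Ioo a b, y' t ≤ C * y t - k * y t ^ 2) (hpos : 0 < y b) :
    k * (b - a) * Real.exp (-(C * (b - a))) * y b ≤ 1 := by
  have hexp : ∀ t, HasDerivAt (fun t => Real.exp (-C * t)) (Real.exp (-C * t) * -C) t := by
    intro t
    have := ((hasDerivAt_id t).const_mul (-C)).exp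
    simpa using this
  set u : ℝ → ℝ := fun t => Real.exp (-C * t) * y t with hu
  have hud : ∀ t ∈ Ioo a b, HasDerivAt u (Real.exp (-C * t) * -C * y t + Real.exp (-C * t) * y' t) t
    := fun t ht => (hexp t).mul (hder t ht)
  have huc : ContinuousOn u (Icc a b) :=
    ContinuousOn.mul (Continuous.continuousOn (by fun_prop)) hy
  have hdn : ∀ t ∈ Ioo a b, Real.exp (-C * t) * -C * y t + Real.exp (-C * t) * y' t
      ≤ - (k * Real.exp (C * t)) * u t ^ 2 := by
    intro t ht
    have h3 := Real.exp_pos (-C * t)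
    have h4 := mul_le_mul_of_nonneg_left (h t ht) h3.le
    have e : Real.exp (C * t) * Real.exp (-C * t) = 1 := by
      rw [← Real.exp_add]; ring_nf; exact Real.exp_zero
    have e2 : - (k * Real.exp (C * t)) * u t ^ 2 = - k * (Real.exp (C * t) * Real.exp (-C * t))
        * Real.exp (-C * t) * y t ^ 2 := by
      simp only [hu]; ring
    rw [e2, e]
    linarith
  have hub : 0 < u b := mul_pos (Real.exp_pos _) hpos
  have hupos : ∀ t ∈ Icc a b, 0 < u t := by
    intro t ht
    have := le_of_deriv_nonneg' (f := fun t => - u t) (f' := fun t =>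
      -(Real.exp (-C * t) * -C * y t + Real.exp (-C * t) * y' t)) ht.2
      ((huc.mono (Icc_subset_Icc_left ht.1)).neg)
      (fun s hs => (hud s ⟨lt_of_le_of_lt ht.1 hs.1, hs.2⟩).neg) ?_
    · simp only [neg_le_neg_iff] at this
      linarith
    · intro s hs
      have := hdn s ⟨lt_of_le_of_lt ht.1 hs.1, hs.2⟩
      have h2 : 0 ≤ (k * Real.exp (C * s)) * u s ^ 2 := by positivity
      linarith
  have key := le_of_deriv_nonneg' (f := fun t => (u t)⁻¹ - k * Real.exp (C * a) * t)
    (f' := fun t => -(Real.exp (-C * t) * -C * y t + Real.exp (-C * t) * y' t) / u t ^ 2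
      - k * Real.exp (C * a)) hab ?_ ?_ ?_
  · have ha := inv_pos.2 (hupos a (left_mem_Icc.2 hab))
    have h1 : k * Real.exp (C * a) * (b - a) ≤ (u b)⁻¹ := by
      linarith
    have h2 : k * Real.exp (C * a) * (b - a) * u b ≤ 1 := by
      rwa [← le_div_iff₀ hub, one_div]
    have e : Real.exp (C * a) * Real.exp (-C * b) = Real.exp (-(C * (b - a))) := by
      rw [← Real.exp_add]; ring_nf
    rw [← e]
    simp only [hu] at h2
    linarith
  · refine (huc.inv₀ fun t ht => (hupos t ht).ne').sub ?_
    exact Continuous.continuousOn (by fun_prop)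
  · intro t ht
    refine HasDerivAt.sub ((hud t ht).inv (hupos t (Ioo_subset_Icc_self ht)).ne') ?_
    simpa using (hasDerivAt_id t).const_mul (k * Real.exp (C * a))
  · intro t ht
    have hp := hupos t (Ioo_subset_Icc_self ht)
    have h1 := hdn t ht
    have h2 : Real.exp (C * a) ≤ Real.exp (C * t) := by
      apply Real.exp_le_exp.2
      exact mul_le_mul_of_nonneg_left ht.1.le hC
    have h3 : k * Real.exp (C * t) ≤
        -(Real.exp (-C * t) * -C * y t + Real.exp (-C * t) * y' t) / u t ^ 2 := by
      rw [le_div_iff₀ (by positivity)]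
      linarith
    have h4 := mul_le_mul_of_nonneg_left h2 hk
    linarith

end Scalar

section Mat
variable {n : ℕ}

theorem hd_entry {K : ℝ → Matrix (Fin n) (Fin n) ℝ} {K' : Matrix (Fin n) (Fin n) ℝ} {t : ℝ}
    (h : HasDerivAt K K' t) (i j : Fin n) : HasDerivAt (fun s => K s i j) (K' i j) t :=
  hasDerivAt_pi.1 (hasDerivAt_pi.1 h i) j

theorem hd_form {K : ℝ → Matrix (Fin n) (Fin n) ℝ} {K' : Matrix (Fin n) (Fin n) ℝ} {t : ℝ}
    (h : HasDerivAt K K' t) (v : Fin n → ℝ) :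
    HasDerivAt (fun s => v ⬝ᵥ (K s *ᵥ v)) (v ⬝ᵥ (K' *ᵥ v)) t := by
  simp only [dotProduct, mulVec]
  refine HasDerivAt.fun_sum fun i _ => HasDerivAt.const_mul _ ?_
  exact HasDerivAt.fun_sum fun j _ => HasDerivAt.mul_const (hd_entry h i j) _

theorem hd_trace {K : ℝ → Matrix (Fin n) (Fin n) ℝ} {K' : Matrix (Fin n) (Fin n) ℝ} {t : ℝ}
    (h : HasDerivAt K K' t) :
    HasDerivAt (fun s => (K s).trace) K'.trace t := by
  simp only [Matrix.trace, diag]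
  exact HasDerivAt.fun_sum fun i _ => hd_entry h i i

theorem co_entry {K : ℝ → Matrix (Fin n) (Fin n) ℝ} {s : Set ℝ}
    (h : ContinuousOn K s) (i j : Fin n) : ContinuousOn (fun t => K t i j) s :=
  continuousOn_pi.1 (continuousOn_pi.1 h i) j

theorem form_le_norm (A : Matrix (Fin n) (Fin n) ℝ) (v : Fin n → ℝ) (hv : v ⬝ᵥ v = 1) :
    |v ⬝ᵥ (A *ᵥ v)| ≤ n * n * ‖A‖ := by
  have h1 : ∀ i, |v i| ≤ 1 := by
    intro i
    have : v i * v i ≤ v ⬝ᵥ v :=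
      Finset.single_le_sum (f := fun k => v k * v k) (fun k _ => mul_self_nonneg _)
        (Finset.mem_univ i)
    rw [hv] at this
    exact abs_le_one_iff_mul_self_le_one.2 this
  simp only [dotProduct, mulVec]
  refine (Finset.abs_sum_le_sum_abs _ _).trans ?_
  refine (Finset.sum_le_card_nsmul _ _ (n * ‖A‖) ?_).trans (by simp [mul_assoc])
  intro i _
  rw [abs_mul]
  have : |∑ j, A i j * v j| ≤ n * ‖A‖ := by
    refine (Finset.abs_sum_le_sum_abs _ _).trans ?_
    refine (Finset.sum_le_card_nsmul _ _ (‖A‖) ?_).trans (by simp)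
    intro j _
    rw [abs_mul]
    exact (mul_le_mul (norm_entry_le_entrywise_sup_norm A) (h1 j) (abs_nonneg _)
      (norm_nonneg _)).trans (by simp)
  exact (mul_le_mul (h1 i) this (abs_nonneg _) zero_le_one).trans (by simp)

theorem entry_le_trace {K : Matrix (Fin n) (Fin n) ℝ} (hK : K.PosSemidef) (i j : Fin n) :
    |K i j| ≤ K.trace := by
  have hd : ∀ k, 0 ≤ K k k := fun k => hK.diag_nonneg
  have ht : ∀ k, K k k ≤ K.trace := fun k =>
    Finset.single_le_sum (f := fun k => K k k) (fun k _ => hd k) (Finset.mem_univ k)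
  have hs : K j i = K i j := congrFun (congrFun (psd_symm hK) i) j
  have key : ∀ c : ℝ, 0 ≤ K i i + 2 * c * K i j + c * c * K j j := by
    intro c
    have := psd_nonneg hK (Pi.single i 1 + c • Pi.single j 1)
    simp only [mulVec_add, mulVec_smul, mulVec_single_one, add_dotProduct, dotProduct_add,
      smul_dotProduct, dotProduct_smul, single_one_dotProduct, smul_eq_mul, col_apply, hs] at this
    linarith
  have h1 := key 1
  have h2 := key (-1)
  have h3 := ht i
  have h4 := ht j
  rw [abs_le]
  constructor <;> linarith

theorem norm_le_trace {K : Matrix (Fin n) (Fin n) ℝ} (hK : K.PosSemidef) : ‖K‖ ≤ K.trace := by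
  rw [Matrix.norm_le_iff hK.trace_nonneg]
  exact fun i j => entry_le_trace hK i j

theorem gronM {D D' : ℝ → Matrix (Fin n) (Fin n) ℝ} {a T C δ : ℝ} (haT : a ≤ T) (hC : 0 ≤ C)
    (hD : ContinuousOn D (Icc a T)) (hder : ∀ t ∈ Ioo a T, HasDerivAt D (D' t) t)
    (h : ∀ t ∈ Ioo a T, ‖D' t‖ ≤ C * (δ + ‖D t‖)) (hT : D T = 0) :
    ‖D a‖ ^ 2 ≤ (n * n * C * δ ^ 2) * (Real.exp (n * n * C * 3 * (T - a)) * (T - a)) := by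
  have hle : ∀ t, ‖D t‖ ^ 2 ≤ ∑ i, ∑ j, D t i j ^ 2 := by
    intro t
    have h0 : 0 ≤ ∑ i, ∑ j, D t i j ^ 2 :=
      Finset.sum_nonneg fun i _ => Finset.sum_nonneg fun j _ => sq_nonneg _
    have : ‖D t‖ ≤ Real.sqrt (∑ i, ∑ j, D t i j ^ 2) := by
      rw [Matrix.norm_le_iff (Real.sqrt_nonneg _)]
      intro i j
      apply Real.le_sqrt_of_sq_le
      rw [Real.norm_eq_abs, sq_abs]
      calc D t i j ^ 2 ≤ ∑ j, D t i j ^ 2 :=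
            Finset.single_le_sum (f := fun j => D t i j ^ 2) (fun j _ => sq_nonneg _)
              (Finset.mem_univ j)
        _ ≤ ∑ i, ∑ j, D t i j ^ 2 :=
            Finset.single_le_sum (f := fun i => ∑ j, D t i j ^ 2)
              (fun i _ => Finset.sum_nonneg fun j _ => sq_nonneg _) (Finset.mem_univ i)
    calc ‖D t‖ ^ 2 ≤ Real.sqrt (∑ i, ∑ j, D t i j ^ 2) ^ 2 :=
          pow_le_pow_left₀ (norm_nonneg _) this 2
      _ = _ := Real.sq_sqrt h0
  refine (hle a).trans ?_
  refine gron (E := fun t => ∑ i, ∑ j, D t i j ^ 2)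
    (E' := fun t => ∑ i, ∑ j, 2 * D t i j * D' t i j) haT (by positivity) (by positivity) ?_ ?_ ?_ ?_
  · refine continuousOn_finsetSum _ fun i _ => continuousOn_finsetSum _ fun j _ => ?_
    exact (co_entry hD i j).pow 2
  · intro t ht
    refine HasDerivAt.fun_sum fun i _ => HasDerivAt.fun_sum fun j _ => ?_
    have := (hd_entry (hder t ht) i j).fun_pow 2
    simpa using this
  · intro t ht
    have h1 := h t ht
    have h2 := hle t
    have h3 : ∀ i j, -(C * (3 * ‖D t‖ ^ 2 + δ ^ 2)) ≤ 2 * D t i j * D' t i j := by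
      intro i j
      have a1 : |D t i j| ≤ ‖D t‖ := norm_entry_le_entrywise_sup_norm (D t)
      have a2 : |D' t i j| ≤ ‖D' t‖ := norm_entry_le_entrywise_sup_norm (D' t)
      have a3 : |D t i j * D' t i j| ≤ ‖D t‖ * (C * (δ + ‖D t‖)) := by
        rw [abs_mul]
        exact mul_le_mul a1 (a2.trans h1) (abs_nonneg _) (norm_nonneg _)
      have a4 := (abs_le.1 a3).1
      have a5 : 0 ≤ C * (‖D t‖ - δ) ^ 2 := by positivity
      nlinarith
    have h4 : -(n * n * (C * (3 * ‖D t‖ ^ 2 + δ ^ 2))) ≤ ∑ i, ∑ j, 2 * D t i j * D' t i j := by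
      have : ∑ i : Fin n, ∑ j : Fin n, -(C * (3 * ‖D t‖ ^ 2 + δ ^ 2))
          ≤ ∑ i, ∑ j, 2 * D t i j * D' t i j :=
        Finset.sum_le_sum fun i _ => Finset.sum_le_sum fun j _ => h3 i j
      simp only [Finset.sum_const, Finset.card_univ, Fintype.card_fin, nsmul_eq_mul] at this
      linarith
    have h5 := mul_le_mul_of_nonneg_left h2 (show 0 ≤ n * n * C * 3 by positivity)
    linarith
  · simp [hT]

theorem compact_sphere' : IsCompact {v : Fin n → ℝ | v ⬝ᵥ v = 1} := by
  have hcl : IsClosed {v : Fin n → ℝ | v ⬝ᵥ v = 1} :=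
    isClosed_eq (by fun_prop) continuous_const
  refine (isCompact_closedBall (0 : Fin n → ℝ) 1).of_isClosed_subset hcl ?_
  intro v hv
  rw [mem_closedBall_zero_iff, pi_norm_le_iff_of_nonneg zero_le_one]
  intro i
  have : v i * v i ≤ v ⬝ᵥ v :=
    Finset.single_le_sum (f := fun k => v k * v k) (fun k _ => mul_self_nonneg _)
      (Finset.mem_univ i)
  rw [show v ⬝ᵥ v = 1 from hv] at this
  exact abs_le_one_iff_mul_self_le_one.2 this

end Mat

namespace Dat
variable {n : ℕ} {T β : ℝ} (d : Dat n T β)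

theorem trace_lower (hβ : 0 < β) (hn : 1 ≤ n) (a : ℝ) : ∃ C : ℝ, 0 ≤ C ∧ ∀ t, a ≤ t → t ≤ T →
    ∀ ϱ ≤ (0 : ℝ), ∀ K : Matrix (Fin n) (Fin n) ℝ, K.PosSemidef →
    -(C * K.trace) + n * β + (-ϱ) * β / n * K.trace ^ 2 ≤ (d.R ϱ t K).trace := by
  have hI : IsCompact (Icc a T) := isCompact_Icc
  obtain ⟨A, hA⟩ := hI.exists_bound_of_continuousOn d.hc21.continuousOn
  refine ⟨2 * (n * (n * |A|)), by positivity, fun t h1 h2 ϱ hϱ K hK => ?_⟩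
  have hA' : ‖d.H21 t‖ ≤ |A| := (hA t ⟨h1, h2⟩).trans (le_abs_self A)
  have hnp : (0 : ℝ) < n := by exact_mod_cast hn
  have key : ∀ i : Fin n, -(2 * (n * |A|) * K.trace) + β + (-ϱ) * β * K i i ^ 2
      ≤ (d.R ϱ t K) i i := by
    intro i
    have l := d.lower hβ h2 hϱ hK (Pi.single i 1)
    simp only [mulVec_single_one, single_one_dotProduct, col_apply, Pi.single_eq_same] at l
    have b1 : |K.col i ⬝ᵥ (d.H21 t).col i| ≤ n * (K.trace * |A|) := by
      simp only [dotProduct]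
      refine (Finset.abs_sum_le_sum_abs _ _).trans ?_
      refine (Finset.sum_le_card_nsmul _ _ (K.trace * |A|) ?_).trans (by simp)
      intro j _
      rw [abs_mul]
      exact mul_le_mul (entry_le_trace hK j i) ((norm_entry_le_entrywise_sup_norm _).trans hA')
        (abs_nonneg _) hK.trace_nonneg
    have b2 := (abs_le.1 b1).1
    have b3 : K i i * K i i ≤ K.col i ⬝ᵥ K.col i :=
      Finset.single_le_sum (f := fun k => K k i * K k i) (fun k _ => mul_self_nonneg _)
        (Finset.mem_univ i)
    have b4 := mul_le_mul_of_nonneg_left b3 (show 0 ≤ (-ϱ) * β by nlinarith)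
    nlinarith
  have s := Finset.sum_le_sum fun i (_ : i ∈ (Finset.univ : Finset (Fin n))) => key i
  rw [Finset.sum_add_distrib, Finset.sum_add_distrib, ← Finset.mul_sum] at s
  simp only [Finset.sum_const, Finset.card_univ, Fintype.card_fin, nsmul_eq_mul] at s
  have q : K.trace ^ 2 ≤ n * ∑ i, K i i ^ 2 := by
    have := sq_sum_le_card_mul_sum_sq (s := (Finset.univ : Finset (Fin n))) (f := fun i => K i i)
    simpa [Matrix.trace, diag] using this
  have q2 : K.trace ^ 2 / n ≤ ∑ i, K i i ^ 2 := by
    rw [div_le_iff₀ hnp]; linarith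
  have q3 := mul_le_mul_of_nonneg_left q2 (show 0 ≤ (-ϱ) * β by nlinarith)
  have e : (-ϱ) * β / n * K.trace ^ 2 = (-ϱ) * β * (K.trace ^ 2 / n) := by ring
  rw [e]
  change _ ≤ (d.R ϱ t K).trace at s
  linarith

end Dat

/-- A maximal solution of the Riccati equation. -/
structure Sol {n : ℕ} {T β : ℝ} (d : Dat n T β) (ϱ : ℝ) (K : ℝ → Matrix (Fin n) (Fin n) ℝ)
    (tb : EReal) : Prop where
  htbT : tb < (T : EReal)
  hterm : K T = 0
  hcont : ContinuousOn K {t : ℝ | tb < (t : EReal) ∧ t ≤ T}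
  hode : ∀ t : ℝ, tb < (t : EReal) → t < T → HasDerivAt K (-(d.R ϱ t (K t))) t
  hpsd : ∀ t : ℝ, tb < (t : EReal) → t ≤ T → (K t).PosSemidef
  hblow : ⊥ < tb → Tendsto (fun t => ‖K t‖) (nhdsWithin tb.toReal (Set.Ioi tb.toReal)) atTop

theorem deriv_nonneg_of_right_min {g : ℝ → ℝ} {g' x b : ℝ} (hg : HasDerivAt g g' x) (hx : x < b)
    (h : ∀ t ∈ Ioo x b, g x ≤ g t) : 0 ≤ g' := by
  have h1 := (hasDerivWithinAt_iff_tendsto_slope' (s := Ioi x) (by simp)).1 hg.hasDerivWithinAt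
  refine ge_of_tendsto h1 ?_
  filter_upwards [Ioo_mem_nhdsGT hx] with t ht
  rw [slope_def_field]
  exact div_nonneg (by linarith [h t ht]) (by linarith [ht.1])

namespace Sol
variable {n : ℕ} {T β : ℝ} {d : Dat n T β} {ϱ : ℝ} {K : ℝ → Matrix (Fin n) (Fin n) ℝ}
    {tb : EReal}

theorem lt_of_le (_S : Sol d ϱ K tb) {a t : ℝ} (ha : tb < (a : EReal)) (h : a ≤ t) :
    tb < (t : EReal) := ha.trans_le (by exact_mod_cast h)

theorem cont_Icc (S : Sol d ϱ K tb) {a : ℝ} (ha : tb < (a : EReal)) :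
    ContinuousOn K (Icc a T) :=
  S.hcont.mono fun _ ht => ⟨S.lt_of_le ha ht.1, ht.2⟩

/-- blow-up: if `a ≤ tb`, solution is unbounded on `(tb, T)`. -/
theorem unbdd (S : Sol d ϱ K tb) {a : ℝ} (ha : (a : EReal) ≤ tb) (M b : ℝ)
    (hb : tb < (b : EReal)) :
    ∃ t : ℝ, tb < (t : EReal) ∧ t < b ∧ t < T ∧ a < t ∧ M < ‖K t‖ := by
  have hbot : ⊥ < tb := lt_of_lt_of_le (EReal.bot_lt_coe a) ha
  have htop : tb ≠ ⊤ := (S.htbT.trans_le le_top).ne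
  have hr : ((tb.toReal : ℝ) : EReal) = tb := EReal.coe_toReal htop hbot.ne'
  have hbl := S.hblow hbot
  have h1 : tb.toReal < T := by
    have := S.htbT
    rw [← hr] at this
    exact_mod_cast this
  have h2 : tb.toReal < b := by
    rw [← hr] at hb
    exact_mod_cast hb
  have h3 : a ≤ tb.toReal := by
    rw [← hr] at ha
    exact_mod_cast ha
  have e := (hbl.eventually (eventually_gt_atTop M)).and
    (Ioo_mem_nhdsGT (lt_min h1 h2))
  obtain ⟨t, ht, ht2⟩ := e.exists
  refine ⟨t, ?_, ht2.2.trans_le (min_le_right _ _), ht2.2.trans_le (min_le_left _ _),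
    h3.trans_lt ht2.1, ht⟩
  rw [← hr]
  exact_mod_cast ht2.1

theorem bdd (S : Sol d ϱ K tb) {a : ℝ} (ha : tb < (a : EReal)) :
    ∃ r : ℝ, 0 ≤ r ∧ ∀ t ∈ Icc a T, ‖K t‖ ≤ r := by
  obtain ⟨C, hC⟩ := isCompact_Icc.exists_bound_of_continuousOn (S.cont_Icc ha)
  exact ⟨|C|, abs_nonneg _, fun t ht => (hC t ht).trans (le_abs_self _)⟩

/-- At `ϱ = 0` the solution is global. -/
theorem tb_zero (S : Sol d 0 K tb) (a : ℝ) : tb < (a : EReal) := by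
  by_contra hcon
  rw [not_lt] at hcon
  obtain ⟨C, hC, hl⟩ := d.lin0 a
  set M := (n * n * C * 1 ^ 2) * (Real.exp (n * n * C * 3 * (T - a)) * (T - a))
  obtain ⟨t, h1, -, h3, h4, h5⟩ := S.unbdd hcon (|M| + 1) T S.htbT
  have g := gronM (D := K) (D' := fun t => -(d.R 0 t (K t))) (δ := 1) h3.le hC (S.cont_Icc h1)
    (fun s hs => S.hode s (S.lt_of_le h1 hs.1.le) hs.2) ?_ S.hterm
  · have : (n * n * C * 1 ^ 2) * (Real.exp (n * n * C * 3 * (T - t)) * (T - t)) ≤ M := by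
      have : 0 ≤ T - t := by linarith
      simp only [M]
      gcongr
    have h6 : ‖K t‖ ^ 2 ≤ |M| := g.trans (this.trans (le_abs_self _))
    nlinarith [abs_nonneg M]
  · intro s hs
    rw [norm_neg]
    exact hl s (h4.trans hs.1).le hs.2.le _

theorem CD {K : ℝ → ℝ → Matrix (Fin n) (Fin n) ℝ} {tb : ℝ → EReal} (hβ : 0 < β)
    (S : ∀ ϱ, Sol d ϱ (K ϱ) (tb ϱ)) {ϱ₀ a : ℝ} (ha : tb ϱ₀ < (a : EReal)) (haT : a ≤ T)
    {ε : ℝ} (hε : 0 < ε) : ∃ δ > 0, ∀ ϱ', |ϱ' - ϱ₀| < δ →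
      tb ϱ' < (a : EReal) ∧ ‖K ϱ' a - K ϱ₀ a‖ < ε := by
  obtain ⟨r0, hr0, hr⟩ := (S ϱ₀).bdd ha
  obtain ⟨C, hC, hl⟩ := d.lip hβ a (r0 + 1 + |ϱ₀|)
  set M := (n * n * C) * (Real.exp (n * n * C * 3 * (T - a)) * (T - a)) with hM
  have hTa : 0 ≤ T - a := by linarith
  have hM0 : 0 ≤ M := by positivity
  set m := min 1 ε with hm
  have hm0 : 0 < m := lt_min one_pos hε
  have hm1 : m ≤ 1 := min_le_left _ _
  refine ⟨m / (M + 1), by positivity, fun ϱ' hϱ => ?_⟩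
  have hϱ1 : |ϱ' - ϱ₀| ≤ 1 := by
    refine hϱ.le.trans ((div_le_self hm0.le (by linarith)).trans hm1)
  have hϱr : |ϱ'| ≤ r0 + 1 + |ϱ₀| := by
    have := abs_sub_abs_le_abs_sub ϱ' ϱ₀
    linarith
  have hsmall : |ϱ' - ϱ₀| ^ 2 * M < m ^ 2 := by
    have h1 : |ϱ' - ϱ₀| ^ 2 * M ≤ (m / (M + 1)) ^ 2 * M := by gcongr
    have h2 : (m / (M + 1)) ^ 2 * M < m ^ 2 := by
      rw [div_pow, div_mul_eq_mul_div, div_lt_iff₀ (by positivity)]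
      have h3 : 0 < m ^ 2 := by positivity
      have h4 : M < (M + 1) ^ 2 := by nlinarith
      exact mul_lt_mul_of_pos_left h4 h3
    linarith
  have claim : ∀ t : ℝ, a ≤ t → t ≤ T → tb ϱ' < (t : EReal) → ‖K ϱ' t - K ϱ₀ t‖ < m := by
    intro t0 h1 h2 h3
    by_contra hcon
    rw [not_lt] at hcon
    have hDc : ContinuousOn (fun t => K ϱ' t - K ϱ₀ t) (Icc t0 T) :=
      ((S ϱ').cont_Icc h3).sub ((S ϱ₀).cont_Icc ((S ϱ₀).lt_of_le ha h1))
    have hcomp : IsCompact (Icc t0 T ∩ (fun t => ‖K ϱ' t - K ϱ₀ t‖) ⁻¹' Ici m) :=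
      isCompact_Icc.of_isClosed_subset (hDc.norm.preimage_isClosed_of_isClosed isClosed_Icc
        isClosed_Ici) inter_subset_left
    obtain ⟨ts, hts, hmax⟩ := hcomp.exists_isGreatest ⟨t0, left_mem_Icc.2 h2, hcon⟩
    have hts0 := hts.1.1
    have hlt : ∀ s ∈ Ioo ts T, ‖K ϱ' s - K ϱ₀ s‖ < m := by
      intro s hs
      by_contra hc
      rw [not_lt] at hc
      have := hmax ⟨⟨hts0.trans hs.1.le, hs.2.le⟩, hc⟩
      linarith [hs.1]
    have g := gronM (D := fun t => K ϱ' t - K ϱ₀ t)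
      (D' := fun t => -(d.R ϱ' t (K ϱ' t)) - -(d.R ϱ₀ t (K ϱ₀ t))) (δ := |ϱ' - ϱ₀|) hts.1.2 hC
      (hDc.mono (Icc_subset_Icc_left hts0)) ?_ ?_ (by simp [(S _).hterm])
    · have e1 : ts ∈ Icc t0 T := hts.1
      have : (n * n * C * |ϱ' - ϱ₀| ^ 2) * (Real.exp (n * n * C * 3 * (T - ts)) * (T - ts))
          ≤ |ϱ' - ϱ₀| ^ 2 * M := by
        have h5 : 0 ≤ T - ts := by linarith [e1.2]
        have h6 : T - ts ≤ T - a := by linarith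
        have : (n * n * C) * (Real.exp (n * n * C * 3 * (T - ts)) * (T - ts)) ≤ M := by
          simp only [hM]
          gcongr
        nlinarith [sq_nonneg |ϱ' - ϱ₀|]
      have h7 : m ≤ ‖K ϱ' ts - K ϱ₀ ts‖ := hts.2
      have h8 : m ^ 2 ≤ ‖K ϱ' ts - K ϱ₀ ts‖ ^ 2 := pow_le_pow_left₀ hm0.le h7 2
      linarith
    · intro s hs
      have hs0 : t0 ≤ s := hts0.trans hs.1.le
      exact ((S ϱ').hode s ((S ϱ').lt_of_le h3 hs0) hs.2).sub
        ((S ϱ₀).hode s ((S ϱ₀).lt_of_le ha (h1.trans hs0)) hs.2)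
    · intro s hs
      have hs0 : t0 ≤ s := hts0.trans hs.1.le
      have e : -(d.R ϱ' s (K ϱ' s)) - -(d.R ϱ₀ s (K ϱ₀ s))
        = -(d.R ϱ' s (K ϱ' s) - d.R ϱ₀ s (K ϱ₀ s)) := by abel
      have k0 : ‖K ϱ₀ s‖ ≤ r0 := hr s ⟨h1.trans hs0, hs.2.le⟩
      have k1 : ‖K ϱ' s‖ ≤ r0 + 1 := by
        have e2 : K ϱ' s = (K ϱ' s - K ϱ₀ s) + K ϱ₀ s := by abel
        rw [e2]
        refine (norm_add_le _ _).trans ?_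
        linarith [hlt s hs]
      have ab := abs_nonneg ϱ₀
      simp only [e, norm_neg]
      exact hl s (h1.trans hs0) hs.2.le ϱ' ϱ₀ hϱr (by linarith) _ _
        ((S ϱ').hpsd s ((S ϱ').lt_of_le h3 hs0) hs.2.le)
        ((S ϱ₀).hpsd s ((S ϱ₀).lt_of_le ha (h1.trans hs0)) hs.2.le) (by linarith) (by linarith)
  have htb : tb ϱ' < (a : EReal) := by
    by_contra hcon
    rw [not_lt] at hcon
    obtain ⟨t, h1, -, h3, h4, h5⟩ := (S ϱ').unbdd hcon (r0 + 1) T (S ϱ').htbT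
    have c := claim t h4.le h3.le h1
    have k0 : ‖K ϱ₀ t‖ ≤ r0 := hr t ⟨h4.le, h3.le⟩
    have e2 : K ϱ' t = (K ϱ' t - K ϱ₀ t) + K ϱ₀ t := by abel
    have := norm_add_le (K ϱ' t - K ϱ₀ t) (K ϱ₀ t)
    rw [← e2] at this
    linarith
  exact ⟨htb, (claim a le_rfl haT htb).trans_le (min_le_right _ _)⟩

theorem co_trace (S : Sol d ϱ K tb) {a b : ℝ} (ha : tb < (a : EReal)) (hb : b ≤ T) :
    ContinuousOn (fun t => (K t).trace) (Icc a b) := by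
  have h := (S.cont_Icc ha).mono (Icc_subset_Icc_right hb)
  simp only [Matrix.trace, diag]
  exact continuousOn_finsetSum _ fun i _ => co_entry h i i

theorem exists_zero {K : ℝ → ℝ → Matrix (Fin n) (Fin n) ℝ} {tb : ℝ → EReal} (hβ : 0 < β)
    (hn : 1 ≤ n) (hT : 0 < T)
    (S : ∀ ϱ, Sol d ϱ (K ϱ) (tb ϱ)) : ∃ ϱ < 0, tb ϱ = ((0 : ℝ) : EReal) := by
  by_contra hcon
  push Not at hcon
  obtain ⟨C, hC, htr⟩ := d.trace_lower hβ hn 0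
  have hnp : (0 : ℝ) < n := by exact_mod_cast hn
  -- blow-up estimate for the trace
  have hblow : ∀ ϱ < (0 : ℝ), ∀ a b : ℝ, 0 ≤ a → a ≤ b → b ≤ T → tb ϱ < (a : EReal) →
      0 < (K ϱ b).trace →
      (-ϱ) * β / n * (b - a) * Real.exp (-(C * (b - a))) * (K ϱ b).trace ≤ 1 := by
    intro ϱ hϱ a b h0 hab hb ha hp
    refine blow (y := fun t => (K ϱ t).trace) (y' := fun t => (-(d.R ϱ t (K ϱ t))).trace) hab hC
      ?_ ((S ϱ).co_trace ha hb) ?_ ?_ hp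
    · have : 0 < -ϱ := by linarith
      positivity
    · exact fun t ht => hd_trace ((S ϱ).hode t ((S ϱ).lt_of_le ha ht.1.le) (ht.2.trans_le hb))
    · intro t ht
      have htT : t ≤ T := ht.2.le.trans hb
      have := htr t (h0.trans ht.1.le) htT ϱ hϱ.le (K ϱ t)
        ((S ϱ).hpsd t ((S ϱ).lt_of_le ha ht.1.le) htT)
      rw [trace_neg]
      have : 0 < n * β := by positivity
      linarith
  set A : Set ℝ := {ϱ | tb ϱ < ((0 : ℝ) : EReal)} with hA
  set B : Set ℝ := {ϱ | ϱ < 0 ∧ ((0 : ℝ) : EReal) < tb ϱ} with hB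
  have hAo : IsOpen A := by
    rw [Metric.isOpen_iff]
    intro ϱ hϱ
    obtain ⟨δ, hδ, h⟩ := CD hβ S hϱ hT.le one_pos
    exact ⟨δ, hδ, fun x hx => (h x (by simpa [Real.dist_eq] using hx)).1⟩
  have hBo : IsOpen B := by
    rw [Metric.isOpen_iff]
    rintro ϱ ⟨hϱ, hϱ2⟩
    have hbot : ⊥ < tb ϱ := lt_of_lt_of_le (EReal.bot_lt_coe 0) hϱ2.le
    have htop : tb ϱ ≠ ⊤ := ((S ϱ).htbT.trans_le le_top).ne
    have hr : (((tb ϱ).toReal : ℝ) : EReal) = tb ϱ := EReal.coe_toReal htop hbot.ne'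
    set r := (tb ϱ).toReal with hrdef
    have hr0 : 0 < r := by rw [← hr] at hϱ2; exact_mod_cast hϱ2
    set c := (-(ϱ / 2)) * β / n * (r / 2) * Real.exp (-(C * T)) with hc
    have hc0 : 0 < c := by
      have : 0 < -(ϱ / 2) := by linarith
      positivity
    obtain ⟨t, h1, -, h3, h4, h5⟩ := (S ϱ).unbdd hr.le (1 / c + n) T (S ϱ).htbT
    obtain ⟨δ, hδ, h⟩ := CD hβ S h1 h3.le one_pos
    refine ⟨min δ (-(ϱ / 2)), lt_min hδ (by linarith), fun x hx => ?_⟩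
    rw [Metric.mem_ball, Real.dist_eq, lt_min_iff] at hx
    have hx0 : x < ϱ / 2 := by have := (abs_lt.1 hx.2).2; linarith
    refine ⟨by linarith, ?_⟩
    obtain ⟨k1, k2⟩ := h x hx.1
    by_contra hcon2
    rw [not_lt] at hcon2
    have htT : t ≤ T := h3.le
    have tr1 := norm_le_trace ((S ϱ).hpsd t h1 htT)
    have tr2 : |(K ϱ t).trace - (K x t).trace| ≤ n := by
      rw [← trace_sub]
      simp only [Matrix.trace, diag]
      refine (Finset.abs_sum_le_sum_abs _ _).trans ?_
      refine (Finset.sum_le_card_nsmul _ _ 1 ?_).trans (by simp)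
      intro i _
      have e : ‖K x t - K ϱ t‖ = ‖K ϱ t - K x t‖ := norm_sub_rev _ _
      have := norm_entry_le_entrywise_sup_norm (K ϱ t - K x t) (i := i) (j := i)
      rw [Real.norm_eq_abs] at this
      linarith
    have tr3 : 1 / c < (K x t).trace := by
      have := (abs_le.1 tr2).2
      linarith
    have hxp : 0 < (K x t).trace := lt_trans (by positivity) tr3
    have b := hblow x (by linarith) (r / 2) t (by linarith) (by linarith) htT
      (lt_of_le_of_lt hcon2 (by exact_mod_cast half_pos hr0)) hxp
    have : c * (K x t).trace ≤ 1 := by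
      refine le_trans ?_ b
      have hx1 : -(ϱ / 2) ≤ -x := by linarith
      have hϱp : 0 ≤ -(ϱ / 2) := by linarith
      have hx2 : 0 ≤ -x := by linarith
      have hr1 : r / 2 ≤ t - r / 2 := by linarith
      have he : -(C * T) ≤ -(C * (t - r / 2)) := by
        have : C * (t - r / 2) ≤ C * T := mul_le_mul_of_nonneg_left (by linarith) hC
        linarith
      have hq : 0 ≤ t - r / 2 := by linarith
      simp only [hc]
      gcongr ?_ * ?_
      gcongr ?_ * ?_
      · have := div_nonneg (mul_nonneg hx2 hβ.le) hnp.le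
        gcongr
      · gcongr
    rw [div_lt_iff₀ hc0] at tr3
    linarith
  have hcov : Iio (0 : ℝ) ⊆ A ∪ B := by
    intro x hx
    rcases lt_trichotomy (tb x) ((0 : ℝ) : EReal) with h | h | h
    · exact Or.inl h
    · exact absurd h (hcon x hx)
    · exact Or.inr ⟨hx, h⟩
  have hAne : (Iio (0 : ℝ) ∩ A).Nonempty := by
    have h0 : (0 : ℝ) ∈ A := (S 0).tb_zero 0
    obtain ⟨δ, hδ, h⟩ := Metric.isOpen_iff.1 hAo 0 h0
    refine ⟨-(δ / 2), by simpa using hδ, h ?_⟩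
    rw [Metric.mem_ball, Real.dist_eq, abs_lt]
    constructor <;> linarith
  have hBne : (Iio (0 : ℝ) ∩ B).Nonempty := by
    set Y := n * β * T / 4 with hY
    have hY0 : 0 < Y := by positivity
    set c := β / n * (T / 4) * Real.exp (-(C * (T / 4))) * Y with hc
    have hc0 : 0 < c := by positivity
    set N := C ^ 2 / β ^ 2 + 1 / c + 1 with hN
    have hN0 : 0 < N := by positivity
    refine ⟨-N, by simpa using hN0, by simpa using hN0, ?_⟩
    by_contra hcon2
    rw [not_lt] at hcon2
    have hlt : ∀ s : ℝ, 0 < s → tb (-N) < (s : EReal) := fun s hs =>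
      lt_of_le_of_lt hcon2 (by exact_mod_cast hs)
    have tY : Y ≤ (K (-N) (T / 2)).trace := by
      have g := le_of_deriv_nonneg' (f := fun t => -(K (-N) t).trace - n * β / 2 * t)
        (f' := fun t => -(-(d.R (-N) t (K (-N) t))).trace - n * β / 2)
        (show T / 2 ≤ T by linarith) ?_ ?_ ?_
      · simp only [(S _).hterm, trace_zero] at g
        simp only [hY]
        linarith
      · refine ((S _).co_trace (hlt _ (by linarith)) le_rfl).neg.sub ?_
        exact Continuous.continuousOn (by fun_prop)
      · intro t ht
        have ht0 : 0 < t := by linarith [ht.1]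
        refine HasDerivAt.sub (hd_trace ((S _).hode t (hlt t ht0) ht.2)).neg ?_
        simpa using (hasDerivAt_id t).const_mul (n * β / 2)
      · intro t ht
        have ht0 : 0 < t := by linarith [ht.1]
        have l := htr t ht0.le ht.2.le (-N) (by linarith) (K (-N) t)
          ((S _).hpsd t (hlt t ht0) ht.2.le)
        rw [trace_neg, neg_neg]
        set y := (K (-N) t).trace
        have hNn : C ^ 2 / β ^ 2 ≤ N := by
          simp only [hN]
          have : 0 < 1 / c := by positivity
          linarith
        have hNn2 : C ^ 2 ≤ N * β ^ 2 := by rwa [div_le_iff₀ (by positivity)] at hNn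
        have q : C * y ≤ n * β / 2 + N * β / n * y ^ 2 := by
          have q1 : 0 ≤ (n * β - C * y) ^ 2 := sq_nonneg _
          have q2 : C ^ 2 * y ^ 2 ≤ N * β ^ 2 * y ^ 2 :=
            mul_le_mul_of_nonneg_right hNn2 (sq_nonneg _)
          have q3 : 0 ≤ N * β ^ 2 * y ^ 2 := by positivity
          have q4 : (C * y) * (n * β) ≤ (n * β / 2 + N * β / n * y ^ 2) * (n * β) := by
            have : (n * β / 2 + N * β / n * y ^ 2) * (n * β)
              = (n * β) ^ 2 / 2 + N * β ^ 2 * y ^ 2 := by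
              field_simp
            rw [this]
            nlinarith
          exact le_of_mul_le_mul_right q4 (by positivity)
        simp only [neg_neg] at l
        linarith
    have b := hblow (-N) (by linarith) (T / 4) (T / 2) (by linarith) (by linarith) (by linarith)
      (hlt _ (by linarith)) (hY0.trans_le tY)
    have e : T / 2 - T / 4 = T / 4 := by ring
    rw [e, neg_neg] at b
    have h1 : N * c ≤ 1 := by
      refine le_trans ?_ b
      have : N * c = N * β / n * (T / 4) * Real.exp (-(C * (T / 4))) * Y := by
        simp only [hc]; ring
      rw [this]
      gcongr
    have h2 : 1 < N * c := by
      have : N * c = C ^ 2 / β ^ 2 * c + 1 + c := by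
        simp only [hN, add_mul, one_mul]
        rw [one_div, inv_mul_cancel₀ hc0.ne']
      rw [this]
      have : 0 ≤ C ^ 2 / β ^ 2 * c := by positivity
      linarith
    linarith
  obtain ⟨x, -, hx1, hx2⟩ := isPreconnected_Iio A B hAo hBo hcov hAne hBne
  exact lt_asymm hx1 hx2.2

end Sol

namespace Sol
variable {n : ℕ} {T β : ℝ} {d : Dat n T β}

theorem compare (hβ : 0 < β) {ϱ₁ ϱ₂ : ℝ} {K₁ K₂ : ℝ → Matrix (Fin n) (Fin n) ℝ} {tb₁ tb₂ : EReal}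
    (h12 : ϱ₁ ≤ ϱ₂) (h2 : ϱ₂ ≤ 0) (S₁ : Sol d ϱ₁ K₁ tb₁) (S₂ : Sol d ϱ₂ K₂ tb₂) {a : ℝ}
    (ha₁ : tb₁ < (a : EReal)) (ha₂ : tb₂ < (a : EReal)) (haT : a ≤ T) (v : Fin n → ℝ) :
    v ⬝ᵥ (K₂ a *ᵥ v) ≤ v ⬝ᵥ (K₁ a *ᵥ v) := by
  by_contra hcon
  rw [not_le] at hcon
  obtain ⟨r₁, hr₁, hb₁⟩ := S₁.bdd ha₁
  obtain ⟨r₂, hr₂, hb₂⟩ := S₂.bdd ha₂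
  set c1 := ‖(1 : Matrix (Fin n) (Fin n) ℝ)‖ with hc1
  have hc10 : 0 ≤ c1 := norm_nonneg _
  set r := r₁ + r₂ + n * n * (r₁ + r₂) * c1 + |ϱ₂| with hr
  obtain ⟨C, hC, hl⟩ := d.lip hβ a r
  set L := n * n * C * c1 + 1 with hL
  have hscale : ∀ (A : Matrix (Fin n) (Fin n) ℝ) (c : ℝ) (w : Fin n → ℝ),
      (c • w) ⬝ᵥ (A *ᵥ (c • w)) = c ^ 2 * (w ⬝ᵥ (A *ᵥ w)) := by
    intro A c w
    rw [mulVec_smul, smul_dotProduct, dotProduct_smul, smul_eq_mul, smul_eq_mul]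
    ring
  set D : ℝ → Matrix (Fin n) (Fin n) ℝ := fun t => K₁ t - K₂ t with hD
  have hDc : ContinuousOn D (Icc a T) := (S₁.cont_Icc ha₁).sub (S₂.cont_Icc ha₂)
  have hDv : ∀ t w, w ⬝ᵥ (D t *ᵥ w) = w ⬝ᵥ (K₁ t *ᵥ w) - w ⬝ᵥ (K₂ t *ᵥ w) := by
    intro t w
    simp only [hD, sub_mulVec, dotProduct_sub]
  -- normalised vectors
  have hnorm : ∀ w : Fin n → ℝ, w ≠ 0 → ∃ c : ℝ, 0 < c ∧ c ^ 2 * (w ⬝ᵥ w) = 1 ∧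
      (c • w) ⬝ᵥ (c • w) = 1 := by
    intro w hw
    have hp := dp_self_pos hw
    have e : (1 / Real.sqrt (w ⬝ᵥ w)) ^ 2 * (w ⬝ᵥ w) = 1 := by
      rw [div_pow, Real.sq_sqrt hp.le]
      field_simp
    refine ⟨1 / Real.sqrt (w ⬝ᵥ w), by positivity, e, ?_⟩
    rw [smul_dotProduct, dotProduct_smul, smul_eq_mul, smul_eq_mul, ← mul_assoc, ← sq, e]
  have hv0 : v ≠ 0 := by
    rintro rfl
    simp at hcon
  set φ : ℝ × (Fin n → ℝ) → ℝ := fun p => Real.exp (L * p.1) * (p.2 ⬝ᵥ (D p.1 *ᵥ p.2)) with hφ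
  have hφc : ContinuousOn φ (Icc a T ×ˢ {v : Fin n → ℝ | v ⬝ᵥ v = 1}) := by
    have h1 : ContinuousOn (fun p : ℝ × (Fin n → ℝ) => D p.1)
        (Icc a T ×ˢ {v : Fin n → ℝ | v ⬝ᵥ v = 1}) :=
      hDc.comp continuous_fst.continuousOn fun p hp => hp.1
    have h2 : Continuous fun q : Matrix (Fin n) (Fin n) ℝ × (Fin n → ℝ) =>
        q.2 ⬝ᵥ (q.1 *ᵥ q.2) := by fun_prop
    have h3 := h2.comp_continuousOn (h1.prodMk continuous_snd.continuousOn)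
    refine ContinuousOn.mul ?_ h3
    exact Continuous.continuousOn (by fun_prop)
  obtain ⟨c, hc, hce, hcu⟩ := hnorm v hv0
  obtain ⟨⟨ts, vs⟩, ⟨hts, hvs⟩, hmin⟩ := (isCompact_Icc.prod compact_sphere').exists_isMinOn
    ⟨(a, c • v), ⟨left_mem_Icc.2 haT, hcu⟩⟩ hφc
  have hvs1 : vs ⬝ᵥ vs = 1 := hvs
  have hmin' : ∀ t ∈ Icc a T, ∀ w : Fin n → ℝ, w ⬝ᵥ w = 1 → φ (ts, vs) ≤ φ (t, w) :=
    fun t ht w hw => hmin (show (t, w) ∈ _ from ⟨ht, hw⟩)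
  have hneg : φ (ts, vs) < 0 := by
    refine (hmin' a (left_mem_Icc.2 haT) _ hcu).trans_lt ?_
    simp only [hφ, hscale]
    refine mul_neg_of_pos_of_neg (Real.exp_pos _) (mul_neg_of_pos_of_neg (by positivity) ?_)
    rw [hDv]
    linarith
  have hηn : vs ⬝ᵥ (D ts *ᵥ vs) < 0 := by
    by_contra hh
    rw [not_lt] at hh
    exact absurd hneg (not_lt.2 (mul_nonneg (Real.exp_pos _).le hh))
  set η := -(vs ⬝ᵥ (D ts *ᵥ vs)) with hη
  have hη0 : 0 < η := by linarith
  have htsT : ts < T := by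
    refine lt_of_le_of_ne hts.2 ?_
    rintro rfl
    simp [hD, S₁.hterm, S₂.hterm] at hηn
  have k1 := hb₁ ts hts
  have k2 := hb₂ ts hts
  have hηr : η ≤ n * n * (r₁ + r₂) := by
    have h1 := form_le_norm (D ts) vs hvs1
    have h2 : ‖D ts‖ ≤ r₁ + r₂ := (norm_sub_le _ _).trans (add_le_add k1 k2)
    have h3 := neg_abs_le (vs ⬝ᵥ (D ts *ᵥ vs))
    have h4 : (n * n : ℝ) * ‖D ts‖ ≤ n * n * (r₁ + r₂) := by gcongr
    linarith
  have hDlow : ∀ w : Fin n → ℝ, -(η * (w ⬝ᵥ w)) ≤ w ⬝ᵥ (D ts *ᵥ w) := by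
    intro w
    rcases eq_or_ne w 0 with rfl | hw
    · simp
    obtain ⟨e, he, hee, heu⟩ := hnorm w hw
    have h1 := hmin' ts hts _ heu
    simp only [hφ] at h1
    have h1 := le_of_mul_le_mul_left h1 (Real.exp_pos _)
    rw [hscale] at h1
    have h3 : vs ⬝ᵥ (D ts *ᵥ vs) = -η := by simp [hη]
    rw [h3] at h1
    have he2 : 0 < e ^ 2 := by positivity
    have : e ^ 2 * (-(η * (w ⬝ᵥ w))) ≤ e ^ 2 * (w ⬝ᵥ (D ts *ᵥ w)) := by
      have : e ^ 2 * (-(η * (w ⬝ᵥ w))) = -η * (e ^ 2 * (w ⬝ᵥ w)) := by ring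
      rw [this, hee]
      linarith
    exact le_of_mul_le_mul_left this he2
  have hp1 := S₁.hpsd ts (S₁.lt_of_le ha₁ hts.1) hts.2
  have hp2 := S₂.hpsd ts (S₂.lt_of_le ha₂ hts.1) hts.2
  set Kt := K₁ ts + η • (1 : Matrix (Fin n) (Fin n) ℝ) with hKt
  have hKtv : ∀ w, Kt *ᵥ w = K₁ ts *ᵥ w + η • w := by
    intro w
    simp only [hKt, add_mulVec, smul_mulVec, one_mulVec]
  have hKtf : ∀ w, w ⬝ᵥ (Kt *ᵥ w) = w ⬝ᵥ (K₁ ts *ᵥ w) + η * (w ⬝ᵥ w) := by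
    intro w
    rw [hKtv, dotProduct_add, dotProduct_smul, smul_eq_mul]
  have hKts : Ktᵀ = Kt := by
    simp [hKt, psd_symm hp1]
  have hKtp : Kt.PosSemidef := psd_of hKts fun w => by
    rw [hKtf]
    exact add_nonneg (psd_nonneg hp1 w) (mul_nonneg hη0.le (dp_self_nonneg w))
  have hle : ∀ w : Fin n → ℝ, w ⬝ᵥ (K₂ ts *ᵥ w) ≤ w ⬝ᵥ (Kt *ᵥ w) := by
    intro w
    have := hDlow w
    rw [hDv] at this
    rw [hKtf]
    linarith
  have hdiff : (Kt - K₂ ts).PosSemidef := by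
    refine psd_of ?_ fun w => ?_
    · rw [transpose_sub, hKts, psd_symm hp2]
    · rw [sub_mulVec, dotProduct_sub]
      linarith [hle w]
  have hkv : Kt *ᵥ vs = K₂ ts *ᵥ vs := by
    have : (Kt - K₂ ts) *ᵥ vs = 0 := by
      refine psd_ker hdiff ?_
      rw [sub_mulVec, dotProduct_sub, hKtf, hvs1]
      have := hDv ts vs
      linarith
    rwa [sub_mulVec, sub_eq_zero] at this
  have m1 := d.mono_K (ϱ := ϱ₂) hβ hts.2 hKtp hp2 hle vs hkv
  have m2 := d.mono_rho hβ hts.2 h12 h2 hp1 vs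
  have hKtsub : Kt - K₁ ts = η • (1 : Matrix (Fin n) (Fin n) ℝ) := by simp [hKt]
  have hKn : ‖Kt - K₁ ts‖ = η * c1 := by
    rw [hKtsub, norm_smul, Real.norm_eq_abs, abs_of_pos hη0]
  have ab := abs_nonneg ϱ₂
  have hnr : 0 ≤ n * n * (r₁ + r₂) * c1 := by positivity
  have hKtr : ‖Kt‖ ≤ r := by
    have h1 : Kt = (Kt - K₁ ts) + K₁ ts := by abel
    rw [h1]
    refine (norm_add_le _ _).trans ?_
    rw [hKn]
    have : η * c1 ≤ n * n * (r₁ + r₂) * c1 := by gcongr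
    simp only [hr]
    linarith
  have hlip := hl ts hts.1 hts.2 ϱ₂ ϱ₂ (by simp only [hr]; linarith) (by simp only [hr]; linarith)
    Kt (K₁ ts) hKtp hp1 hKtr (by simp only [hr]; linarith)
  rw [sub_self, abs_zero, zero_add, hKn] at hlip
  have hf := (abs_le.1 (form_le_norm (d.R ϱ₂ ts Kt - d.R ϱ₂ ts (K₁ ts)) vs hvs1)).2
  rw [sub_mulVec, dotProduct_sub] at hf
  have hf2 : (n * n : ℝ) * ‖d.R ϱ₂ ts Kt - d.R ϱ₂ ts (K₁ ts)‖ ≤ n * n * (C * (η * c1)) := by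
    gcongr
  -- derivative
  have hder : HasDerivAt (fun t => Real.exp (L * t) * (vs ⬝ᵥ (D t *ᵥ vs)))
      (Real.exp (L * ts) * L * (vs ⬝ᵥ (D ts *ᵥ vs)) + Real.exp (L * ts) *
        (vs ⬝ᵥ ((-(d.R ϱ₁ ts (K₁ ts)) - -(d.R ϱ₂ ts (K₂ ts))) *ᵥ vs))) ts := by
    refine HasDerivAt.mul ?_ (hd_form ((S₁.hode ts (S₁.lt_of_le ha₁ hts.1) htsT).sub
      (S₂.hode ts (S₂.lt_of_le ha₂ hts.1) htsT)) vs)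
    simpa using ((hasDerivAt_id ts).const_mul L).exp
  have hge := deriv_nonneg_of_right_min hder htsT fun t ht =>
    hmin' t ⟨hts.1.trans ht.1.le, ht.2.le⟩ vs hvs1
  have e3 : vs ⬝ᵥ (D ts *ᵥ vs) = -η := by simp [hη]
  rw [e3, mul_assoc, ← mul_add] at hge
  have hge2 := nonneg_of_mul_nonneg_right hge (Real.exp_pos _)
  rw [sub_mulVec, neg_mulVec, neg_mulVec, dotProduct_sub, dotProduct_neg, dotProduct_neg] at hge2
  simp only [hL] at hge2
  nlinarith

end Sol

section Inv
variable {n : ℕ}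

theorem cont_inv {A : Matrix (Fin n) (Fin n) ℝ} (h : A.det ≠ 0) :
    ContinuousAt (fun M : Matrix (Fin n) (Fin n) ℝ => M⁻¹) A := by
  refine continuousAt_matrix_inv A ?_
  rw [Ring.inverse_eq_inv']
  exact continuousAt_inv₀ h

theorem hd_inv {K : ℝ → Matrix (Fin n) (Fin n) ℝ} {K' : Matrix (Fin n) (Fin n) ℝ} {t : ℝ}
    (h : HasDerivAt K K' t) (hdet : (K t).det ≠ 0) :
    HasDerivAt (fun s => (K s)⁻¹) (-((K t)⁻¹ * K' * (K t)⁻¹)) t := by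
  have hc : ContinuousAt (fun s => (K s)⁻¹) t :=
    ContinuousAt.comp (f := K) (cont_inv hdet) h.continuousAt
  have hdc : ContinuousAt (fun s => (K s).det) t :=
    (continuous_id.matrix_det.continuousAt).comp h.continuousAt
  have hne : ∀ᶠ s in nhdsWithin t {t}ᶜ, (K s).det ≠ 0 :=
    (hdc.eventually_ne hdet).filter_mono nhdsWithin_le_nhds
  replace h := hasDerivAt_iff_tendsto_slope.1 h
  refine hasDerivAt_iff_tendsto_slope.2 ?_
  have h1 : Tendsto (fun s => (K s)⁻¹) (nhdsWithin t {t}ᶜ) (nhds (K t)⁻¹) :=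
    hc.tendsto.mono_left nhdsWithin_le_nhds
  have hcont : Continuous fun p : Matrix (Fin n) (Fin n) ℝ × Matrix (Fin n) (Fin n) ℝ =>
      -(p.1 * p.2 * (K t)⁻¹) := by fun_prop
  have h2 := (hcont.tendsto ((K t)⁻¹, K')).comp (h1.prodMk_nhds h)
  refine h2.congr' ?_
  filter_upwards [hne] with s hs
  have u1 : IsUnit (K s).det := isUnit_iff_ne_zero.2 hs
  have u2 : IsUnit (K t).det := isUnit_iff_ne_zero.2 hdet
  simp only [Function.comp, slope, vsub_eq_sub]
  have : (K s)⁻¹ - (K t)⁻¹ = -((K s)⁻¹ * (K s - K t) * (K t)⁻¹) := by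
    rw [mul_sub, sub_mul, nonsing_inv_mul _ u1, mul_assoc, mul_nonsing_inv _ u2]
    simp
  rw [this, mul_smul_comm, smul_mul_assoc, smul_neg]

end Inv

namespace Sol
variable {n : ℕ} {T β : ℝ} {d : Dat n T β} {ϱ : ℝ} {K : ℝ → Matrix (Fin n) (Fin n) ℝ}
    {tb : EReal}

theorem det_ne (hβ : 0 < β) (hϱ : ϱ ≤ 0) (S : Sol d ϱ K tb) {t : ℝ} (ht : tb < (t : EReal))
    (htT : t < T) : (K t).det ≠ 0 := by
  intro h
  obtain ⟨v, hv, hv0⟩ := Matrix.exists_mulVec_eq_zero_iff.mpr h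
  have hp := S.hpsd t ht htT.le
  have l := d.lower hβ htT.le hϱ hp v
  have hvp := dp_self_pos hv
  rw [hv0] at l
  simp only [zero_dotProduct, mul_zero, zero_add, add_zero] at l
  have hd := hd_form (S.hode t ht htT) v
  have := deriv_nonneg_of_right_min hd htT fun s hs => by
    rw [hv0, dotProduct_zero]
    exact psd_nonneg (S.hpsd s (S.lt_of_le ht hs.1.le) hs.2.le) v
  rw [neg_mulVec, dotProduct_neg] at this
  nlinarith [mul_pos hβ hvp]

theorem inv_psd (S : Sol d ϱ K tb) {t : ℝ} (ht : tb < (t : EReal)) (htT : t ≤ T) :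
    ((K t)⁻¹).PosSemidef := (S.hpsd t ht htT).inv

theorem inv_form_deriv (hβ : 0 < β) (hϱ : ϱ ≤ 0) (S : Sol d ϱ K tb) {t : ℝ}
    (ht : tb < (t : EReal)) (htT : t < T) (v : Fin n → ℝ) :
    HasDerivAt (fun s => v ⬝ᵥ ((K s)⁻¹ *ᵥ v))
      (((K t)⁻¹ *ᵥ v) ⬝ᵥ (d.R ϱ t (K t) *ᵥ ((K t)⁻¹ *ᵥ v))) t := by
  have h := hd_form (hd_inv (S.hode t ht htT) (S.det_ne hβ hϱ ht htT)) v
  convert h using 1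
  rw [mul_neg, neg_mul, neg_neg, mul_assoc, ← mulVec_mulVec,
    dp_mv_sym (psd_symm (S.inv_psd ht htT.le)), mulVec_mulVec]

theorem mul_inv_vec (hβ : 0 < β) (hϱ : ϱ ≤ 0) (S : Sol d ϱ K tb) {t : ℝ}
    (ht : tb < (t : EReal)) (htT : t < T) (v : Fin n → ℝ) : K t *ᵥ ((K t)⁻¹ *ᵥ v) = v := by
  rw [mulVec_mulVec, mul_nonsing_inv _ (isUnit_iff_ne_zero.2 (S.det_ne hβ hϱ ht htT)), one_mulVec]

/-- the limit of the quadratic forms of the inverse -/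
theorem form_lim (hβ : 0 < β) (hϱ : ϱ ≤ 0) (hT : 0 < T) (S : Sol d ϱ K ((0 : ℝ) : EReal))
    (v : Fin n → ℝ) :
    ∃ l : ℝ, Tendsto (fun t => v ⬝ᵥ ((K t)⁻¹ *ᵥ v)) (nhdsWithin 0 (Ioi 0)) (nhds l) := by
  have hlt : ∀ t : ℝ, 0 < t → ((0 : ℝ) : EReal) < (t : EReal) := fun t ht => by exact_mod_cast ht
  have hcv : Continuous fun t => (d.H12 t *ᵥ v) ⬝ᵥ (d.H12 t *ᵥ v) := by
    have := d.hc12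
    fun_prop
  obtain ⟨c, hc⟩ := (isCompact_Icc (a := (0 : ℝ)) (b := T)).exists_bound_of_continuousOn
    hcv.continuousOn
  set g := fun t => v ⬝ᵥ ((K t)⁻¹ *ᵥ v) + c / β * t with hg
  have hder : ∀ t, 0 < t → t < T → HasDerivAt g
      (((K t)⁻¹ *ᵥ v) ⬝ᵥ (d.R ϱ t (K t) *ᵥ ((K t)⁻¹ *ᵥ v)) + c / β) t := by
    intro t h0 h1
    refine (S.inv_form_deriv hβ hϱ (hlt t h0) h1 v).add ?_
    simpa using (hasDerivAt_id t).const_mul (c / β)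
  have hmono : MonotoneOn g (Ioo 0 T) := by
    refine monotoneOn_of_deriv_nonneg (convex_Ioo 0 T)
      (fun t ht => (hder t ht.1 ht.2).continuousAt.continuousWithinAt) ?_ ?_
    · rw [interior_Ioo]
      exact fun t ht => (hder t ht.1 ht.2).differentiableAt.differentiableWithinAt
    · rw [interior_Ioo]
      intro t ht
      rw [(hder t ht.1 ht.2).deriv]
      have l := d.lower hβ ht.2.le hϱ (S.hpsd t (hlt t ht.1) ht.2.le) ((K t)⁻¹ *ᵥ v)
      rw [S.mul_inv_vec hβ hϱ (hlt t ht.1) ht.2] at l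
      have a := dp_amgm ((K t)⁻¹ *ᵥ v) (d.H12 t *ᵥ v) hβ
      have e : v ⬝ᵥ (d.H21 t *ᵥ ((K t)⁻¹ *ᵥ v)) = ((K t)⁻¹ *ᵥ v) ⬝ᵥ (d.H12 t *ᵥ v) := by
        obtain ⟨-, s, -⟩ := d.hsym t
        rw [dp_mv_sym s, dotProduct_comm]
      have b := (le_abs_self _).trans (hc t ⟨ht.1.le, ht.2.le⟩)
      have b2 : (d.H12 t *ᵥ v) ⬝ᵥ (d.H12 t *ᵥ v) / β ≤ c / β := by gcongr
      have b3 : 0 ≤ -ϱ * β * (v ⬝ᵥ v) :=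
        mul_nonneg (mul_nonneg (by linarith) hβ.le) (dp_self_nonneg v)
      rw [neg_div] at a
      linarith
  have hbdd : BddBelow (g '' Ioo 0 T) := by
    refine ⟨-(|c / β| * T), ?_⟩
    rintro _ ⟨t, ht, rfl⟩
    have h1 := psd_nonneg (S.inv_psd (hlt t ht.1) ht.2.le) v
    have h2 : -(|c / β| * T) ≤ c / β * t := by
      have h3 := neg_abs_le (c / β)
      have h4 : |c / β| * t ≤ |c / β| * T := mul_le_mul_of_nonneg_left ht.2.le (abs_nonneg _)
      nlinarith [ht.1]
    simp only [hg]
    linarith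
  have hlim := hmono.tendsto_nhdsWithin_Ioo_right (nonempty_Ioo.2 hT) hbdd
  refine ⟨sInf (g '' Ioo 0 T) - c / β * 0, ?_⟩
  have hl2 : Tendsto (fun t : ℝ => c / β * t) (nhdsWithin 0 (Ioi 0)) (nhds (c / β * 0)) :=
    (Continuous.tendsto (by fun_prop) 0).mono_left nhdsWithin_le_nhds
  refine (hlim.sub hl2).congr fun t => ?_
  simp only [hg]
  ring

theorem inv_lim (hβ : 0 < β) (hϱ : ϱ ≤ 0) (hT : 0 < T) (S : Sol d ϱ K ((0 : ℝ) : EReal)) :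
    ∃ A : Matrix (Fin n) (Fin n) ℝ,
      Tendsto (fun t => (K t)⁻¹) (nhdsWithin 0 (Ioi 0)) (nhds A) ∧ A.PosSemidef ∧
      ∃ v : Fin n → ℝ, v ≠ 0 ∧ A *ᵥ v = 0 := by
  have hlt : ∀ t : ℝ, 0 < t → ((0 : ℝ) : EReal) < (t : EReal) := fun t ht => by exact_mod_cast ht
  have hev : ∀ᶠ t in nhdsWithin (0 : ℝ) (Ioi 0), 0 < t ∧ t < T := Ioo_mem_nhdsGT hT
  choose l hl using S.form_lim hβ hϱ hT
  set A : Matrix (Fin n) (Fin n) ℝ := Matrix.of fun i j =>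
    (l (Pi.single i 1 + Pi.single j 1) - l (Pi.single i 1 - Pi.single j 1)) / 4 with hA
  have hAl : Tendsto (fun t => (K t)⁻¹) (nhdsWithin 0 (Ioi 0)) (nhds A) := by
    refine tendsto_pi_nhds.2 fun i => tendsto_pi_nhds.2 fun j => ?_
    have h := ((hl (Pi.single i 1 + Pi.single j 1)).sub
      (hl (Pi.single i 1 - Pi.single j 1))).div_const 4
    refine h.congr' ?_
    filter_upwards [hev] with t ht
    have hs := psd_symm (S.inv_psd (hlt t ht.1) ht.2.le)
    have hs' : (K t)⁻¹ j i = (K t)⁻¹ i j := congrFun (congrFun hs i) j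
    simp only [mulVec_add, mulVec_sub, add_dotProduct, sub_dotProduct, dotProduct_add,
      dotProduct_sub, mulVec_single_one, single_one_dotProduct, col_apply]
    rw [hs']
    ring
  have hAp : A.PosSemidef := by
    refine psd_of ?_ fun x => ?_
    · have h1 : Tendsto (fun t => ((K t)⁻¹)ᵀ) (nhdsWithin 0 (Ioi 0)) (nhds Aᵀ) :=
        (Continuous.tendsto (f := fun M : Matrix (Fin n) (Fin n) ℝ => Mᵀ) (by fun_prop) A).comp hAl
      refine tendsto_nhds_unique (h1.congr' ?_) hAl
      filter_upwards [hev] with t ht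
      exact psd_symm (S.inv_psd (hlt t ht.1) ht.2.le)
    · have h1 : Tendsto (fun t => x ⬝ᵥ ((K t)⁻¹ *ᵥ x)) (nhdsWithin 0 (Ioi 0))
          (nhds (x ⬝ᵥ (A *ᵥ x))) :=
        (Continuous.tendsto (f := fun M : Matrix (Fin n) (Fin n) ℝ => x ⬝ᵥ (M *ᵥ x))
          (by fun_prop) A).comp hAl
      refine ge_of_tendsto h1 ?_
      filter_upwards [hev] with t ht
      exact psd_nonneg (S.inv_psd (hlt t ht.1) ht.2.le) x
  refine ⟨A, hAl, hAp, ?_⟩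
  rw [Matrix.exists_mulVec_eq_zero_iff]
  by_contra hdet
  have h1 : Tendsto (fun t => ((K t)⁻¹)⁻¹) (nhdsWithin 0 (Ioi 0)) (nhds A⁻¹) :=
    (cont_inv hdet).tendsto.comp hAl
  have h2 : Tendsto (fun t => ‖K t‖) (nhdsWithin 0 (Ioi 0)) (nhds ‖A⁻¹‖) := by
    refine (h1.congr' ?_).norm
    filter_upwards [hev] with t ht
    exact nonsing_inv_nonsing_inv _ (isUnit_iff_ne_zero.2 (S.det_ne hβ hϱ (hlt t ht.1) ht.2))
  have h3 := S.hblow (EReal.bot_lt_coe 0)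
  rw [EReal.toReal_coe] at h3
  exact not_tendsto_nhds_of_tendsto_atTop h3 _ h2

end Sol

theorem FF_eq {n : ℕ} {K H : Matrix (Fin n) (Fin n) ℝ} (h : K.det ≠ 0) :
    FF K H = (K⁻¹ - H)⁻¹ := by
  have u : IsUnit K.det := isUnit_iff_ne_zero.2 h
  have e : 1 - K * H = K * (K⁻¹ - H) := by rw [mul_sub, mul_nonsing_inv _ u]
  rw [FF, e, Matrix.mul_inv_rev, mul_assoc, nonsing_inv_mul _ u, mul_one]

theorem sub_det_ne {n : ℕ} {β : ℝ} (hβ : 0 < β) {A H : Matrix (Fin n) (Fin n) ℝ}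
    (hA : A.PosSemidef) (hH : ∀ u : Fin n → ℝ, u ⬝ᵥ (H *ᵥ u) ≤ -β * (u ⬝ᵥ u)) :
    (A - H).det ≠ 0 := by
  intro h
  obtain ⟨u, hu, hu0⟩ := Matrix.exists_mulVec_eq_zero_iff.mpr h
  have h1 := psd_nonneg hA u
  have h2 := hH u
  have h3 : u ⬝ᵥ ((A - H) *ᵥ u) = 0 := by rw [hu0, dotProduct_zero]
  rw [sub_mulVec, dotProduct_sub] at h3
  nlinarith [mul_pos hβ (dp_self_pos hu)]

theorem tq {n : ℕ} {l : Filter ℝ} {x y : ℝ → Fin n → ℝ} {M : ℝ → Matrix (Fin n) (Fin n) ℝ}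
    {x0 y0 : Fin n → ℝ} {M0 : Matrix (Fin n) (Fin n) ℝ} (hx : Tendsto x l (nhds x0))
    (hM : Tendsto M l (nhds M0)) (hy : Tendsto y l (nhds y0)) :
    Tendsto (fun t => x t ⬝ᵥ (M t *ᵥ y t)) l (nhds (x0 ⬝ᵥ (M0 *ᵥ y0))) := by
  have hc : Continuous fun p : (Fin n → ℝ) × Matrix (Fin n) (Fin n) ℝ × (Fin n → ℝ) =>
      p.1 ⬝ᵥ (p.2.1 *ᵥ p.2.2) := by fun_prop
  exact (hc.tendsto (x0, M0, y0)).comp (hx.prodMk_nhds (hM.prodMk_nhds hy))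

theorem tmv {n : ℕ} {l : Filter ℝ} {y : ℝ → Fin n → ℝ} {M : ℝ → Matrix (Fin n) (Fin n) ℝ}
    {y0 : Fin n → ℝ} {M0 : Matrix (Fin n) (Fin n) ℝ}
    (hM : Tendsto M l (nhds M0)) (hy : Tendsto y l (nhds y0)) :
    Tendsto (fun t => M t *ᵥ y t) l (nhds (M0 *ᵥ y0)) := by
  have hc : Continuous fun p : Matrix (Fin n) (Fin n) ℝ × (Fin n → ℝ) =>
      p.1 *ᵥ p.2 := by fun_prop
  exact (hc.tendsto (M0, y0)).comp (hM.prodMk_nhds hy)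

namespace Sol
variable {n : ℕ} {T β : ℝ} {d : Dat n T β}

theorem unique (hβ : 0 < β) (hT : 0 < T) {ϱ₁ ϱ₂ : ℝ} {K₁ K₂ : ℝ → Matrix (Fin n) (Fin n) ℝ}
    (h12 : ϱ₁ < ϱ₂) (h2 : ϱ₂ < 0) (S₁ : Sol d ϱ₁ K₁ ((0 : ℝ) : EReal))
    (S₂ : Sol d ϱ₂ K₂ ((0 : ℝ) : EReal)) : False := by
  have h1 : ϱ₁ < 0 := h12.trans h2
  have hlt : ∀ t : ℝ, 0 < t → ((0 : ℝ) : EReal) < (t : EReal) := fun t ht => by exact_mod_cast ht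
  have hev : ∀ᶠ t in nhdsWithin (0 : ℝ) (Ioi 0), 0 < t ∧ t < T := Ioo_mem_nhdsGT hT
  obtain ⟨A₁, hA₁, hp₁, -⟩ := S₁.inv_lim hβ h1.le hT
  obtain ⟨A₂, hA₂, hp₂, v, hv, hv2⟩ := S₂.inv_lim hβ h2.le hT
  have hcmp : ∀ t, 0 < t → t < T → ∀ u, u ⬝ᵥ (K₂ t *ᵥ u) ≤ u ⬝ᵥ (K₁ t *ᵥ u) :=
    fun t h0 hT' u => compare hβ h12.le h2.le S₁ S₂ (hlt t h0) (hlt t h0) hT'.le u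
  have hP : ∀ t, 0 < t → t < T → v ⬝ᵥ ((K₁ t)⁻¹ *ᵥ v) ≤ v ⬝ᵥ ((K₂ t)⁻¹ *ᵥ v) := by
    intro t h0 hT'
    set a := (K₁ t)⁻¹ *ᵥ v with ha
    set b := (K₂ t)⁻¹ *ᵥ v with hb
    have e1 : K₁ t *ᵥ a = v := S₁.mul_inv_vec hβ h1.le (hlt t h0) hT' v
    have e2 : K₂ t *ᵥ b = v := S₂.mul_inv_vec hβ h2.le (hlt t h0) hT' v
    have hp := S₂.hpsd t (hlt t h0) hT'.le
    have q := psd_nonneg hp (a - b)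
    have c := hcmp t h0 hT' a
    rw [e1] at c
    rw [mulVec_sub, e2, sub_dotProduct, dotProduct_sub, dotProduct_sub,
      dp_mv_sym (psd_symm hp) b a, e2, dotProduct_comm b v, dotProduct_comm a v] at q
    rw [dotProduct_comm a v] at c
    linarith
  have cv : Tendsto (fun _ : ℝ => v) (nhdsWithin 0 (Ioi 0)) (nhds v) := tendsto_const_nhds
  have hv1 : A₁ *ᵥ v = 0 := by
    refine psd_ker hp₁ (le_antisymm ?_ (psd_nonneg hp₁ v))
    have : v ⬝ᵥ (A₁ *ᵥ v) ≤ v ⬝ᵥ (A₂ *ᵥ v) := by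
      refine le_of_tendsto_of_tendsto (tq cv hA₁ cv) (tq cv hA₂ cv) ?_
      filter_upwards [hev] with t ht
      exact hP t ht.1 ht.2
    rwa [hv2, dotProduct_zero] at this
  have z₁ : Tendsto (fun t => (K₁ t)⁻¹ *ᵥ v) (nhdsWithin 0 (Ioi 0)) (nhds 0) := by
    have := tmv hA₁ cv
    rwa [hv1] at this
  have z₂ : Tendsto (fun t => (K₂ t)⁻¹ *ᵥ v) (nhdsWithin 0 (Ioi 0)) (nhds 0) := by
    have := tmv hA₂ cv
    rwa [hv2] at this
  have hH : ∀ {H : ℝ → Matrix (Fin n) (Fin n) ℝ}, Continuous H →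
      Tendsto H (nhdsWithin 0 (Ioi 0)) (nhds (H 0)) :=
    fun h => (h.tendsto 0).mono_left nhdsWithin_le_nhds
  have hFF : ∀ {H : ℝ → Matrix (Fin n) (Fin n) ℝ}, Continuous H →
      (∀ u : Fin n → ℝ, u ⬝ᵥ (H 0 *ᵥ u) ≤ -β * (u ⬝ᵥ u)) →
      Tendsto (fun t => FF (K₂ t) (H t)) (nhdsWithin 0 (Ioi 0)) (nhds (A₂ - H 0)⁻¹) := by
    intro H hc hb
    have := (cont_inv (sub_det_ne hβ hp₂ hb)).tendsto.comp (hA₂.sub (hH hc))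
    refine this.congr' ?_
    filter_upwards [hev] with t ht
    exact (FF_eq (S₂.det_ne hβ h2.le (hlt t ht.1) ht.2)).symm
  -- the block terms
  set W : (ℝ → Matrix (Fin n) (Fin n) ℝ) → (ℝ → Matrix (Fin n) (Fin n) ℝ) →
    (ℝ → Matrix (Fin n) (Fin n) ℝ) → ℝ → Fin n → ℝ :=
    fun P H H' t => H t *ᵥ ((P t)⁻¹ *ᵥ v) + H' t *ᵥ v with hW
  have hWl : ∀ {H H' : ℝ → Matrix (Fin n) (Fin n) ℝ}, Continuous H → Continuous H' →
      Tendsto (W K₁ H H') (nhdsWithin 0 (Ioi 0)) (nhds (H' 0 *ᵥ v)) ∧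
      Tendsto (W K₂ H H') (nhdsWithin 0 (Ioi 0)) (nhds (H' 0 *ᵥ v)) := by
    intro H H' hc hc'
    constructor
    · have := (tmv (hH hc) z₁).add (tmv (hH hc') cv)
      rwa [mulVec_zero, zero_add] at this
    · have := (tmv (hH hc) z₂).add (tmv (hH hc') cv)
      rwa [mulVec_zero, zero_add] at this
  have hblk : ∀ {H H' G : ℝ → Matrix (Fin n) (Fin n) ℝ}, Continuous H → Continuous H' →
      Continuous G → (∀ u : Fin n → ℝ, u ⬝ᵥ (G 0 *ᵥ u) ≤ -β * (u ⬝ᵥ u)) →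
      Tendsto (fun t => ϱ₂ ^ 2 * (W K₂ H H' t ⬝ᵥ (FF (K₂ t) (G t) *ᵥ W K₂ H H' t))
        - ϱ₂ ^ 2 * (W K₁ H H' t ⬝ᵥ (FF (K₂ t) (G t) *ᵥ W K₁ H H' t)))
        (nhdsWithin 0 (Ioi 0)) (nhds 0) := by
    intro H H' G hc hc' hcG hb
    obtain ⟨w1, w2⟩ := hWl hc hc'
    have := ((tq w2 (hFF hcG hb) w2).const_mul (ϱ₂ ^ 2)).sub
      ((tq w1 (hFF hcG hb) w1).const_mul (ϱ₂ ^ 2))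
    rwa [sub_self] at this
  have hb3 := hblk d.hc31 d.hc32 d.hc33 (d.h33 0 hT.le)
  have hb4 := hblk d.hc41 d.hc42 d.hc44 (d.h44 0 hT.le)
  have l21 := ((tq cv (hH d.hc21) z₂).const_mul 2).sub ((tq cv (hH d.hc21) z₁).const_mul 2)
  have l11 := (tq z₂ (hH d.hc11) z₂).sub (tq z₁ (hH d.hc11) z₁)
  have l22 := (tq cv (hH d.hc22) cv).const_mul (ϱ₂ - ϱ₁)
  have ltot := (((l21.add l11).add l22).add hb3).add hb4
  simp only [mulVec_zero, dotProduct_zero, mul_zero, sub_self, add_zero, zero_add] at ltot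
  have hneg : (ϱ₂ - ϱ₁) * (v ⬝ᵥ (d.H22 0 *ᵥ v)) < 0 := by
    refine mul_neg_of_pos_of_neg (by linarith) ?_
    have := d.h22 0 hT.le v
    nlinarith [mul_pos hβ (dp_self_pos hv)]
  have hevneg := (ltot.eventually (eventually_lt_nhds hneg)).and hev
  obtain ⟨b, hb0, hb⟩ := mem_nhdsGT_iff_exists_Ioo_subset.1 hevneg
  have hb0 : 0 < b := hb0
  set φ := fun t => v ⬝ᵥ ((K₂ t)⁻¹ *ᵥ v) - v ⬝ᵥ ((K₁ t)⁻¹ *ᵥ v) with hφ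
  have hφl : Tendsto φ (nhdsWithin 0 (Ioi 0)) (nhds 0) := by
    have := (tq cv hA₂ cv).sub (tq cv hA₁ cv)
    simpa [hv1, hv2] using this
  have hφd : ∀ t ∈ Ioo 0 b, ∃ f', f' < 0 ∧ HasDerivAt φ f' t := by
    intro t ht
    obtain ⟨hx, h0, hT'⟩ := hb ht
    refine ⟨_, ?_, (S₂.inv_form_deriv hβ h2.le (hlt t h0) hT' v).sub
      (S₁.inv_form_deriv hβ h1.le (hlt t h0) hT' v)⟩
    have q₁ := S₁.hpsd t (hlt t h0) hT'.le
    have q₂ := S₂.hpsd t (hlt t h0) hT'.le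
    obtain ⟨s11, s12, s13, s14, s22, s23, s24, s33, s44⟩ := d.hsym t
    rw [d.form q₂, d.form q₁, S₁.mul_inv_vec hβ h1.le (hlt t h0) hT' v,
      S₂.mul_inv_vec hβ h2.le (hlt t h0) hT' v]
    refine lt_of_le_of_lt ?_ hx
    simp only [hW]
    have sq : ϱ₂ ^ 2 ≤ ϱ₁ ^ 2 := by nlinarith
    have m3 : ϱ₂ ^ 2 * _ ≤ ϱ₁ ^ 2 * _ := mul_le_mul sq
      (FF_mono hβ q₁ q₂ s33 (d.h33 t hT'.le) (hcmp t h0 hT')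
        (d.H31 t *ᵥ ((K₁ t)⁻¹ *ᵥ v) + d.H32 t *ᵥ v))
      (FF_nonneg hβ q₂ (d.h33 t hT'.le) _) (sq_nonneg _)
    have m4 : ϱ₂ ^ 2 * _ ≤ ϱ₁ ^ 2 * _ := mul_le_mul sq
      (FF_mono hβ q₁ q₂ s44 (d.h44 t hT'.le) (hcmp t h0 hT')
        (d.H41 t *ᵥ ((K₁ t)⁻¹ *ᵥ v) + d.H42 t *ᵥ v))
      (FF_nonneg hβ q₂ (d.h44 t hT'.le) _) (sq_nonneg _)
    linarith
  have hanti : StrictAntiOn φ (Ioo 0 b) := by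
    refine strictAntiOn_of_deriv_neg (convex_Ioo 0 b) ?_ ?_
    · intro t ht
      obtain ⟨f', -, hf⟩ := hφd t ht
      exact hf.continuousAt.continuousWithinAt
    · rw [interior_Ioo]
      intro t ht
      obtain ⟨f', h', hf⟩ := hφd t ht
      rwa [hf.deriv]
  have m1 : b / 3 ∈ Ioo 0 b := ⟨by linarith, by linarith⟩
  have m2 : b / 2 ∈ Ioo 0 b := ⟨by linarith, by linarith⟩
  have k1 : φ (b / 2) < φ (b / 3) := hanti m1 m2 (by linarith)
  have k2 : φ (b / 3) ≤ 0 := by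
    refine ge_of_tendsto hφl ?_
    filter_upwards [Ioo_mem_nhdsGT m1.1] with t ht
    exact (hanti ⟨ht.1, ht.2.trans m1.2⟩ m1 ht.2).le
  have k3 : 0 ≤ φ (b / 2) := by
    obtain ⟨-, h0, hT'⟩ := hb m2
    have := hP _ h0 hT'
    simp only [hφ]
    linarith
  linarith

end Sol

/-- there is a unique `ϱ̄ < 0` with `t_{ϱ̄} = 0`; moreover the
limit matrix `lim_{t ↓ 0} K_t(ϱ̄)⁻¹` exists, is symmetric positive semidefinite
and has a nontrivial kernel. -/
theorem stmt_13
    (T : ℝ) (hT : 0 < T) (n : ℕ) (hn : 1 ≤ n) (β : ℝ) (hβ : 0 < β)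
    (H11 H12 H13 H14 H21 H22 H23 H24 H31 H32 H33 H41 H42 H44 :
      ℝ → Matrix (Fin n) (Fin n) ℝ)
    (hc11 : Continuous H11) (hc12 : Continuous H12) (hc13 : Continuous H13)
    (hc14 : Continuous H14) (hc21 : Continuous H21) (hc22 : Continuous H22)
    (hc23 : Continuous H23) (hc24 : Continuous H24) (hc31 : Continuous H31)
    (hc32 : Continuous H32) (hc33 : Continuous H33) (hc41 : Continuous H41)
    (hc42 : Continuous H42) (hc44 : Continuous H44)
    (hsym : ∀ t : ℝ, (H11 t)ᵀ = H11 t ∧ (H12 t)ᵀ = H21 t ∧ (H13 t)ᵀ = H31 t ∧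
      (H14 t)ᵀ = H41 t ∧ (H22 t)ᵀ = H22 t ∧ (H23 t)ᵀ = H32 t ∧
      (H24 t)ᵀ = H42 t ∧ (H33 t)ᵀ = H33 t ∧ (H44 t)ᵀ = H44 t)
    (hconst : ∀ t : ℝ, t ≤ 0 → H11 t = H11 0 ∧ H12 t = H12 0 ∧ H13 t = H13 0 ∧
      H14 t = H14 0 ∧ H21 t = H21 0 ∧ H22 t = H22 0 ∧ H23 t = H23 0 ∧
      H24 t = H24 0 ∧ H31 t = H31 0 ∧ H32 t = H32 0 ∧ H33 t = H33 0 ∧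
      H41 t = H41 0 ∧ H42 t = H42 0 ∧ H44 t = H44 0)
    (hmono : ∀ t : ℝ, t ≤ T → ∀ x y z θ : Fin n → ℝ,
      -(((H11 t).mulVec x + (H12 t).mulVec y + (H13 t).mulVec z + (H14 t).mulVec θ) ⬝ᵥ x)
        + ((H21 t).mulVec x + (H22 t).mulVec y + (H23 t).mulVec z + (H24 t).mulVec θ) ⬝ᵥ y
        + ((H31 t).mulVec x + (H32 t).mulVec y + (H33 t).mulVec z) ⬝ᵥ z
        + ((H41 t).mulVec x + (H42 t).mulVec y + (H44 t).mulVec θ) ⬝ᵥ θ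
        ≤ -β * (x ⬝ᵥ x + y ⬝ᵥ y + z ⬝ᵥ z + θ ⬝ᵥ θ))
    (K : ℝ → ℝ → Matrix (Fin n) (Fin n) ℝ) (tb : ℝ → EReal)
    (htbT : ∀ ϱ : ℝ, tb ϱ < (T : EReal))
    (hterm : ∀ ϱ : ℝ, K ϱ T = 0)
    (hcont : ∀ ϱ : ℝ, ContinuousOn (K ϱ) {t : ℝ | tb ϱ < (t : EReal) ∧ t ≤ T})
    (hode : ∀ ϱ t : ℝ, tb ϱ < (t : EReal) → t < T →
      HasDerivAt (K ϱ)
        (-(Ric H11 H12 H13 H14 H21 H22 H23 H24 H31 H32 H33 H41 H42 H44 ϱ t (K ϱ t))) t)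
    (hpsd : ∀ ϱ t : ℝ, tb ϱ < (t : EReal) → t ≤ T → (K ϱ t).PosSemidef)
    (hblow : ∀ ϱ : ℝ, ⊥ < tb ϱ →
      Tendsto (fun t => ‖K ϱ t‖) (nhdsWithin (tb ϱ).toReal (Set.Ioi (tb ϱ).toReal)) atTop) :
    (∃! ϱ' : ℝ, ϱ' < 0 ∧ tb ϱ' = ((0 : ℝ) : EReal)) ∧
    ∀ ϱ' : ℝ, ϱ' < 0 → tb ϱ' = ((0 : ℝ) : EReal) →
      ∃ K0 : Matrix (Fin n) (Fin n) ℝ,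
        Tendsto (fun t => (K ϱ' t)⁻¹) (nhdsWithin 0 (Set.Ioi (0 : ℝ))) (nhds K0) ∧
        K0.PosSemidef ∧ ∃ v : Fin n → ℝ, v ≠ 0 ∧ K0.mulVec v = 0 := by
  have dcm : ∀ x y : Fin n → ℝ, x ⬝ᵥ y = y ⬝ᵥ x := fun x y => dotProduct_comm x y
  let d : Dat n T β :=
    { H11 := H11, H12 := H12, H13 := H13, H14 := H14, H21 := H21, H22 := H22, H23 := H23,
      H24 := H24, H31 := H31, H32 := H32, H33 := H33, H41 := H41, H42 := H42, H44 := H44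
      hc11 := hc11, hc12 := hc12, hc13 := hc13, hc14 := hc14, hc21 := hc21, hc22 := hc22
      hc23 := hc23, hc24 := hc24, hc31 := hc31, hc32 := hc32, hc33 := hc33, hc41 := hc41
      hc42 := hc42, hc44 := hc44, hsym := hsym
      h11 := fun t ht u => by
        have h := hmono t ht u 0 0 0
        simp only [mulVec_zero, dotProduct_zero, add_zero] at h
        rw [dcm u (H11 t *ᵥ u)]
        linarith
      h22 := fun t ht u => by
        have h := hmono t ht 0 u 0 0
        simp only [mulVec_zero, dotProduct_zero, add_zero, zero_add, neg_zero] at h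
        rw [dcm u (H22 t *ᵥ u)]
        linarith
      h33 := fun t ht u => by
        have h := hmono t ht 0 0 u 0
        simp only [mulVec_zero, dotProduct_zero, add_zero, zero_add, neg_zero] at h
        rw [dcm u (H33 t *ᵥ u)]
        linarith
      h44 := fun t ht u => by
        have h := hmono t ht 0 0 0 u
        simp only [mulVec_zero, dotProduct_zero, add_zero, zero_add, neg_zero] at h
        rw [dcm u (H44 t *ᵥ u)]
        linarith }
  have S : ∀ ϱ, Sol d ϱ (K ϱ) (tb ϱ) := fun ϱ =>
    ⟨htbT ϱ, hterm ϱ, hcont ϱ, hode ϱ, hpsd ϱ, hblow ϱ⟩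
  have S0 : ∀ ϱ, tb ϱ = ((0 : ℝ) : EReal) → Sol d ϱ (K ϱ) ((0 : ℝ) : EReal) := fun ϱ h => h ▸ S ϱ
  refine ⟨?_, fun x hx hx0 => (S0 x hx0).inv_lim hβ hx.le hT⟩
  obtain ⟨x, hx, hx0⟩ := Sol.exists_zero hβ hn hT S
  refine ⟨x, ⟨hx, hx0⟩, ?_⟩
  rintro y ⟨hy, hy0⟩
  rcases lt_trichotomy y x with h | h | h
  · exact (Sol.unique hβ hT h hx (S0 y hy0) (S0 x hx0)).elim
  · exact h
  · exact (Sol.unique hβ hT h hy (S0 x hx0) (S0 y hy0)).elim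
end

section
/- Set ρ₀ := max(ρ_a, ρ_b). Then for every ρ ∈ (ρ₀, +∞) the blow-up time t^k_ρ of the scalar Riccati equation is finite, and the map ρ ↦ t^k_ρ is continuous and strictly increasing on (ρ₀, +∞). -/
open Filter Set

/-- Right-hand side of the scalar Riccati equation `−k̇ = ricS ρ t k`. -/
noncomputable def ricS (H11 H13 H14 H21 H22 H33 H44 Hb22 : ℝ → ℝ)
    (ρ t k : ℝ) : ℝ :=
  (2 * H21 t + (H13 t) ^ 2 + (H14 t) ^ 2) * k + H11 t
    + (H22 t - ρ * Hb22 t - H33 t * (H13 t) ^ 2 - H44 t * (H14 t) ^ 2) * k ^ 2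

theorem fence15 (t1 T : ℝ) (g g' : ℝ → ℝ) (hc : ContinuousOn g (Icc t1 T))
    (hd : ∀ t, t1 ≤ t → t < T → HasDerivAt g (g' t) t) (hT : 0 < g T)
    (hz : ∀ t, t1 ≤ t → t < T → g t = 0 → g' t < 0) :
    ∀ t, t1 ≤ t → t ≤ T → 0 < g t := by
  by_contra hcon
  push Not at hcon
  obtain ⟨t0, h1, h2, h3⟩ := hcon
  have hScl : IsCompact (Icc t1 T ∩ g ⁻¹' (Iic 0)) :=
    isCompact_Icc.of_isClosed_subset (hc.preimage_isClosed_of_isClosed isClosed_Icc isClosed_Iic)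
      inter_subset_left
  obtain ⟨s, ⟨hs1, hs2⟩, hs3⟩ := hScl.exists_isGreatest ⟨t0, ⟨h1, h2⟩, h3⟩
  have hs2' : g s ≤ 0 := hs2
  have hsT : s < T := by
    rcases eq_or_lt_of_le hs1.2 with h | h
    · rw [h] at hs2'; linarith
    · exact h
  have hpos : ∀ t, s < t → t ≤ T → 0 < g t := by
    intro t ht htT
    by_contra hn
    have := hs3 ⟨⟨hs1.1.trans ht.le, htT⟩, (not_lt.mp hn : g t ≤ 0)⟩
    linarith
  have hD := hd s hs1.1 hsT
  have hev : ∀ᶠ t in nhdsWithin s (Ioi s), 0 < g t := by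
    filter_upwards [Ioc_mem_nhdsGT hsT] with t ht
    exact hpos t ht.1 ht.2
  have hlim : Tendsto g (nhdsWithin s (Ioi s)) (nhds (g s)) :=
    hD.continuousAt.tendsto.mono_left nhdsWithin_le_nhds
  have h0 : 0 ≤ g s := ge_of_tendsto hlim (hev.mono fun _ h => h.le)
  have hgs : g s = 0 := le_antisymm hs2' h0
  have hneg := hz s hs1.1 hsT hgs
  have hsl : Tendsto (slope g s) (nhdsWithin s (Ioi s)) (nhds (g' s)) :=
    (hasDerivAt_iff_tendsto_slope.mp hD).mono_left
      (nhdsWithin_mono _ (fun x hx => ne_of_gt hx))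
  have : 0 ≤ g' s := by
    refine ge_of_tendsto hsl ?_
    filter_upwards [hev, self_mem_nhdsWithin] with t ht hts
    rw [slope_def_field, hgs]
    have : (0:ℝ) < t - s := sub_pos.mpr hts
    exact div_nonneg (by linarith) this.le
  linarith

/-- solution on `[t1,T]` -/
structure Sol15 (T : ℝ) (a h d g : ℝ → ℝ) (ρ : ℝ) (κ : ℝ → ℝ) (t1 : ℝ) : Prop where
  cont : ContinuousOn κ (Icc t1 T)
  term : κ T = 0
  ode : ∀ t, t1 ≤ t → t < T → HasDerivAt κ (-(a t * κ t + h t + (g t + ρ * d t) * κ t ^ 2)) t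

/-- coefficient bounds -/
structure Coef15 (T A β m : ℝ) (a h d g : ℝ → ℝ) : Prop where
  β0 : 0 < β
  m0 : 0 < m
  A0 : 0 < A
  ha : ∀ t ≤ T, |a t| ≤ A
  hh : ∀ t ≤ T, β ≤ h t
  hh' : ∀ t ≤ T, h t ≤ A
  hg : ∀ t ≤ T, |g t| ≤ A
  hd : ∀ t ≤ T, m ≤ d t
  hd' : ∀ t ≤ T, d t ≤ A

theorem Coef15.c_bound {T A β m : ℝ} {a h d g : ℝ → ℝ} (C : Coef15 T A β m a h d g)
    {ρ R t : ℝ} (hρ : |ρ| ≤ R) (ht : t ≤ T) : |g t + ρ * d t| ≤ A + R * A := by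
  have h1 := C.hg t ht
  have h2 : |d t| ≤ A := abs_le.mpr ⟨by linarith [C.hd t ht, C.m0, C.A0], C.hd' t ht⟩
  calc |g t + ρ * d t| ≤ |g t| + |ρ * d t| := abs_add_le _ _
    _ ≤ A + R * A := by
      rw [abs_mul]
      have := mul_le_mul hρ h2 (abs_nonneg _) ((abs_nonneg _).trans hρ)
      linarith

theorem Sol15.nonneg {T A β m : ℝ} {a h d g : ℝ → ℝ} (C : Coef15 T A β m a h d g)
    {ρ : ℝ} {κ : ℝ → ℝ} {t1 : ℝ} (S : Sol15 T a h d g ρ κ t1) :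
    ∀ t, t1 ≤ t → t ≤ T → 0 ≤ κ t := by
  intro t ht htT
  have hA := C.A0
  have hβ := C.β0
  set Q := A + |ρ| * A with hQ
  have hQ0 : 0 < Q := by positivity
  have key : ∀ δ, 0 < δ → δ ≤ 1 → δ * (A + Q) < β → 0 < κ t + δ := by
    intro δ hδ hδ1 hδ2
    refine fence15 t1 T (fun t => κ t + δ) _ (S.cont.add continuousOn_const)
      (fun t h1 h2 => (S.ode t h1 h2).add_const δ) (by simp [S.term, hδ]) ?_ t ht htT
    intro t h1 h2 h3
    have hk : κ t = -δ := by linarith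
    have e1 := abs_le.mp (C.ha t h2.le)
    have e2 := abs_le.mp (C.c_bound (le_refl |ρ|) h2.le)
    have e3 := C.hh t h2.le
    rw [hk]
    have e4 : δ ^ 2 ≤ δ := by nlinarith
    have e5 : a t * δ ≤ A * δ := mul_le_mul_of_nonneg_right e1.2 hδ.le
    have e6 : (-Q) * δ^2 ≤ (g t + ρ * d t) * δ ^ 2 :=
      mul_le_mul_of_nonneg_right e2.1 (by positivity)
    have e7 : Q * δ^2 ≤ Q * δ := mul_le_mul_of_nonneg_left e4 hQ0.le
    nlinarith
  by_contra hn
  push Not at hn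
  set δ := min (min 1 (-κ t)) (β / (2 * (A + Q))) with hδ
  have p : 0 < A + Q := by positivity
  have d0 : 0 < δ := lt_min (lt_min one_pos (by linarith)) (by positivity)
  have d1 : δ ≤ 1 := (min_le_left _ _).trans (min_le_left _ _)
  have d2 : δ ≤ -κ t := (min_le_left _ _).trans (min_le_right _ _)
  have d3 : δ ≤ β / (2 * (A + Q)) := min_le_right _ _
  have d4 : δ * (A + Q) < β := by
    rw [le_div_iff₀ (by positivity)] at d3
    nlinarith
  have := key δ d0 d1 d4
  linarith

theorem Sol15.pos {T A β m : ℝ} {a h d g : ℝ → ℝ} (C : Coef15 T A β m a h d g)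
    {ρ : ℝ} {κ : ℝ → ℝ} {t1 : ℝ} (S : Sol15 T a h d g ρ κ t1) :
    ∀ t, t1 < t → t < T → 0 < κ t := by
  intro t ht htT
  rcases (S.nonneg C t ht.le htT.le).lt_or_eq with h' | h'
  · exact h'
  exfalso
  have hmin : IsLocalMin κ t := by
    filter_upwards [Ioo_mem_nhds ht htT] with s hs
    rw [← h']
    exact S.nonneg C s hs.1.le hs.2.le
  have := hmin.hasDerivAt_eq_zero (S.ode t ht.le htT)
  rw [← h'] at this
  have := C.hh t htT.le
  have := C.β0
  simp at *
  linarith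

theorem Sol15.bdd {T : ℝ} {a h d g : ℝ → ℝ} {ρ : ℝ} {κ : ℝ → ℝ} {t1 : ℝ}
    (S : Sol15 T a h d g ρ κ t1) : ∃ M, 0 ≤ M ∧ ∀ t, t1 ≤ t → t ≤ T → |κ t| ≤ M := by
  obtain ⟨M, hM⟩ := isCompact_Icc.exists_bound_of_continuousOn S.cont
  exact ⟨max M 0, le_max_right _ _, fun t h1 h2 => (hM t ⟨h1, h2⟩).trans (le_max_left _ _)⟩

theorem Sol15.comp {T A β m : ℝ} {a h d g : ℝ → ℝ} (C : Coef15 T A β m a h d g)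
    {ρ1 ρ2 : ℝ} {κ1 κ2 : ℝ → ℝ} {t1 : ℝ} (S1 : Sol15 T a h d g ρ1 κ1 t1)
    (S2 : Sol15 T a h d g ρ2 κ2 t1) (hρ : ρ1 ≤ ρ2) :
    ∀ t, t1 ≤ t → t ≤ T → κ1 t ≤ κ2 t := by
  intro t ht htT
  obtain ⟨M1, hM10, hM1⟩ := S1.bdd
  obtain ⟨M2, hM20, hM2⟩ := S2.bdd
  have hA := C.A0
  set Q := A + |ρ2| * A with hQ
  have hQ0 : 0 < Q := by positivity
  set L := A + Q * (M1 + M2) + 1 with hL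
  have key : ∀ δ, 0 < δ → 0 < κ2 t - κ1 t + δ * Real.exp (L * (T - t)) := by
    intro δ hδ
    have hE : ∀ t, HasDerivAt (fun t => δ * Real.exp (L * (T - t)))
        (-(L * (δ * Real.exp (L * (T - t))))) t := by
      intro t
      have := ((((hasDerivAt_id' t).const_sub T).const_mul L).exp).const_mul δ
      refine this.congr_deriv ?_
      simp; ring
    refine fence15 t1 T (fun t => κ2 t - κ1 t + δ * Real.exp (L * (T - t))) _
      ((S2.cont.sub S1.cont).add (by fun_prop))
      (fun t h1 h2 => ((S2.ode t h1 h2).sub (S1.ode t h1 h2)).add (hE t))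
      (by simp [S1.term, S2.term, hδ]) ?_ t ht htT
    intro t h1 h2 h3
    have hp : 0 < δ * Real.exp (L * (T - t)) := by positivity
    set E := δ * Real.exp (L * (T - t)) with hEd
    have hk : κ2 t = κ1 t - E := by linarith
    have e1 := abs_le.mp (C.ha t h2.le)
    have e2 := C.c_bound (le_refl |ρ2|) h2.le
    have e3 : |κ2 t + κ1 t| ≤ M1 + M2 := by
      have := abs_add_le (κ2 t) (κ1 t)
      linarith [hM1 t h1 h2.le, hM2 t h1 h2.le]
    have e4 : (g t + ρ2 * d t) * (κ2 t + κ1 t) ≤ Q * (M1 + M2) := by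
      refine (le_abs_self _).trans ?_
      rw [abs_mul]
      exact mul_le_mul e2 e3 (abs_nonneg _) hQ0.le
    have e5 : 0 ≤ (ρ2 - ρ1) * d t * κ1 t ^ 2 := by
      have : 0 ≤ d t := C.m0.le.trans (C.hd t h2.le)
      have : 0 ≤ ρ2 - ρ1 := by linarith
      positivity
    have e6 : (a t + (g t + ρ2 * d t) * (κ2 t + κ1 t)) * E ≤ (L - 1) * E :=
      mul_le_mul_of_nonneg_right (by linarith) hp.le
    have e7 : -(a t * κ2 t + h t + (g t + ρ2 * d t) * κ2 t ^ 2) -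
        -(a t * κ1 t + h t + (g t + ρ1 * d t) * κ1 t ^ 2) + -(L * E)
        = (a t + (g t + ρ2 * d t) * (κ2 t + κ1 t)) * E - (ρ2 - ρ1) * d t * κ1 t ^ 2 - L * E := by
      rw [hk]; ring
    rw [e7]
    linarith
  by_contra hn
  push Not at hn
  have h0 := Real.exp_pos (L * (T - t))
  have := key ((κ1 t - κ2 t) / Real.exp (L * (T - t))) (div_pos (by linarith) h0)
  rw [div_mul_cancel₀ _ h0.ne'] at this
  linarith

theorem Sol15.close {T A β m : ℝ} {a h d g : ℝ → ℝ} (C : Coef15 T A β m a h d g)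
    (R M t1 : ℝ) (hR : 0 ≤ R) (hM : 0 ≤ M) : ∃ ε > 0, ∀ (ρ1 ρ2 : ℝ) (κ1 κ2 : ℝ → ℝ) (t2 : ℝ),
    t1 ≤ t2 → Sol15 T a h d g ρ1 κ1 t2 → Sol15 T a h d g ρ2 κ2 t2 → ρ1 ≤ ρ2 → |ρ2| ≤ R →
    ρ2 - ρ1 < ε → (∀ t, t2 ≤ t → t ≤ T → κ1 t ≤ M) →
    ∀ t, t2 ≤ t → t ≤ T → κ2 t < κ1 t + 1 := by
  have hA := C.A0
  set Q := A + R * A with hQ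
  have hQ0 : 0 < Q := by positivity
  set L := A + Q * (2 * M + 1) + 1 with hL
  have hL0 : 0 < L := by positivity
  set η := Real.exp (- (L * (T - t1))) with hη
  have hη0 : 0 < η := Real.exp_pos _
  refine ⟨η / (A * M ^ 2 + 1), by positivity, ?_⟩
  intro ρ1 ρ2 κ1 κ2 t2 ht12 S1 S2 hρ hρR hρε hκM t ht htT
  have hq : (ρ2 - ρ1) * (A * M ^ 2) < η := by
    rw [lt_div_iff₀ (by positivity)] at hρε
    nlinarith
  have hE1 : ∀ t, t2 ≤ t → η * Real.exp (L * (T - t)) ≤ 1 := by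
    intro t ht
    rw [hη, ← Real.exp_add, Real.exp_le_one_iff]
    nlinarith
  have hE : ∀ t, HasDerivAt (fun t => η * Real.exp (L * (T - t)))
      (-(L * (η * Real.exp (L * (T - t))))) t := by
    intro t
    have := ((((hasDerivAt_id' t).const_sub T).const_mul L).exp).const_mul η
    refine this.congr_deriv ?_
    simp; ring
  have := fence15 t2 T (fun t => η * Real.exp (L * (T - t)) - (κ2 t - κ1 t)) _
      (ContinuousOn.sub (by fun_prop) (S2.cont.sub S1.cont))
      (fun t h1 h2 => (hE t).sub ((S2.ode t h1 h2).sub (S1.ode t h1 h2)))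
      (by simp [S1.term, S2.term, hη0]) ?_ t ht htT
  · have h9 := hE1 t ht
    linarith
  intro t h1 h2 h3
  have hEt := hE1 t h1
  have hEη : η ≤ η * Real.exp (L * (T - t)) := by
    have : 1 ≤ Real.exp (L * (T - t)) := Real.one_le_exp (mul_nonneg hL0.le (by linarith))
    nlinarith
  set E := η * Real.exp (L * (T - t)) with hEd
  have hE0 : 0 < E := by linarith
  have hk : κ2 t = κ1 t + E := by linarith
  have hk1 := S1.nonneg C t h1 h2.le
  have hk1M := hκM t h1 h2.le
  have e1 := abs_le.mp (C.ha t h2.le)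
  have e2 := C.c_bound hρR h2.le
  have e3 : |κ2 t + κ1 t| ≤ 2 * M + 1 := by
    rw [abs_of_nonneg (by linarith)]; linarith
  have e4 : (g t + ρ2 * d t) * (κ2 t + κ1 t) ≤ Q * (2 * M + 1) := by
    refine (le_abs_self _).trans ?_
    rw [abs_mul]
    exact mul_le_mul e2 e3 (abs_nonneg _) hQ0.le
  have e5 : (ρ2 - ρ1) * (d t * κ1 t ^ 2) ≤ (ρ2 - ρ1) * (A * M ^ 2) := by
    refine mul_le_mul_of_nonneg_left ?_ (by linarith)
    exact mul_le_mul (C.hd' t h2.le) (pow_le_pow_left₀ hk1 hk1M 2) (by positivity) hA.le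
  have e6 : (a t + (g t + ρ2 * d t) * (κ2 t + κ1 t)) * E ≤ (L - 1) * E :=
    mul_le_mul_of_nonneg_right (by linarith) hE0.le
  have e7 : -(L * E) - (-(a t * κ2 t + h t + (g t + ρ2 * d t) * κ2 t ^ 2) -
      -(a t * κ1 t + h t + (g t + ρ1 * d t) * κ1 t ^ 2))
      = (a t + (g t + ρ2 * d t) * (κ2 t + κ1 t)) * E + (ρ2 - ρ1) * (d t * κ1 t ^ 2) - L * E := by
    rw [hk]; ring
  rw [e7]
  linarith

theorem Sol15.inv_deriv {T : ℝ} {a h d g : ℝ → ℝ}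
    {ρ : ℝ} {κ : ℝ → ℝ} {t1 t : ℝ} (S : Sol15 T a h d g ρ κ t1) (h1 : t1 ≤ t) (h2 : t < T)
    (h0 : 0 < κ t) : HasDerivAt (fun t => (κ t)⁻¹)
      (a t * (κ t)⁻¹ + h t * (κ t)⁻¹ ^ 2 + (g t + ρ * d t)) t := by
  have := (S.ode t h1 h2).inv h0.ne'
  refine this.congr_deriv ?_
  field_simp

/-- fast blow-up -/
theorem Sol15.fast {T A β m : ℝ} {a h d g : ℝ → ℝ} (C : Coef15 T A β m a h d g)
    {ρ c0 ε K : ℝ} {κ : ℝ → ℝ} {t0 t1 : ℝ} (S : Sol15 T a h d g ρ κ t0)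
    (ht0 : t0 < t1 - ε) (hε : 0 < ε) (ht1 : t1 < T) (hc0 : 0 < c0)
    (hc : ∀ t ≤ T, c0 ≤ g t + ρ * d t) (hK0 : 0 < K) (hK1 : 2 * A ≤ c0 * K) (hK2 : 4 ≤ c0 * ε * K)
    (hk : K < κ t1) : False := by
  have hA := C.A0
  have hpos : ∀ t, t1 - ε ≤ t → t ≤ t1 → 0 < κ t :=
    fun t h1 h2 => S.pos C t (by linarith) (by linarith)
  have hder : ∀ t, t1 - ε ≤ t → t ≤ t1 → HasDerivAt (fun t => (κ t)⁻¹)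
      (a t * (κ t)⁻¹ + h t * (κ t)⁻¹ ^ 2 + (g t + ρ * d t)) t :=
    fun t h1 h2 => S.inv_deriv (by linarith) (by linarith) (hpos t h1 h2)
  have hB : ∀ t, HasDerivAt (fun t => K⁻¹ - (c0 / 4) * (t1 - t)) (c0 / 4) t := by
    intro t
    have := (((hasDerivAt_id' t).const_sub t1).const_mul (c0/4)).const_sub (K⁻¹)
    refine this.congr_deriv ?_
    simp
  have := fence15 (t1 - ε) t1 (fun t => (K⁻¹ - (c0 / 4) * (t1 - t)) - (κ t)⁻¹) _
    (ContinuousOn.sub (by fun_prop)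
      (fun t ht => (hder t ht.1 ht.2).continuousAt.continuousWithinAt))
    (fun t h1 h2 => (hB t).sub (hder t h1 h2.le)) ?_ ?_ (t1 - ε) le_rfl (by linarith)
  · have hp := inv_pos.mpr (hpos (t1 - ε) le_rfl (by linarith))
    have : K⁻¹ ≤ c0 / 4 * ε := by
      rw [inv_le_iff_one_le_mul₀ hK0]
      nlinarith
    simp only [sub_sub_cancel] at *
    linarith
  · have := inv_strictAnti₀ hK0 hk
    simp only [sub_self, mul_zero, sub_zero]
    linarith
  · intro t h1 h2 h3
    have hu : 0 < (κ t)⁻¹ := inv_pos.mpr (hpos t h1 h2.le)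
    have hu2 : (κ t)⁻¹ ≤ K⁻¹ := by nlinarith
    have hAK : A * K⁻¹ ≤ c0 / 2 := by
      rw [← div_eq_mul_inv, div_le_iff₀ hK0]; linarith
    have e1 := abs_le.mp (C.ha t (by linarith))
    have e2 := hc t (by linarith)
    have e3 : 0 ≤ h t * (κ t)⁻¹ ^ 2 :=
      mul_nonneg (C.β0.le.trans (C.hh t (by linarith))) (by positivity)
    have e4 : -A * (κ t)⁻¹ ≤ a t * (κ t)⁻¹ := mul_le_mul_of_nonneg_right e1.1 hu.le
    have e5 : A * (κ t)⁻¹ ≤ A * K⁻¹ := mul_le_mul_of_nonneg_left hu2 hA.le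
    linarith

/-- large parameter: no global solution -/
theorem Sol15.large {T A β m : ℝ} {a h d g : ℝ → ℝ} (C : Coef15 T A β m a h d g) :
    ∃ ρ : ℝ, 0 ≤ ρ ∧ ∀ κ : ℝ → ℝ, ¬ (∀ t1, t1 < T → Sol15 T a h d g ρ κ t1) := by
  have hA := C.A0
  have hβ := C.β0
  have hm := C.m0
  set c0 := A ^ 2 / β + 1 with hc0
  have hc00 : 0 < c0 := by positivity
  refine ⟨(A + c0) / m, by positivity, ?_⟩
  intro κ S
  set ρ := (A + c0) / m with hρ
  have hc : ∀ t ≤ T, c0 ≤ g t + ρ * d t := by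
    intro t ht
    have e1 := abs_le.mp (C.hg t ht)
    have e2 : ρ * m ≤ ρ * d t := mul_le_mul_of_nonneg_left (C.hd t ht) (by positivity)
    have e3 : ρ * m = A + c0 := div_mul_cancel₀ _ hm.ne'
    linarith
  set δ := min (β / 2) (c0 / 2) with hδ
  have hδ0 : 0 < δ := lt_min (by positivity) (by positivity)
  have hd1 : δ ≤ β / 2 := min_le_left _ _
  have hd2 : δ ≤ c0 / 2 := min_le_right _ _
  set t0 := T - 2 / δ - 1 with ht0
  have hp : 0 < 2 / δ := by positivity
  have S0 := S (t0 - 1) (by linarith)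
  have hder : ∀ t, t0 - 1 ≤ t → t < T → HasDerivAt (fun t => Real.arctan (κ t) + δ * t)
      (1 / (1 + κ t ^ 2) * (-(a t * κ t + h t + (g t + ρ * d t) * κ t ^ 2)) + δ) t := by
    intro t h1 h2
    have := (S0.ode t h1 h2).arctan.add ((hasDerivAt_id' t).const_mul δ)
    refine this.congr_deriv ?_
    simp
  have hanti : AntitoneOn (fun t => Real.arctan (κ t) + δ * t) (Icc t0 T) := by
    refine antitoneOn_of_deriv_nonpos (convex_Icc _ _) ?_ ?_ ?_
    · refine ContinuousOn.add ?_ (by fun_prop)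
      exact Real.continuous_arctan.comp_continuousOn
        (S0.cont.mono (Icc_subset_Icc_left (by linarith)))
    · rw [interior_Icc]
      exact fun t ht => (hder t (by linarith [ht.1]) ht.2).differentiableAt.differentiableWithinAt
    · rw [interior_Icc]
      intro t ht
      have h1 : t0 - 1 ≤ t := by linarith [ht.1]
      rw [(hder t h1 ht.2).deriv]
      have hk := S0.nonneg C t h1 ht.2.le
      have e1 := abs_le.mp (C.ha t ht.2.le)
      have e2 := hc t ht.2.le
      have e3 := C.hh t ht.2.le
      have e4 : -A * κ t ≤ a t * κ t := mul_le_mul_of_nonneg_right e1.1 hk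
      have e5 : c0 * κ t ^ 2 ≤ (g t + ρ * d t) * κ t ^ 2 :=
        mul_le_mul_of_nonneg_right e2 (by positivity)
      have e6 : A * κ t ≤ β / 2 + (c0 / 2) * κ t ^ 2 := by
        have : c0 * β = A ^ 2 + β := by rw [hc0]; field_simp
        have h9 : 0 ≤ (β - A * κ t) ^ 2 := sq_nonneg _
        have h10 : β * (A * κ t) ≤ β * (β / 2 + (c0 / 2) * κ t ^ 2) := by
          have : β * (β / 2 + (c0 / 2) * κ t ^ 2) = β ^ 2 / 2 + (c0 * β) * κ t ^ 2 / 2 := by ring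
          rw [this, ‹c0 * β = A ^ 2 + β›]
          nlinarith [mul_nonneg hβ.le (sq_nonneg (κ t))]
        exact le_of_mul_le_mul_left h10 hβ
      have e7 : δ * κ t ^ 2 ≤ c0 / 2 * κ t ^ 2 := mul_le_mul_of_nonneg_right hd2 (by positivity)
      have hq : 0 < 1 + κ t ^ 2 := by positivity
      have e8 : δ * (1 + κ t ^ 2) ≤ a t * κ t + h t + (g t + ρ * d t) * κ t ^ 2 := by linarith
      have e9 : δ ≤ (a t * κ t + h t + (g t + ρ * d t) * κ t ^ 2) / (1 + κ t ^ 2) := by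
        rw [le_div_iff₀ hq]; exact e8
      have e10 : 1 / (1 + κ t ^ 2) * (-(a t * κ t + h t + (g t + ρ * d t) * κ t ^ 2))
        = - ((a t * κ t + h t + (g t + ρ * d t) * κ t ^ 2) / (1 + κ t ^ 2)) := by ring
      rw [e10]
      linarith
  have h1 := hanti (a := t0) ⟨le_rfl, by linarith⟩ (b := T) ⟨by linarith, le_rfl⟩ (by linarith)
  simp only [S0.term, Real.arctan_zero] at h1
  have h2 := Real.arctan_lt_pi_div_two (κ t0)
  have h3 := Real.pi_le_four
  have h4 : δ * (2 / δ) = 2 := by field_simp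
  have h5 : δ * t0 = δ * T - 2 - δ := by rw [ht0]; nlinarith
  linarith

/-- no simultaneous blow-up -/
theorem Sol15.strict {T A β m : ℝ} {a h d g : ℝ → ℝ} (C : Coef15 T A β m a h d g)
    {ρ1 ρ2 τ : ℝ} {κ1 κ2 : ℝ → ℝ} (hρ : ρ1 < ρ2) (hτ : τ < T)
    (S1 : ∀ t1, τ < t1 → t1 < T → Sol15 T a h d g ρ1 κ1 t1)
    (S2 : ∀ t1, τ < t1 → t1 < T → Sol15 T a h d g ρ2 κ2 t1)
    (L1 : Tendsto κ1 (nhdsWithin τ (Ioi τ)) atTop)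
    (L2 : Tendsto κ2 (nhdsWithin τ (Ioi τ)) atTop) : False := by
  have hA := C.A0
  have hm := C.m0
  set δ := (ρ2 - ρ1) * m with hδ
  have hδ0 : 0 < δ := mul_pos (by linarith) hm
  have U1 := tendsto_inv_atTop_zero.comp L1
  have U2 := tendsto_inv_atTop_zero.comp L2
  have W : Tendsto (fun t => (κ1 t)⁻¹ - (κ2 t)⁻¹) (nhdsWithin τ (Ioi τ)) (nhds 0) := by
    simpa using U1.sub U2
  have pos : ∀ t, τ < t → t < T → 0 < κ1 t ∧ 0 < κ2 t := by
    intro t h1 h2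
    exact ⟨(S1 ((τ + t)/2) (by linarith) (by linarith)).pos C t (by linarith) h2,
      (S2 ((τ + t)/2) (by linarith) (by linarith)).pos C t (by linarith) h2⟩
  have w0 : ∀ t, τ < t → t < T → 0 ≤ (κ1 t)⁻¹ - (κ2 t)⁻¹ := by
    intro t h1 h2
    have := Sol15.comp C (S1 t h1 h2) (S2 t h1 h2) hρ.le t le_rfl h2.le
    exact sub_nonneg.mpr (inv_anti₀ (pos t h1 h2).1 this)
  have ev : ∀ᶠ t in nhdsWithin τ (Ioi τ), (κ1 t)⁻¹ < 1 ∧ (κ2 t)⁻¹ < 1 ∧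
      (κ1 t)⁻¹ - (κ2 t)⁻¹ < δ / (6 * A) ∧ t < T := by
    have p : 0 < δ / (6 * A) := by positivity
    filter_upwards [U1.eventually_lt_const one_pos, U2.eventually_lt_const one_pos,
      W.eventually_lt_const p, Ioo_mem_nhdsGT hτ] with t h1 h2 h3 h4
    exact ⟨h1, h2, h3, h4.2⟩
  obtain ⟨t1, ht1, hev⟩ := (mem_nhdsGT_iff_exists_Ioo_subset).mp ev
  have ht1' : τ < t1 := ht1
  have hder : ∀ t, τ < t → t < t1 → HasDerivAt (fun t => (κ1 t)⁻¹ - (κ2 t)⁻¹)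
      ((a t * (κ1 t)⁻¹ + h t * (κ1 t)⁻¹ ^ 2 + (g t + ρ1 * d t)) -
      (a t * (κ2 t)⁻¹ + h t * (κ2 t)⁻¹ ^ 2 + (g t + ρ2 * d t))) t := by
    intro t h1 h2
    have h3 : t < T := (hev ⟨h1, h2⟩).2.2.2
    exact ((S1 t h1 h3).inv_deriv le_rfl h3 (pos t h1 h3).1).sub
      ((S2 t h1 h3).inv_deriv le_rfl h3 (pos t h1 h3).2)
  have hanti : StrictAntiOn (fun t => (κ1 t)⁻¹ - (κ2 t)⁻¹) (Ioo τ t1) := by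
    refine strictAntiOn_of_deriv_neg (convex_Ioo _ _)
      (fun t ht => (hder t ht.1 ht.2).continuousAt.continuousWithinAt) ?_
    rw [interior_Ioo]
    intro t ht
    rw [(hder t ht.1 ht.2).deriv]
    obtain ⟨h1, h2, h3, h4⟩ := hev ht
    have w := w0 t ht.1 h4
    obtain ⟨p1, p2⟩ := pos t ht.1 h4
    have q1 := inv_pos.mpr p1
    have q2 := inv_pos.mpr p2
    set u1 := (κ1 t)⁻¹
    set u2 := (κ2 t)⁻¹
    have e1 := abs_le.mp (C.ha t h4.le)
    have e2 := C.hh' t h4.le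
    have e3 := C.hd t h4.le
    have e4 : δ ≤ (ρ2 - ρ1) * d t := mul_le_mul_of_nonneg_left e3 (by linarith)
    have e5 : a t + h t * (u1 + u2) ≤ 3 * A := by
      have : h t * (u1 + u2) ≤ A * 2 := mul_le_mul e2 (by linarith) (by linarith) hA.le
      linarith
    have e6 : (a t + h t * (u1 + u2)) * (u1 - u2) ≤ 3 * A * (u1 - u2) :=
      mul_le_mul_of_nonneg_right e5 w
    have e7 : (u1 - u2) * (6 * A) < δ := by rwa [lt_div_iff₀ (by positivity)] at h3
    nlinarith
  have c1 : (3 * τ + t1) / 4 ∈ Ioo τ t1 := ⟨by linarith, by linarith⟩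
  have c2 : (τ + t1) / 2 ∈ Ioo τ t1 := ⟨by linarith, by linarith⟩
  have f1 := hanti c1 c2 (by linarith)
  have f2 := w0 _ c2.1 (hev c2).2.2.2
  have : (κ1 ((3 * τ + t1) / 4))⁻¹ - (κ2 ((3 * τ + t1) / 4))⁻¹ ≤ 0 := by
    refine ge_of_tendsto W ?_
    filter_upwards [Ioo_mem_nhdsGT c1.1] with t ht
    exact (hanti ⟨ht.1, ht.2.trans c1.2⟩ c1 ht.2).le
  simp only at f1
  linarith

theorem bound15 (T : ℝ) (f : ℝ → ℝ) (hf : Continuous f) (h0 : ∀ t ≤ 0, f t = f 0) :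
    ∃ B, ∀ t ≤ T, |f t| ≤ B := by
  obtain ⟨M, hM⟩ := isCompact_Icc.exists_bound_of_continuousOn (hf.continuousOn (s := Icc 0 T))
  refine ⟨max M |f 0|, fun t ht => ?_⟩
  rcases le_total t 0 with h | h
  · rw [h0 t h]; exact le_max_right _ _
  · exact (hM t ⟨h, ht⟩).trans (le_max_left _ _)

theorem lower15 (T : ℝ) (hT : 0 < T) (f : ℝ → ℝ) (hf : Continuous f) (h0 : ∀ t ≤ 0, f t = f 0)
    (hp : ∀ t ∈ Icc 0 T, 0 < f t) : ∃ m > 0, ∀ t ≤ T, m ≤ f t := by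
  obtain ⟨s, hs, hmin⟩ := isCompact_Icc.exists_isMinOn (nonempty_Icc.mpr hT.le)
    (hf.continuousOn (s := Icc 0 T))
  refine ⟨f s, hp s hs, fun t ht => ?_⟩
  rcases le_total t 0 with h | h
  · rw [h0 t h]; exact hmin ⟨le_rfl, hT.le⟩
  · exact hmin ⟨h, ht⟩

theorem main15 {T A β m : ℝ} {a h d g : ℝ → ℝ} (C : Coef15 T A β m a h d g)
    (k : ℝ → ℝ → ℝ) (tb : ℝ → EReal)
    (htbT : ∀ ρ : ℝ, tb ρ < (T : EReal))
    (hsol : ∀ ρ t1 : ℝ, tb ρ < (t1 : EReal) → t1 < T → Sol15 T a h d g ρ (k ρ) t1)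
    (hblow : ∀ ρ : ℝ, ⊥ < tb ρ →
      Tendsto (fun t => |k ρ t|) (nhdsWithin (tb ρ).toReal (Set.Ioi (tb ρ).toReal)) atTop)
    (ρ0 : ℝ) (hρ00 : 0 ≤ ρ0) (hρa : sInf {ρ : ℝ | 0 ≤ ρ ∧ ⊥ < tb ρ} ≤ ρ0)
    (hcpos : ∀ ρ, ρ0 < ρ → ∃ c0 > 0, ∀ t ≤ T, c0 ≤ g t + ρ * d t) :
    (∀ ρ : ℝ, ρ0 < ρ → ⊥ < tb ρ) ∧
    ContinuousOn (fun ρ => (tb ρ).toReal) (Set.Ioi ρ0) ∧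
    StrictMonoOn (fun ρ => (tb ρ).toReal) (Set.Ioi ρ0) := by
  have hA := C.A0
  have hcoe : ∀ ρ, ⊥ < tb ρ → ((tb ρ).toReal : EReal) = tb ρ := fun ρ h =>
    EReal.coe_toReal (ne_top_of_lt (htbT ρ)) h.ne'
  have htT : ∀ ρ, ⊥ < tb ρ → (tb ρ).toReal < T := by
    intro ρ h
    have := htbT ρ
    rw [← hcoe ρ h] at this
    exact_mod_cast this
  have hsol' : ∀ ρ, ⊥ < tb ρ → ∀ t1, (tb ρ).toReal < t1 → t1 < T →
      Sol15 T a h d g ρ (k ρ) t1 := by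
    intro ρ h t1 h1 h2
    refine hsol ρ t1 ?_ h2
    rw [← hcoe ρ h]
    exact_mod_cast h1
  have hblow' : ∀ ρ, ⊥ < tb ρ →
      Tendsto (k ρ) (nhdsWithin (tb ρ).toReal (Set.Ioi (tb ρ).toReal)) atTop := by
    intro ρ hb
    refine (hblow ρ hb).congr' ?_
    filter_upwards [Ioo_mem_nhdsGT (htT ρ hb)] with t ht
    exact abs_of_nonneg ((hsol' ρ hb t ht.1 ht.2).nonneg C t le_rfl ht.2.le)
  -- bounded near the blow-up time is impossible
  have hunb : ∀ ρ, ⊥ < tb ρ → ∀ M, (∀ t, (tb ρ).toReal < t → t < T → k ρ t ≤ M) → False := by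
    intro ρ hb M hM
    have := (hblow' ρ hb).eventually_gt_atTop M
    obtain ⟨t, h1, h2⟩ := (this.and (Ioo_mem_nhdsGT (htT ρ hb))).exists
    linarith [hM t h2.1 h2.2]
  have hmono : ∀ ρ1 ρ2, ρ1 ≤ ρ2 → tb ρ1 ≤ tb ρ2 := by
    intro ρ1 ρ2 h12
    by_contra hn
    push Not at hn
    have hb : ⊥ < tb ρ1 := bot_le.trans_lt hn
    have S2 : Sol15 T a h d g ρ2 (k ρ2) (tb ρ1).toReal :=
      hsol ρ2 _ (by rwa [hcoe ρ1 hb]) (htT ρ1 hb)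
    obtain ⟨M, -, hM⟩ := S2.bdd
    refine hunb ρ1 hb M fun t h1 h2 => ?_
    have S2' := hsol ρ2 t (hn.trans (by rw [← hcoe ρ1 hb]; exact_mod_cast h1)) h2
    exact (Sol15.comp C (hsol' ρ1 hb t h1 h2) S2' h12 t le_rfl h2.le).trans
      ((le_abs_self _).trans (hM t h1.le h2.le))
  have hfin : ∀ ρ : ℝ, ρ0 < ρ → ⊥ < tb ρ := by
    intro ρ hρ
    have hne : {ρ : ℝ | 0 ≤ ρ ∧ ⊥ < tb ρ}.Nonempty := by
      obtain ⟨ρL, h1, h2⟩ := Sol15.large C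
      refine ⟨ρL, h1, ?_⟩
      rw [bot_lt_iff_ne_bot]
      intro hbot
      exact h2 (k ρL) fun t1 ht1 => hsol ρL t1 (by rw [hbot]; exact EReal.bot_lt_coe _) ht1
    obtain ⟨ρ', h1, h2⟩ := exists_lt_of_csInf_lt hne (hρa.trans_lt hρ)
    exact h1.2.trans_le (hmono ρ' ρ h2.le)
  have hstrict : StrictMonoOn (fun ρ => (tb ρ).toReal) (Set.Ioi ρ0) := by
    intro ρ1 h1 ρ2 h2 h12
    have b1 := hfin ρ1 h1
    have b2 := hfin ρ2 h2
    have hle : (tb ρ1).toReal ≤ (tb ρ2).toReal :=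
      EReal.toReal_le_toReal (hmono ρ1 ρ2 h12.le) b1.ne' (ne_top_of_lt (htbT ρ2))
    rcases hle.lt_or_eq with h' | h'
    · exact h'
    exfalso
    have S2 := hsol' ρ2 b2
    have L2 := hblow' ρ2 b2
    rw [← h'] at S2 L2
    exact Sol15.strict C h12 (htT ρ1 b1) (hsol' ρ1 b1) S2 (hblow' ρ1 b1) L2
  refine ⟨hfin, ?_, hstrict⟩
  intro x hx
  have hx' : ρ0 < x := hx
  have bx := hfin x hx'
  have hupper : ∀ t1, (tb x).toReal < t1 → t1 < T → ∃ ε > 0, ∀ ρ, x < ρ → ρ < x + ε →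
      (tb ρ).toReal < t1 := by
    intro t1 h1 h2
    obtain ⟨M, hM0, hM⟩ := (hsol' x bx t1 h1 h2).bdd
    obtain ⟨ε, hε, H⟩ := Sol15.close C (x + 1) M t1 (by linarith) hM0
    refine ⟨min ε 1, lt_min hε one_pos, fun ρ hρ1 hρ2 => ?_⟩
    have l1 := min_le_left ε 1
    have l2 := min_le_right ε 1
    by_contra hn
    push Not at hn
    have bρ := hfin ρ (hx'.trans hρ1)
    refine hunb ρ bρ (M + 1) fun t h3 h4 => ?_
    have := H x ρ (k x) (k ρ) t (by linarith) (hsol' x bx t (by linarith) h4) (hsol' ρ bρ t h3 h4)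
      hρ1.le (by rw [abs_of_nonneg (by linarith)]; linarith) (by linarith)
      (fun s h5 h6 => (le_abs_self _).trans (hM s (by linarith) h6)) t le_rfl h4.le
    have := (le_abs_self _).trans (hM t (by linarith) h4.le)
    linarith
  have hlower : ∀ η > 0, ∃ ρ, ρ0 < ρ ∧ ρ < x ∧ (tb x).toReal - η < (tb ρ).toReal := by
    intro η hη
    by_contra hn
    push Not at hn
    set y := (ρ0 + x) / 2 with hy
    have hy0 : ρ0 < y := by linarith
    have hyx : y < x := by linarith
    obtain ⟨c0, hc0, hc⟩ := hcpos y hy0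
    set K := 2 * A / c0 + 8 / (c0 * η) with hK
    have hK0 : 0 < K := by positivity
    have hK1 : 2 * A ≤ c0 * K := by
      have : c0 * K = 2 * A + 8 / η := by rw [hK]; field_simp
      rw [this]
      have : 0 < 8 / η := by positivity
      linarith
    have hK2 : 4 ≤ c0 * (η / 2) * K := by
      have : c0 * (η / 2) * K = A * η + 4 := by rw [hK]; field_simp; ring
      rw [this]
      have : 0 < A * η := by positivity
      linarith
    have hTx := htT x bx
    have ev : ∀ᶠ t in nhdsWithin (tb x).toReal (Ioi (tb x).toReal), K + 1 < k x t ∧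
        (tb x).toReal < t ∧ t < T ∧ t < (tb x).toReal + η / 4 := by
      filter_upwards [(hblow' x bx).eventually_gt_atTop (K + 1), Ioo_mem_nhdsGT hTx,
        Ioo_mem_nhdsGT (show (tb x).toReal < (tb x).toReal + η / 4 by linarith)] with t h1 h2 h3
      exact ⟨h1, h2.1, h2.2, h3.2⟩
    obtain ⟨t1, e1, e2, e3, e4⟩ := ev.exists
    have Sx := hsol' x bx t1 e2 e3
    obtain ⟨M, hM0, hM⟩ := Sx.bdd
    obtain ⟨ε, hε, H⟩ := Sol15.close C x M t1 (by linarith) hM0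
    obtain ⟨ρ, r1, r2⟩ : ∃ ρ, max y (x - ε) < ρ ∧ ρ < x :=
      exists_between (max_lt hyx (by linarith))
    have r3 := (le_max_left _ _).trans_lt r1
    have r4 := (le_max_right _ _).trans_lt r1
    have hρ0 : ρ0 < ρ := hy0.trans r3
    have bρ := hfin ρ hρ0
    have hbd := hn ρ hρ0 r2
    have Sρ := hsol' ρ bρ t1 (by linarith) e3
    have hcl := H ρ x (k ρ) (k x) t1 le_rfl Sρ Sx r2.le (abs_of_nonneg (by linarith)).le
      (by linarith) (fun s h5 h6 => (Sol15.comp C Sρ Sx r2.le s h5 h6).trans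
        ((le_abs_self _).trans (hM s h5 h6))) t1 le_rfl e3.le
    refine Sol15.fast C (hsol' ρ bρ (t1 - η / 2 - η / 8) ?_ (by linarith))
      (by linarith) (by linarith : 0 < η / 2) e3 hc0 ?_ hK0 hK1 hK2 (by linarith)
    · linarith
    · intro t ht
      have := hc t ht
      have : y * d t ≤ ρ * d t := mul_le_mul_of_nonneg_right r3.le (C.m0.le.trans (C.hd t ht))
      linarith
  refine ContinuousAt.continuousWithinAt ?_
  refine tendsto_order.mpr ⟨fun b hb => ?_, fun b hb => ?_⟩
  · obtain ⟨ρ, h1, h2, h3⟩ := hlower ((tb x).toReal - b) (by simpa using hb)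
    filter_upwards [Ioi_mem_nhds h2] with ρ' hρ'
    have := hstrict h1 (h1.trans hρ') hρ'
    simp only at this
    linarith
  · obtain ⟨t1, h1, h2⟩ : ∃ t1, (tb x).toReal < t1 ∧ t1 < min b T :=
      exists_between (lt_min hb (htT x bx))
    have h3 := h2.trans_le (min_le_left _ _)
    obtain ⟨ε, hε, H⟩ := hupper t1 h1 (h2.trans_le (min_le_right _ _))
    filter_upwards [Ioo_mem_nhds hx' (show x < x + ε by linarith)] with ρ' hρ'
    rcases le_or_gt ρ' x with h' | h'
    · have := hstrict.monotoneOn hρ'.1 hx h'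
      linarith
    · exact (H ρ' h' hρ'.2).trans h3

/-- on `(ρ₀, +∞)` with `ρ₀ = max(ρ_a, ρ_b)`, the blow-up time of
the scalar Riccati equation is finite, continuous and strictly increasing. -/
theorem stmt_15
    (T β : ℝ) (hT : 0 < T) (hβ : 0 < β)
    (H11 H12 H13 H14 H21 H22 H33 H44 Hb22 : ℝ → ℝ)
    (hc11 : Continuous H11) (hc12 : Continuous H12) (hc13 : Continuous H13)
    (hc14 : Continuous H14) (hc21 : Continuous H21) (hc22 : Continuous H22)
    (hc33 : Continuous H33) (hc44 : Continuous H44) (hcb22 : Continuous Hb22)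
    (hconst : ∀ t : ℝ, t ≤ 0 → H11 t = H11 0 ∧ H12 t = H12 0 ∧ H13 t = H13 0 ∧
      H14 t = H14 0 ∧ H21 t = H21 0 ∧ H22 t = H22 0 ∧ H33 t = H33 0 ∧
      H44 t = H44 0 ∧ Hb22 t = Hb22 0)
    (hbound : ∀ t : ℝ, t ≤ T → β ≤ H11 t ∧ H22 t ≤ -β ∧ H33 t ≤ -β ∧
      H44 t ≤ -β ∧ Hb22 t < 0)
    (k : ℝ → ℝ → ℝ) (tb : ℝ → EReal)
    (htbT : ∀ ρ : ℝ, tb ρ < (T : EReal))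
    (hterm : ∀ ρ : ℝ, k ρ T = 0)
    (hcont : ∀ ρ : ℝ, ContinuousOn (k ρ) {t : ℝ | tb ρ < (t : EReal) ∧ t ≤ T})
    (hode : ∀ ρ t : ℝ, tb ρ < (t : EReal) → t < T →
      HasDerivAt (k ρ) (-(ricS H11 H13 H14 H21 H22 H33 H44 Hb22 ρ t (k ρ t))) t)
    (hblow : ∀ ρ : ℝ, ⊥ < tb ρ →
      Tendsto (fun t => |k ρ t|) (nhdsWithin (tb ρ).toReal (Set.Ioi (tb ρ).toReal)) atTop)
    (ρa ρb ρ0 : ℝ)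
    (hρb : ρb = sInf ((fun t => H22 t - H33 t * (H13 t) ^ 2 - H44 t * (H14 t) ^ 2) ''
        Set.Icc (0 : ℝ) T) / sSup (Hb22 '' Set.Icc (0 : ℝ) T))
    (hρa : ρa = sInf {ρ : ℝ | 0 ≤ ρ ∧ ⊥ < tb ρ})
    (hρ0 : ρ0 = max ρa ρb) :
    (∀ ρ : ℝ, ρ0 < ρ → ⊥ < tb ρ) ∧
    ContinuousOn (fun ρ => (tb ρ).toReal) (Set.Ioi ρ0) ∧
    StrictMonoOn (fun ρ => (tb ρ).toReal) (Set.Ioi ρ0) := by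
  have hK : ∀ t ≤ (0:ℝ), H13 t = H13 0 ∧ H14 t = H14 0 ∧ H21 t = H21 0 ∧ H22 t = H22 0 ∧
      H33 t = H33 0 ∧ H44 t = H44 0 ∧ Hb22 t = Hb22 0 := fun t ht => by
    obtain ⟨-, -, h⟩ := hconst t ht; exact h
  set a : ℝ → ℝ := fun t => 2 * H21 t + (H13 t) ^ 2 + (H14 t) ^ 2 with ha
  set d : ℝ → ℝ := fun t => - Hb22 t with hd
  set g : ℝ → ℝ := fun t => H22 t - H33 t * (H13 t) ^ 2 - H44 t * (H14 t) ^ 2 with hg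
  have ca : Continuous a := by fun_prop
  have cd : Continuous d := by fun_prop
  have cg : Continuous g := by fun_prop
  have ka : ∀ t ≤ 0, a t = a 0 := by
    intro t ht; obtain ⟨h1, h2, h3, h4, h5, h6, h7⟩ := hK t ht; simp only [ha, h1, h2, h3]
  have kd : ∀ t ≤ 0, d t = d 0 := by
    intro t ht; obtain ⟨h1, h2, h3, h4, h5, h6, h7⟩ := hK t ht; simp only [hd, h7]
  have kg : ∀ t ≤ 0, g t = g 0 := by
    intro t ht; obtain ⟨h1, h2, h3, h4, h5, h6, h7⟩ := hK t ht
    simp only [hg, h1, h2, h4, h5, h6]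
  obtain ⟨B1, hB1⟩ := bound15 T a ca ka
  obtain ⟨B2, hB2⟩ := bound15 T d cd kd
  obtain ⟨B3, hB3⟩ := bound15 T g cg kg
  obtain ⟨B4, hB4⟩ := bound15 T H11 hc11 (fun t ht => (hconst t ht).1)
  obtain ⟨m, hm, hm'⟩ := lower15 T hT d cd kd
    (fun t ht => by have := (hbound t ht.2).2.2.2.2; simp only [hd]; linarith)
  have n1 := (abs_nonneg _).trans (hB1 T le_rfl)
  have n2 := (abs_nonneg _).trans (hB2 T le_rfl)
  have n3 := (abs_nonneg _).trans (hB3 T le_rfl)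
  have n4 := (abs_nonneg _).trans (hB4 T le_rfl)
  have C : Coef15 T (B1 + B2 + B3 + B4 + 1) β m a H11 d g :=
    { β0 := hβ
      m0 := hm
      A0 := by linarith
      ha := fun t ht => by linarith [hB1 t ht]
      hh := fun t ht => (hbound t ht).1
      hh' := fun t ht => by linarith [(le_abs_self _).trans (hB4 t ht)]
      hg := fun t ht => by linarith [hB3 t ht]
      hd := hm'
      hd' := fun t ht => by linarith [(le_abs_self _).trans (hB2 t ht)] }
  have hρa0 : 0 ≤ ρa := by
    rw [hρa]; exact Real.sInf_nonneg fun x hx => hx.1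
  have hρ00 : 0 ≤ ρ0 := by rw [hρ0]; exact hρa0.trans (le_max_left _ _)
  refine main15 C k tb htbT ?_ hblow ρ0 hρ00 ?_ ?_
  · intro ρ t1 h1 h2
    refine ⟨(hcont ρ).mono fun t ht => ⟨h1.trans_le (by exact_mod_cast ht.1), ht.2⟩, hterm ρ, ?_⟩
    intro t h3 h4
    refine (hode ρ t (h1.trans_le (by exact_mod_cast h3)) h4).congr_deriv ?_
    simp only [ricS, ha, hd, hg]
    ring
  · rw [← hρa, hρ0]; exact le_max_left _ _
  · intro ρ hρ
    refine lower15 T hT (fun t => g t + ρ * d t) (by fun_prop) ?_ ?_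
    · intro t ht
      simp only [kg t ht, kd t ht]
    intro t ht
    have hbρ : ρb < ρ := by rw [hρ0] at hρ; exact (le_max_right _ _).trans_lt hρ
    have hne : (Icc (0:ℝ) T).Nonempty := nonempty_Icc.mpr hT.le
    have i1 : sInf (g '' Icc 0 T) ≤ g t :=
      csInf_le (isCompact_Icc.image cg).bddBelow ⟨t, ht, rfl⟩
    have i2 : Hb22 t ≤ sSup (Hb22 '' Icc 0 T) :=
      le_csSup (isCompact_Icc.image hcb22).bddAbove ⟨t, ht, rfl⟩
    have i3 : sSup (Hb22 '' Icc 0 T) < 0 := by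
      obtain ⟨s, hs, hs'⟩ := (isCompact_Icc.image hcb22).sSup_mem (hne.image _)
      rw [← hs']
      exact (hbound s hs.2).2.2.2.2
    have i4 : ρ * sSup (Hb22 '' Icc 0 T) < sInf (g '' Icc 0 T) := by
      rw [hρb, div_lt_iff_of_neg i3] at hbρ
      exact hbρ
    have i5 : ρ * Hb22 t ≤ ρ * sSup (Hb22 '' Icc 0 T) :=
      mul_le_mul_of_nonneg_left i2 (by linarith)
    simp only [hd]
    linarith
end

section
/- Set ρ̃₀ := max(ρ̃_a, ρ_b). Then for every ρ ∈ (ρ̃₀, +∞) the blow-up time t^k̃_ρ of the dual scalar Riccati equation is finite, and the map ρ ↦ t^k̃_ρ is continuous and strictly increasing on (ρ̃₀, +∞). -/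
open Filter Set

/-- Right-hand side of the dual scalar Riccati equation `−k̃̇ = ricD ρ t k̃`. -/
noncomputable def ricD (H11 H13 H14 H21 H22 H33 H44 Hb22 : ℝ → ℝ)
    (ρ t k : ℝ) : ℝ :=
  -(2 * H21 t + (H13 t) ^ 2 + (H14 t) ^ 2) * k - H11 t * k ^ 2
    - (H22 t - ρ * Hb22 t - H33 t * (H13 t) ^ 2 - H44 t * (H14 t) ^ 2)

noncomputable def GG (a h n b : ℝ → ℝ) (ρ s v : ℝ) : ℝ :=
  -a s * v - h s * v ^ 2 - n s + ρ * b s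

structure Coef (a h n b : ℝ → ℝ) (β Am Hm Nm Bm : ℝ) : Prop where
  hβ : 0 < β
  ha : ∀ s, 0 ≤ s → |a s| ≤ Am
  hh : ∀ s, 0 ≤ s → β ≤ h s
  hh' : ∀ s, 0 ≤ s → h s ≤ Hm
  hn : ∀ s, 0 ≤ s → |n s| ≤ Nm
  hb : ∀ s, 0 ≤ s → b s < 0
  hb' : ∀ s, 0 ≤ s → |b s| ≤ Bm

structure Sol_s17 (a h n b : ℝ → ℝ) (ρ : ℝ) (y : ℝ → ℝ) (S : ℝ) : Prop where
  cont : ContinuousOn y (Icc 0 S)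
  der : ∀ s ∈ Ico 0 S, HasDerivWithinAt y (GG a h n b ρ s (y s)) (Ici s) s
  der' : ∀ s ∈ Ioo 0 S, HasDerivAt y (GG a h n b ρ s (y s)) s
  init : y 0 = 0

section
variable {a h n b : ℝ → ℝ} {β Am Hm Nm Bm : ℝ}

theorem Coef.nonnegs (hC : Coef a h n b β Am Hm Nm Bm) :
    0 ≤ Am ∧ 0 < Hm ∧ 0 ≤ Nm ∧ 0 < Bm := by
  refine ⟨(abs_nonneg _).trans (hC.ha 0 le_rfl), ?_, (abs_nonneg _).trans (hC.hn 0 le_rfl), ?_⟩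
  · linarith [hC.hβ, hC.hh 0 le_rfl, hC.hh' 0 le_rfl]
  · exact lt_of_lt_of_le (abs_pos.2 (hC.hb 0 le_rfl).ne) (hC.hb' 0 le_rfl)

theorem Sol_s17.mono {ρ : ℝ} {y : ℝ → ℝ} {S S' : ℝ} (hy : Sol_s17 a h n b ρ y S) (hS : S' ≤ S) :
    Sol_s17 a h n b ρ y S' :=
  ⟨hy.cont.mono (Icc_subset_Icc_right hS), fun s hs => hy.der s ⟨hs.1, hs.2.trans_le hS⟩,
    fun s hs => hy.der' s ⟨hs.1, hs.2.trans_le hS⟩, hy.init⟩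

/-- upper bound for the vector field -/
theorem Coef.GG_le (hC : Coef a h n b β Am Hm Nm Bm) {ρ R s v : ℝ} (hs : 0 ≤ s) (hR : |ρ| ≤ R) :
    GG a h n b ρ s v ≤ Am * |v| - β * v ^ 2 + Nm + R * Bm := by
  have h1 : -a s * v ≤ Am * |v| := by
    calc -a s * v ≤ |-a s * v| := le_abs_self _
      _ = |a s| * |v| := by rw [abs_mul, abs_neg]
      _ ≤ _ := by gcongr; exact hC.ha s hs
  have h2 : β * v ^ 2 ≤ h s * v ^ 2 := by gcongr; exact hC.hh s hs
  have h3 := (abs_le.1 (hC.hn s hs)).1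
  have h4 : ρ * b s ≤ R * Bm := by
    calc ρ * b s ≤ |ρ * b s| := le_abs_self _
      _ = |ρ| * |b s| := abs_mul _ _
      _ ≤ _ := by
        gcongr
        · exact (abs_nonneg _).trans hR
        · exact hC.hb' s hs
  unfold GG
  linarith

theorem solCmp (hC : Coef a h n b β Am Hm Nm Bm) {ρ1 ρ2 S : ℝ} {y1 y2 : ℝ → ℝ}
    (h1 : Sol_s17 a h n b ρ1 y1 S) (h2 : Sol_s17 a h n b ρ2 y2 S) (hρ : ρ1 < ρ2) :
    ∀ s ∈ Icc 0 S, y2 s ≤ y1 s := by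
  have := image_le_of_deriv_right_lt_deriv_boundary' h2.cont h2.der (B := y1)
    (B' := fun s => GG a h n b ρ1 s (y1 s)) (by rw [h1.init, h2.init]) h1.cont h1.der (by
      intro x hx hxx
      have := hC.hb x hx.1
      simp only [GG, hxx]
      nlinarith)
  exact fun s hs => this hs

theorem solCmp_strict (hC : Coef a h n b β Am Hm Nm Bm) {ρ1 ρ2 S : ℝ} {y1 y2 : ℝ → ℝ}
    (h1 : Sol_s17 a h n b ρ1 y1 S) (h2 : Sol_s17 a h n b ρ2 y2 S) (hρ : ρ1 < ρ2) :
    ∀ s ∈ Ioo 0 S, y2 s < y1 s := by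
  intro s hs
  have hle := solCmp hC h1 h2 hρ
  refine lt_of_le_of_ne (hle s ⟨hs.1.le, hs.2.le⟩) fun he => ?_
  have hd := (h1.der' s hs).sub (h2.der' s hs)
  have hm : IsLocalMin (y1 - y2) s := by
    filter_upwards [Ioo_mem_nhds hs.1 hs.2] with x hx
    have := hle x ⟨hx.1.le, hx.2.le⟩
    simp only [Pi.sub_apply]
    linarith
  have h0 := hm.hasDerivAt_eq_zero hd
  have := hC.hb s hs.1.le
  simp only [GG, he] at h0
  nlinarith

theorem upper (hC : Coef a h n b β Am Hm Nm Bm) (ρ : ℝ) : ∃ K : ℝ, ∀ (S : ℝ) (y : ℝ → ℝ),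
    Sol_s17 a h n b ρ y S → ∀ s ∈ Icc 0 S, y s ≤ K := by
  obtain ⟨hA, hH, hN, hB⟩ := hC.nonnegs
  have hβ := hC.hβ
  have hc : 0 ≤ Nm + |ρ| * Bm := by positivity
  set c := Nm + |ρ| * Bm with hcd
  set K := (Am + c) / β + 1 with hK
  have hK1 : 1 ≤ K := by
    have : 0 ≤ (Am + c) / β := by positivity
    linarith
  have hKβ : β * K = Am + c + β := by rw [hK]; field_simp
  refine ⟨K, fun S y hy => ?_⟩
  have := image_le_of_deriv_right_lt_deriv_boundary hy.cont hy.der (B := fun _ => K)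
    (B' := fun s => 0) (by rw [hy.init]; linarith) (fun x => hasDerivAt_const _ _) (by
      intro x hx hxx
      try simp only at hxx
      have := hC.GG_le (v := y x) hx.1 (le_refl |ρ|)
      rw [hxx, abs_of_pos (by linarith : (0:ℝ) < K)] at this
      rw [hxx]
      nlinarith)
  exact fun s hs => this hs

theorem blow_s17 (hC : Coef a h n b β Am Hm Nm Bm) (R : ℝ) (hR0 : 0 ≤ R) : ∃ K0 : ℝ, 1 ≤ K0 ∧
    ∀ (ρ S s1 K : ℝ) (y : ℝ → ℝ), |ρ| ≤ R → Sol_s17 a h n b ρ y S → s1 ∈ Icc 0 S → K0 ≤ K →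
      y s1 ≤ -K → S < s1 + 4 / (β * K) := by
  obtain ⟨hA, hH, hN, hB⟩ := hC.nonnegs
  have hβ := hC.hβ
  have hc : 0 ≤ Nm + R * Bm := by positivity
  set c := Nm + R * Bm with hcd
  set K0 := 2 * (Am + c) / β + 1 with hK
  have hK1 : 1 ≤ K0 := by
    have : 0 ≤ 2 * (Am + c) / β := by positivity
    linarith
  have hKβ : β * K0 = 2 * (Am + c) + β := by rw [hK]; field_simp
  refine ⟨K0, hK1, ?_⟩
  intro ρ S s1 K y hρ hy hs1 hKK hy1
  have hKpos : 0 < K := by linarith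
  by_contra! hS
  obtain ⟨M, hM⟩ := isCompact_Icc.exists_bound_of_continuousOn hy.cont
  set M' := max M K with hM'
  have hM'K : K ≤ M' := le_max_right _ _
  have hM'pos : 0 < M' := by linarith
  set η := 1 / (2 * M') with hη
  have hηpos : 0 < η := by positivity
  have hηK : η < 1 / K := by
    rw [hη]; apply one_div_lt_one_div_of_lt <;> linarith
  set γ := β / 4 with hγ
  have hγpos : 0 < γ := by positivity
  set s2 := s1 + (1 / K - η) / γ with hs2
  have h12 : s1 ≤ s2 := by
    have : 0 ≤ (1 / K - η) / γ := div_nonneg (by linarith) hγpos.le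
    linarith
  have h2S : s2 ≤ S := by
    have : (1 / K - η) / γ ≤ 4 / (β * K) := by
      have e : 4 / (β * K) = (1 / K) / γ := by rw [hγ]; field_simp
      rw [e]; gcongr; linarith
    linarith
  have hγs : γ * (s2 - s1) = 1 / K - η := by rw [hs2]; field_simp; ring
  have hq : ∀ x ∈ Icc s1 s2, η ≤ 1 / K - γ * (x - s1) := by
    intro x hx
    have : γ * (x - s1) ≤ γ * (s2 - s1) := by gcongr; exact hx.2
    linarith
  have hqd : ∀ x ∈ Icc s1 s2, HasDerivAt (fun x => -(1 / K - γ * (x - s1))⁻¹)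
      (-γ * ((1 / K - γ * (x - s1))⁻¹) ^ 2) x := by
    intro x hx
    have h0 : 1 / K - γ * (x - s1) ≠ 0 := by have := hq x hx; linarith
    have e : HasDerivAt (fun x => 1 / K - γ * (x - s1)) (-γ) x := by
      have := (((hasDerivAt_id x).sub_const s1).const_mul γ).const_sub (1 / K)
      simpa using this
    have e2 := (e.fun_inv h0).fun_neg
    refine e2.congr_deriv ?_
    rw [neg_neg, div_eq_mul_inv, inv_pow]; ring
  have key := image_le_of_deriv_right_lt_deriv_boundary' (f := y) (a := s1) (b := s2)
    (f' := fun s => GG a h n b ρ s (y s))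
    (hy.cont.mono (Icc_subset_Icc hs1.1 h2S))
    (fun x hx => hy.der x ⟨hs1.1.trans hx.1, hx.2.trans_le h2S⟩)
    (B := fun x => -(1 / K - γ * (x - s1))⁻¹)
    (B' := fun x => -γ * ((1 / K - γ * (x - s1))⁻¹) ^ 2)
    (by simpa using hy1)
    (fun x hx => (hqd x hx).continuousAt.continuousWithinAt)
    (fun x hx => (hqd x ⟨hx.1, hx.2.le⟩).hasDerivWithinAt)
    (by
      intro x hx hxx
      have hq1 := hq x ⟨hx.1, hx.2.le⟩
      have hq2 : 1 / K - γ * (x - s1) ≤ 1 / K := by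
        have : 0 ≤ γ * (x - s1) := mul_nonneg hγpos.le (by linarith [hx.1])
        linarith
      set q := 1 / K - γ * (x - s1) with hqdef
      have hqpos : 0 < q := by linarith
      have hKq : K ≤ q⁻¹ := by
        rw [le_inv_comm₀ hKpos hqpos]; simpa using hq2
      try simp only at hxx ⊢
      set v := q⁻¹ with hv
      have := hC.GG_le (v := y x) (hs1.1.trans hx.1) hρ
      rw [hxx, abs_neg, abs_of_pos (by linarith : (0:ℝ) < v)] at this
      rw [hxx]
      have hv1 : 1 ≤ v := by linarith
      have hv2 : K0 ≤ v := by linarith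
      have h3 : β * K0 * v ≤ β * v * v := by gcongr
      rw [hKβ] at h3
      rw [hγ]
      nlinarith)
  have h3 := key (right_mem_Icc.2 h12)
  have h4 := hM s2 ⟨hs1.1.trans h12, h2S⟩
  simp only [hγs] at h3
  have h5 : (1 / K - (1 / K - η))⁻¹ = 2 * M' := by
    rw [sub_sub_cancel, hη]; simp
  rw [h5] at h3
  have h6 := (abs_le.1 h4).1
  have h7 : M ≤ M' := le_max_left _ _
  linarith

theorem close_lem (hC : Coef a h n b β Am Hm Nm Bm) (K S : ℝ) (hK : 0 ≤ K) :
    ∃ δ > 0, ∀ (ρ1 ρ2 S' : ℝ) (y1 y2 : ℝ → ℝ), ρ1 < ρ2 → ρ2 < ρ1 + δ → S' ≤ S →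
      Sol_s17 a h n b ρ1 y1 S' → Sol_s17 a h n b ρ2 y2 S' →
      (∀ s ∈ Icc 0 S', |y1 s| ≤ K ∨ |y2 s| ≤ K) → ∀ s ∈ Icc 0 S', y1 s - y2 s ≤ 1 := by
  obtain ⟨hA, hH, hN, hB⟩ := hC.nonnegs
  set M := Am + Hm * (2 * K + 1) + 1 with hM
  have hMpos : 0 < M := by positivity
  set ε := Real.exp (-(M * S)) with hε
  have hεpos : 0 < ε := Real.exp_pos _
  refine ⟨ε / Bm, by positivity, ?_⟩
  intro ρ1 ρ2 S' y1 y2 h12 h21 hSS h1 h2 hb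
  have hδ : (ρ2 - ρ1) * Bm < ε := by
    rw [← lt_div_iff₀ hB]; linarith
  have key := image_le_of_deriv_right_lt_deriv_boundary (f := fun s => y1 s - y2 s)
    (f' := fun s => GG a h n b ρ1 s (y1 s) - GG a h n b ρ2 s (y2 s))
    (h1.cont.sub h2.cont) (fun x hx => (h1.der x hx).sub (h2.der x hx))
    (B := fun s => ε * Real.exp (M * s)) (B' := fun s => ε * (Real.exp (M * s) * M))
    (by simp [h1.init, h2.init, hεpos.le])
    (fun x => by
      have : HasDerivAt (fun s => M * s) M x := by simpa using (hasDerivAt_id x).const_mul M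
      exact (this.exp).const_mul ε)
    (by
      intro x hx hxx
      try simp only at hxx ⊢
      have hB1 : ε ≤ ε * Real.exp (M * x) :=
        le_mul_of_one_le_right hεpos.le (Real.one_le_exp (mul_nonneg hMpos.le hx.1))
      have hB2 : ε * Real.exp (M * x) ≤ 1 := by
        rw [hε, ← Real.exp_add, Real.exp_le_one_iff]
        have : M * x ≤ M * S := by gcongr; linarith [hx.2]
        linarith
      rw [← mul_assoc]
      set D := ε * Real.exp (M * x) with hD
      have hDpos : 0 < D := by linarith
      have hsum : |y1 x + y2 x| ≤ 2 * K + 1 := by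
        rcases hb x ⟨hx.1, hx.2.le⟩ with h | h <;> rw [abs_le] at h ⊢ <;>
          constructor <;> linarith [h.1, h.2]
      have hab : |a x + h x * (y1 x + y2 x)| ≤ Am + Hm * (2 * K + 1) := by
        refine (abs_add_le _ _).trans (add_le_add (hC.ha x hx.1) ?_)
        rw [abs_mul]
        have hhx := hC.hh x hx.1
        have := hC.hβ
        rw [abs_of_pos (by linarith : 0 < h x)]
        gcongr
        exact hC.hh' x hx.1
      have e : GG a h n b ρ1 x (y1 x) - GG a h n b ρ2 x (y2 x) =
          -(a x + h x * (y1 x + y2 x)) * D + (ρ2 - ρ1) * (- b x) := by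
        rw [← hxx]; unfold GG; ring
      rw [e]
      have h5 : -(a x + h x * (y1 x + y2 x)) * D ≤ (Am + Hm * (2 * K + 1)) * D := by
        gcongr
        exact (neg_le_abs _).trans hab
      have h6 : (ρ2 - ρ1) * (- b x) ≤ (ρ2 - ρ1) * Bm := by
        have := (neg_le_abs _).trans (hC.hb' x hx.1)
        have h0 : 0 ≤ ρ2 - ρ1 := by linarith
        gcongr
      rw [hM]
      nlinarith)
  intro s hs
  refine (key hs).trans ?_
  try simp only
  rw [hε, ← Real.exp_add, Real.exp_le_one_iff]
  have : M * s ≤ M * S := by gcongr; linarith [hs.2]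
  linarith

theorem sep (hC : Coef a h n b β Am Hm Nm Bm) {ρ1 ρ2 S s0 : ℝ} {y1 y2 : ℝ → ℝ}
    (h1 : Sol_s17 a h n b ρ1 y1 S) (h2 : Sol_s17 a h n b ρ2 y2 S) (hρ : ρ1 < ρ2)
    (hs0 : s0 ∈ Icc 0 S) (hy1 : ∀ s ∈ Icc s0 S, y1 s ≤ -1) (hlt : y2 s0 < y1 s0) :
    ((y2 s0)⁻¹ - (y1 s0)⁻¹) * Real.exp (-(Am + 2 * (Nm + |ρ2| * Bm) + 1) * (S - s0)) ≤
      -(y1 S)⁻¹ := by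
  obtain ⟨hA, hH, hN, hB⟩ := hC.nonnegs
  have hle := solCmp hC h1 h2 hρ
  have hy2 : ∀ s ∈ Icc s0 S, y2 s ≤ -1 := fun s hs =>
    (hle s ⟨hs0.1.trans hs.1, hs.2⟩).trans (hy1 s hs)
  set M := Am + 2 * (Nm + |ρ2| * Bm) + 1 with hM
  set ε := (y2 s0)⁻¹ - (y1 s0)⁻¹ with hε
  have hεpos : 0 < ε := by
    have a1 := hy1 s0 ⟨le_rfl, hs0.2⟩
    have := (inv_lt_inv_of_neg (by linarith) (by linarith : y2 s0 < 0)).2 hlt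
    linarith
  have hsub : Icc s0 S ⊆ Icc 0 S := Icc_subset_Icc_left hs0.1
  have key := image_le_of_deriv_right_lt_deriv_boundary (a := s0) (b := S)
    (f := fun s => (y1 s)⁻¹ - (y2 s)⁻¹)
    (f' := fun s => -GG a h n b ρ1 s (y1 s) / (y1 s) ^ 2 - -GG a h n b ρ2 s (y2 s) / (y2 s) ^ 2)
    (((h1.cont.mono hsub).inv₀ fun x hx => by linarith [hy1 x hx]).sub
      ((h2.cont.mono hsub).inv₀ fun x hx => by linarith [hy2 x hx]))
    (fun x hx => by
      have hx' : x ∈ Icc s0 S := ⟨hx.1, hx.2.le⟩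
      have hx'' : x ∈ Ico 0 S := ⟨hs0.1.trans hx.1, hx.2⟩
      exact ((h1.der x hx'').fun_inv (by linarith [hy1 x hx'])).sub
        ((h2.der x hx'').fun_inv (by linarith [hy2 x hx'])))
    (B := fun s => -ε * Real.exp (-M * (s - s0)))
    (B' := fun s => -ε * (Real.exp (-M * (s - s0)) * (-M)))
    (by simp [hε])
    (fun x => by
      have : HasDerivAt (fun s => -M * (s - s0)) (-M) x := by
        simpa using ((hasDerivAt_id x).sub_const s0).const_mul (-M)
      exact (this.exp).const_mul (-ε))
    (by
      intro x hx hxx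
      have hx' : x ∈ Icc s0 S := ⟨hx.1, hx.2.le⟩
      have hx0 : 0 ≤ x := hs0.1.trans hx.1
      have hz1 := hy1 x hx'
      have hz2 := hy2 x hx'
      try simp only at hxx ⊢
      have hE : 0 < ε * Real.exp (-M * (x - s0)) := mul_pos hεpos (Real.exp_pos _)
      set w1 := (y1 x)⁻¹ with hw1
      set w2 := (y2 x)⁻¹ with hw2
      have e1 : -GG a h n b ρ1 x (y1 x) / (y1 x) ^ 2 = a x * w1 + h x + (n x - ρ1 * b x) * w1 ^ 2 := by
        have : y1 x ≠ 0 := by linarith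
        rw [hw1]; unfold GG; field_simp; ring
      have e2 : -GG a h n b ρ2 x (y2 x) / (y2 x) ^ 2 = a x * w2 + h x + (n x - ρ2 * b x) * w2 ^ 2 := by
        have : y2 x ≠ 0 := by linarith
        rw [hw2]; unfold GG; field_simp; ring
      rw [e1, e2]
      have b1 : -1 ≤ w1 ∧ w1 < 0 := by
        refine ⟨?_, inv_lt_zero.2 (by linarith)⟩
        have := (inv_le_inv_of_neg (by linarith : (-1:ℝ) < 0) (by linarith : y1 x < 0)).2 hz1
        norm_num at this; exact this
      have b2 : -1 ≤ w2 ∧ w2 < 0 := by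
        refine ⟨?_, inv_lt_zero.2 (by linarith)⟩
        have := (inv_le_inv_of_neg (by linarith : (-1:ℝ) < 0) (by linarith : y2 x < 0)).2 hz2
        norm_num at this; exact this
      set E := ε * Real.exp (-M * (x - s0)) with hEd
      have hxE : w1 - w2 = -E := by rw [hxx, hEd]; ring
      have e3 : a x * w1 + h x + (n x - ρ1 * b x) * w1 ^ 2 -
          (a x * w2 + h x + (n x - ρ2 * b x) * w2 ^ 2) =
          -(a x + (n x - ρ2 * b x) * (w1 + w2)) * E + (ρ2 - ρ1) * w1 ^ 2 * b x := by
        have : E = w2 - w1 := by linarith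
        rw [this]; ring
      have e4 : -ε * (Real.exp (-M * (x - s0)) * (-M)) = M * E := by rw [hEd]; ring
      rw [e3, e4]
      have h5 : |n x - ρ2 * b x| ≤ Nm + |ρ2| * Bm := by
        refine (abs_sub _ _).trans (add_le_add (hC.hn x hx0) ?_)
        rw [abs_mul]; gcongr; exact hC.hb' x hx0
      have h6 : |w1 + w2| ≤ 2 := abs_le.2 ⟨by linarith [b1.1, b2.1], by linarith [b1.2, b2.2]⟩
      have h7 : |a x + (n x - ρ2 * b x) * (w1 + w2)| ≤ Am + (Nm + |ρ2| * Bm) * 2 := by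
        refine (abs_add_le _ _).trans (add_le_add (hC.ha x hx0) ?_)
        rw [abs_mul]; gcongr
      have h8 : -(a x + (n x - ρ2 * b x) * (w1 + w2)) * E ≤ (Am + (Nm + |ρ2| * Bm) * 2) * E := by
        gcongr
        exact (neg_le_abs _).trans h7
      have h9 : (ρ2 - ρ1) * w1 ^ 2 * b x ≤ 0 :=
        mul_nonpos_of_nonneg_of_nonpos (mul_nonneg (by linarith) (sq_nonneg _)) (hC.hb x hx0).le
      rw [hM]
      nlinarith)
  have hk := key (right_mem_Icc.2 hs0.2)
  try simp only at hk
  have : (y2 S)⁻¹ < 0 := inv_lt_zero.2 (by linarith [hy2 S ⟨hs0.2, le_rfl⟩])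
  linarith

theorem decay (hC : Coef a h n b β Am Hm Nm Bm) (bm : ℝ) (hbm : 0 < bm)
    (hbb : ∀ s, 0 ≤ s → b s ≤ -bm) : ∃ ρ > 0, ∀ (S : ℝ) (y : ℝ → ℝ),
    Sol_s17 a h n b ρ y S → ∀ s ∈ Icc 0 S, y s ≤ -s := by
  obtain ⟨hA, hH, hN, hB⟩ := hC.nonnegs
  have hβ := hC.hβ
  set ρ := (Am ^ 2 / β + Nm + 2) / bm with hρ
  have hρpos : 0 < ρ := by positivity
  have hρb : ρ * bm = Am ^ 2 / β + Nm + 2 := by rw [hρ]; field_simp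
  refine ⟨ρ, hρpos, fun S y hy => ?_⟩
  have := image_le_of_deriv_right_lt_deriv_boundary hy.cont hy.der (B := fun s => -s)
    (B' := fun s => -1) (by rw [hy.init]; simp) (fun x => (hasDerivAt_id x).neg) (by
      intro x hx hxx
      set v := y x
      have h1 : -a x * v ≤ Am * |v| := by
        calc -a x * v ≤ |-a x * v| := le_abs_self _
          _ = |a x| * |v| := by rw [abs_mul, abs_neg]
          _ ≤ _ := by gcongr; exact hC.ha x hx.1
      have h2 : β * v ^ 2 ≤ h x * v ^ 2 := by gcongr; exact hC.hh x hx.1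
      have h3 := (abs_le.1 (hC.hn x hx.1)).1
      have h4 : ρ * b x ≤ ρ * (-bm) := by gcongr; exact hbb x hx.1
      have h5 : Am * |v| - β * v ^ 2 ≤ Am ^ 2 / β := by
        rw [le_div_iff₀ hβ, ← sq_abs v]
        nlinarith [sq_nonneg (Am - β * |v|), sq_nonneg (β * |v|), sq_nonneg Am, mul_nonneg hA (mul_nonneg hβ.le (abs_nonneg v))]
      unfold GG
      linarith)
  exact fun s hs => this hs
end

theorem Sol_s17.of_interior {a h n b : ℝ → ℝ} {ρ : ℝ} {y : ℝ → ℝ} {S : ℝ}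
    (ha : Continuous a) (hh : Continuous h) (hn : Continuous n) (hb : Continuous b)
    (cont : ContinuousOn y (Icc 0 S))
    (der' : ∀ s ∈ Ioo 0 S, HasDerivAt y (GG a h n b ρ s (y s)) s) (init : y 0 = 0) :
    Sol_s17 a h n b ρ y S := by
  refine ⟨cont, ?_, der', init⟩
  intro s hs
  rcases hs.1.eq_or_lt with h0 | h0
  · subst h0
    have hS : 0 < S := hs.2
    refine hasDerivWithinAt_Ici_of_tendsto_deriv (s := Ioo 0 S)
      (fun x hx => (der' x hx).differentiableAt.differentiableWithinAt)
      ((cont 0 ⟨le_rfl, hS.le⟩).mono Ioo_subset_Icc_self) (Ioo_mem_nhdsGT hS) ?_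
    have hc : ContinuousOn (fun s => GG a h n b ρ s (y s)) (Icc 0 S) := by
      unfold GG
      have := ha.continuousOn (s := Icc 0 S)
      have := hh.continuousOn (s := Icc 0 S)
      have := hn.continuousOn (s := Icc 0 S)
      have := hb.continuousOn (s := Icc 0 S)
      fun_prop
    have h1 : Tendsto (fun s => GG a h n b ρ s (y s)) (nhdsWithin 0 (Ioi 0))
        (nhds (GG a h n b ρ 0 (y 0))) := by
      have := (hc 0 ⟨le_rfl, hS.le⟩).mono (Ioo_subset_Icc_self)
      rw [ContinuousWithinAt, nhdsWithin_Ioo_eq_nhdsGT hS] at this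
      exact this
    refine h1.congr' ?_
    filter_upwards [Ioo_mem_nhdsGT hS] with x hx
    exact (der' x hx).deriv.symm
  · exact (der' s ⟨h0, hs.2⟩).hasDerivWithinAt

theorem glue {a h n b : ℝ → ℝ} {β Am Hm Nm Bm : ℝ}
    (hC : Coef a h n b β Am Hm Nm Bm) (bm : ℝ) (hbm : 0 < bm)
    (hbb : ∀ s, 0 ≤ s → b s ≤ -bm) (y : ℝ → ℝ → ℝ) (tb : ℝ → EReal) (T : ℝ)
    (htbT : ∀ ρ : ℝ, tb ρ < (T : EReal))
    (hSol : ∀ ρ S : ℝ, 0 ≤ S → tb ρ < ((T - S : ℝ) : EReal) → Sol_s17 a h n b ρ (y ρ) S)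
    (hblow : ∀ ρ : ℝ, ⊥ < tb ρ → ∀ M : ℝ, ∃ s0 : ℝ, 0 < s0 ∧ s0 < T - (tb ρ).toReal ∧
      ∀ s ∈ Ico s0 (T - (tb ρ).toReal), M ≤ |y ρ s|)
    (ρta ρt0 : ℝ)
    (hρta : ρta = sInf {ρ : ℝ | 0 < ρ ∧ ⊥ < tb ρ}) (hρt0 : ρta ≤ ρt0) :
    (∀ ρ : ℝ, ρt0 < ρ → ⊥ < tb ρ) ∧
    ContinuousOn (fun ρ => (tb ρ).toReal) (Set.Ioi ρt0) ∧
    StrictMonoOn (fun ρ => (tb ρ).toReal) (Set.Ioi ρt0) := by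
  have hβ := hC.hβ
  have hreal : ∀ ρ, ⊥ < tb ρ → (((tb ρ).toReal : ℝ) : EReal) = tb ρ := fun ρ h =>
    EReal.coe_toReal ((htbT ρ).trans_le le_top).ne h.ne'
  -- domain in real terms
  have hdom : ∀ ρ, ⊥ < tb ρ → ∀ s, s < T - (tb ρ).toReal → tb ρ < ((T - s : ℝ) : EReal) := by
    intro ρ hρ s hs
    rw [← hreal ρ hρ, EReal.coe_lt_coe_iff]; linarith
  have hneg : ∀ ρ : ℝ, ⊥ < tb ρ → ∀ M : ℝ, ∃ s0 : ℝ, 0 < s0 ∧ s0 < T - (tb ρ).toReal ∧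
      ∀ s ∈ Ico s0 (T - (tb ρ).toReal), y ρ s ≤ -M := by
    intro ρ hρ M
    obtain ⟨K, hK⟩ := upper hC ρ
    obtain ⟨s0, h0, h1, h2⟩ := hblow ρ hρ (max M (K + 1))
    refine ⟨s0, h0, h1, fun s hs => ?_⟩
    have h3 := h2 s hs
    have hs0 : 0 ≤ s := h0.le.trans hs.1
    have h4 := hK s _ (hSol ρ s hs0 (hdom ρ hρ s hs.2)) s ⟨hs0, le_rfl⟩
    have h5 := le_max_left M (K + 1)
    have h6 := le_max_right M (K + 1)
    rcases le_abs.1 h3 with h | h <;> linarith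
  have hmono : ∀ ρ1 ρ2, ρ1 < ρ2 → ⊥ < tb ρ1 → tb ρ1 ≤ tb ρ2 := by
    intro ρ1 ρ2 h12 hb1
    by_contra! hlt
    have e : T - (T - (tb ρ1).toReal) = (tb ρ1).toReal := by ring
    have hS0 : 0 ≤ T - (tb ρ1).toReal := by
      obtain ⟨s0, h0, h1, -⟩ := hneg ρ1 hb1 0
      linarith
    have s2 := hSol ρ2 (T - (tb ρ1).toReal) hS0 (by rw [e, hreal ρ1 hb1]; exact hlt)
    obtain ⟨M, hM⟩ := isCompact_Icc.exists_bound_of_continuousOn s2.cont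
    obtain ⟨s, h0, h1, h2⟩ := hneg ρ1 hb1 (M + 1)
    have h3 := h2 s ⟨le_rfl, h1⟩
    have h4 := solCmp hC (hSol ρ1 s h0.le (hdom ρ1 hb1 s h1)) (s2.mono h1.le) h12 s ⟨h0.le, le_rfl⟩
    have h5 := (abs_le.1 (hM s ⟨h0.le, h1.le⟩)).1
    linarith
  have hfin : ∀ ρ : ℝ, ρt0 < ρ → ⊥ < tb ρ := by
    intro ρ hρ
    have hne : {ρ : ℝ | 0 < ρ ∧ ⊥ < tb ρ}.Nonempty := by
      obtain ⟨r, hr, hdec⟩ := decay hC bm hbm hbb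
      refine ⟨r, hr, ?_⟩
      by_contra hbot
      have hbot : tb r = ⊥ := by simpa using hbot
      obtain ⟨K0, hK0, hB⟩ := blow_s17 hC |r| (abs_nonneg r)
      have hpos : 0 < 4 / (β * K0) := by positivity
      have hs : Sol_s17 a h n b r (y r) (K0 + 4 / (β * K0)) :=
        hSol r _ (by linarith) (by rw [hbot]; exact EReal.bot_lt_coe _)
      have := hB r _ K0 K0 (y r) le_rfl hs ⟨by linarith, by linarith⟩ le_rfl
        (hdec _ _ hs K0 ⟨by linarith, by linarith⟩)
      exact lt_irrefl _ this
    have : sInf {ρ : ℝ | 0 < ρ ∧ ⊥ < tb ρ} < ρ := by rw [← hρta]; linarith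
    obtain ⟨r, hr, hrρ⟩ := exists_lt_of_csInf_lt hne this
    exact hr.2.trans_le (hmono r ρ hrρ hr.2)
  have hmonoR : ∀ ρ1 ρ2, ρt0 < ρ1 → ρ1 ≤ ρ2 → (tb ρ1).toReal ≤ (tb ρ2).toReal := by
    intro ρ1 ρ2 h1 h12
    rcases h12.eq_or_lt with he | hl
    · rw [he]
    · have := hmono ρ1 ρ2 hl (hfin ρ1 h1)
      rw [← hreal ρ1 (hfin ρ1 h1), ← hreal ρ2 (hfin ρ2 (h1.trans hl)), EReal.coe_le_coe_iff] at this
      exact this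
  refine ⟨hfin, ?_, ?_⟩
  · intro r hr
    have hr : ρt0 < r := hr
    apply ContinuousAt.continuousWithinAt
    have hbr := hfin r hr
    rw [ContinuousAt, tendsto_order]
    constructor
    · intro c hc
      obtain ⟨K0, hK0, hB⟩ := blow_s17 hC (|r| + 1) (by positivity)
      set τ := (tb r).toReal with hτ
      have hgap : 0 < τ - c := by linarith
      set M := max K0 (8 / (β * (τ - c))) with hM
      have hMpos : 0 < M := lt_of_lt_of_le (by linarith) (le_max_left _ _)
      have hM4 : 4 / (β * M) < τ - c := by
        have h8 : 8 / (β * (τ - c)) ≤ M := le_max_right _ _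
        rw [div_le_iff₀ (by positivity)] at h8
        rw [div_lt_iff₀ (by positivity)]
        nlinarith
      obtain ⟨s1, h0, h1, h2⟩ := hneg r hbr (M + 1)
      have hsol := hSol r s1 h0.le (hdom r hbr s1 h1)
      obtain ⟨K, hK⟩ := isCompact_Icc.exists_bound_of_continuousOn hsol.cont
      have hKn : 0 ≤ K := (norm_nonneg _).trans (hK 0 ⟨le_rfl, h0.le⟩)
      obtain ⟨δ, hδ, hcl⟩ := close_lem hC K s1 hKn
      filter_upwards [Ioi_mem_nhds hr, Ioi_mem_nhds (show r - δ < r by linarith),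
        Ioi_mem_nhds (show r - 1 < r by linarith)] with ρ hρ1 hρ2 hρ3
      simp only [mem_Ioi] at hρ1 hρ2 hρ3
      rcases le_or_gt r ρ with hle | hlt
      · exact hc.trans_le (hmonoR r ρ hr hle)
      · have hbρ := hfin ρ hρ1
        have hm := hmonoR ρ r hρ1 hlt.le
        have hsρ := hSol ρ s1 h0.le (hdom ρ hbρ s1 (by linarith))
        have hd := hcl ρ r s1 (y ρ) (y r) hlt (by linarith) le_rfl hsρ hsol
          (fun s hs => Or.inr (hK s hs)) s1 ⟨h0.le, le_rfl⟩
        have hy1 := h2 s1 ⟨le_rfl, h1⟩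
        by_contra! hcon
        have hp : 0 < 4 / (β * M) := by positivity
        have hsρ' := hSol ρ (s1 + 4 / (β * M)) (by linarith) (hdom ρ hbρ _ (by linarith))
        have habs : |ρ| ≤ |r| + 1 := by
          have : |ρ| ≤ |r| + |ρ - r| := by
            have := abs_add_le r (ρ - r)
            rwa [add_sub_cancel] at this
          have h' : |ρ - r| ≤ 1 := abs_le.2 ⟨by linarith, by linarith⟩
          linarith
        have := hB ρ _ s1 M (y ρ) habs hsρ' ⟨h0.le, by linarith⟩ (le_max_left _ _) (by linarith)
        exact lt_irrefl _ this
    · intro c hc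
      set τ := (tb r).toReal with hτ
      have hτT : τ < T := by
        obtain ⟨s1, h0, h1, h2⟩ := hneg r hbr 0
        linarith
      obtain ⟨c', hc1, hc2⟩ := exists_between (lt_min hc hτT)
      have hc3 : c' < c := hc2.trans_le (min_le_left _ _)
      have hc4 : c' < T := hc2.trans_le (min_le_right _ _)
      have hS0 : 0 ≤ T - c' := by linarith
      have hsol := hSol r (T - c') hS0 (hdom r hbr _ (by linarith))
      obtain ⟨K, hK⟩ := isCompact_Icc.exists_bound_of_continuousOn hsol.cont
      have hKn : 0 ≤ K := (norm_nonneg _).trans (hK 0 ⟨le_rfl, hS0⟩)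
      obtain ⟨δ, hδ, hcl⟩ := close_lem hC K (T - c') hKn
      filter_upwards [Ioi_mem_nhds hr, Iio_mem_nhds (show r < r + δ by linarith)] with ρ hρ1 hρ2
      simp only [mem_Ioi, mem_Iio] at hρ1 hρ2
      rcases le_or_gt ρ r with hle | hlt
      · exact (hmonoR ρ r hρ1 hle).trans_lt hc
      · have hbρ := hfin ρ hρ1
        by_contra! hcon
        obtain ⟨s1, h0, h1, h2⟩ := hneg ρ hbρ (K + 2)
        have hsT : s1 ≤ T - c' := by linarith
        have hd := hcl r ρ s1 (y r) (y ρ) hlt hρ2 hsT (hsol.mono hsT)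
          (hSol ρ s1 h0.le (hdom ρ hbρ s1 h1))
          (fun s hs => Or.inl (hK s ⟨hs.1, hs.2.trans hsT⟩)) s1 ⟨h0.le, le_rfl⟩
        have h3 := h2 s1 ⟨le_rfl, h1⟩
        have h4 := (abs_le.1 (hK s1 ⟨h0.le, hsT⟩)).1
        linarith
  · intro ρ1 h1 ρ2 h2 h12
    have h1 : ρt0 < ρ1 := h1
    have hb1 := hfin ρ1 h1
    have hb2 := hfin ρ2 h2
    refine lt_of_le_of_ne (hmonoR ρ1 ρ2 h1 h12.le) fun he => ?_
    simp only at he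
    obtain ⟨s0, hs0, hs1, hs2⟩ := hneg ρ1 hb1 1
    set σ := T - (tb ρ1).toReal with hσ
    have hsol : ∀ s, 0 ≤ s → s < σ → Sol_s17 a h n b ρ1 (y ρ1) s ∧ Sol_s17 a h n b ρ2 (y ρ2) s :=
      fun s h0 hs => ⟨hSol ρ1 s h0 (hdom ρ1 hb1 s hs), hSol ρ2 s h0 (hdom ρ2 hb2 s (by rw [← he]; exact hs))⟩
    obtain ⟨s', hs', hs''⟩ := exists_between hs1
    have hlt := solCmp_strict hC (hsol s' (by linarith) hs'').1 (hsol s' (by linarith) hs'').2 h12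
      s0 ⟨hs0, hs'⟩
    obtain ⟨hA, hH, hN, hB⟩ := hC.nonnegs
    set M := Am + 2 * (Nm + |ρ2| * Bm) + 1 with hM
    have hMpos : 0 < M := by positivity
    set d := (y ρ2 s0)⁻¹ - (y ρ1 s0)⁻¹ with hd
    have hdpos : 0 < d := by
      have a1 := hs2 s0 ⟨le_rfl, hs1⟩
      have := (inv_lt_inv_of_neg (by linarith) (by linarith : y ρ2 s0 < 0)).2 hlt
      linarith
    set E := d * Real.exp (-M * (σ - s0)) with hE
    have hEpos : 0 < E := mul_pos hdpos (Real.exp_pos _)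
    obtain ⟨s3, hs3, hs4, hs5⟩ := hneg ρ1 hb1 (2 / E)
    set s := max s0 s3 with hs
    have hss : s < σ := max_lt hs1 hs4
    have hs0s : s0 ≤ s := le_max_left _ _
    have hsp : 0 ≤ s := hs0.le.trans hs0s
    have key := sep hC (hsol s hsp hss).1 (hsol s hsp hss).2 h12 ⟨hs0.le, hs0s⟩
      (fun x hx => hs2 x ⟨hx.1, hx.2.trans_lt hss⟩) hlt
    have hk2 : E ≤ d * Real.exp (-M * (s - s0)) := by
      rw [hE]
      refine mul_le_mul_of_nonneg_left (Real.exp_le_exp.2 ?_) hdpos.le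
      nlinarith
    have h5 := hs5 s ⟨le_max_right _ _, hss⟩
    have h6 : -(y ρ1 s)⁻¹ ≤ E / 2 := by
      rw [← inv_neg]
      have h7 : 2 / E ≤ -(y ρ1 s) := by linarith
      have := inv_anti₀ (by positivity) h7
      rwa [inv_div] at this
    linarith

theorem bddAux {T : ℝ} {g : ℝ → ℝ} (hT : 0 < T) (hg : Continuous g) (hc : ∀ t ≤ 0, g t = g 0) :
    ∃ M, ∀ t ≤ T, |g t| ≤ M := by
  obtain ⟨M, hM⟩ := (isCompact_Icc (a := (0:ℝ)) (b := T)).exists_bound_of_continuousOn hg.continuousOn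
  refine ⟨M, fun t ht => ?_⟩
  rcases le_total t 0 with h | h
  · rw [hc t h]; exact hM 0 ⟨le_rfl, hT.le⟩
  · exact hM t ⟨h, ht⟩

/-- on `(ρ̃₀, +∞)` with `ρ̃₀ = max(ρ̃_a, ρ_b)`, the blow-up time of
the dual scalar Riccati equation is finite, continuous and strictly increasing. -/
theorem stmt_17
    (T β : ℝ) (hT : 0 < T) (hβ : 0 < β)
    (H11 H12 H13 H14 H21 H22 H33 H44 Hb22 : ℝ → ℝ)
    (hc11 : Continuous H11) (hc12 : Continuous H12) (hc13 : Continuous H13)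
    (hc14 : Continuous H14) (hc21 : Continuous H21) (hc22 : Continuous H22)
    (hc33 : Continuous H33) (hc44 : Continuous H44) (hcb22 : Continuous Hb22)
    (hconst : ∀ t : ℝ, t ≤ 0 → H11 t = H11 0 ∧ H12 t = H12 0 ∧ H13 t = H13 0 ∧
      H14 t = H14 0 ∧ H21 t = H21 0 ∧ H22 t = H22 0 ∧ H33 t = H33 0 ∧
      H44 t = H44 0 ∧ Hb22 t = Hb22 0)
    (hbound : ∀ t : ℝ, t ≤ T → β ≤ H11 t ∧ H22 t ≤ -β ∧ H33 t ≤ -β ∧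
      H44 t ≤ -β ∧ Hb22 t < 0)
    (k : ℝ → ℝ → ℝ) (tb : ℝ → EReal)
    (htbT : ∀ ρ : ℝ, tb ρ < (T : EReal))
    (hterm : ∀ ρ : ℝ, k ρ T = 0)
    (hcont : ∀ ρ : ℝ, ContinuousOn (k ρ) {t : ℝ | tb ρ < (t : EReal) ∧ t ≤ T})
    (hode : ∀ ρ t : ℝ, tb ρ < (t : EReal) → t < T →
      HasDerivAt (k ρ) (-(ricD H11 H13 H14 H21 H22 H33 H44 Hb22 ρ t (k ρ t))) t)
    (hblow : ∀ ρ : ℝ, ⊥ < tb ρ →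
      Tendsto (fun t => |k ρ t|) (nhdsWithin (tb ρ).toReal (Set.Ioi (tb ρ).toReal)) atTop)
    (ρta ρb ρt0 : ℝ)
    (hρb : ρb = sInf ((fun t => H22 t - H33 t * (H13 t) ^ 2 - H44 t * (H14 t) ^ 2) ''
        Set.Icc (0 : ℝ) T) / sSup (Hb22 '' Set.Icc (0 : ℝ) T))
    (hρta : ρta = sInf {ρ : ℝ | 0 < ρ ∧ ⊥ < tb ρ})
    (hρt0 : ρt0 = max ρta ρb) :
    (∀ ρ : ℝ, ρt0 < ρ → ⊥ < tb ρ) ∧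
    ContinuousOn (fun ρ => (tb ρ).toReal) (Set.Ioi ρt0) ∧
    StrictMonoOn (fun ρ => (tb ρ).toReal) (Set.Ioi ρt0) := by
  obtain ⟨Am, hAm⟩ := bddAux (T := T) (g := fun t => 2 * H21 t + (H13 t) ^ 2 + (H14 t) ^ 2) hT
    (by fun_prop) (by
      intro t ht
      obtain ⟨e1, e2, e3, e4, e5, e6, e7, e8, e9⟩ := hconst t ht
      simp only [e1, e2, e3, e4, e5, e6, e7, e8, e9])
  obtain ⟨Nm, hNm⟩ := bddAux (T := T)
    (g := fun t => H22 t - H33 t * (H13 t) ^ 2 - H44 t * (H14 t) ^ 2) hT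
    (by fun_prop) (by
      intro t ht
      obtain ⟨e1, e2, e3, e4, e5, e6, e7, e8, e9⟩ := hconst t ht
      simp only [e1, e2, e3, e4, e5, e6, e7, e8, e9])
  obtain ⟨Hm, hHm⟩ := bddAux (T := T) hT hc11 (fun t ht => (hconst t ht).1)
  obtain ⟨Bm, hBm⟩ := bddAux (T := T) hT hcb22 (fun t ht => (hconst t ht).2.2.2.2.2.2.2.2)
  obtain ⟨x, hx, hxm⟩ := (isCompact_Icc (a := (0:ℝ)) (b := T)).exists_isMaxOn
    (nonempty_Icc.2 hT.le) hcb22.continuousOn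
  have hC : Coef (fun s => 2 * H21 (T - s) + (H13 (T - s)) ^ 2 + (H14 (T - s)) ^ 2)
      (fun s => H11 (T - s))
      (fun s => H22 (T - s) - H33 (T - s) * (H13 (T - s)) ^ 2 - H44 (T - s) * (H14 (T - s)) ^ 2)
      (fun s => Hb22 (T - s)) β Am Hm Nm Bm :=
    ⟨hβ, fun s hs => hAm (T - s) (by linarith), fun s hs => (hbound (T - s) (by linarith)).1,
      fun s hs => (le_abs_self _).trans (hHm (T - s) (by linarith)),
      fun s hs => hNm (T - s) (by linarith),
      fun s hs => (hbound (T - s) (by linarith)).2.2.2.2,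
      fun s hs => hBm (T - s) (by linarith)⟩
  refine glue hC (-Hb22 x) (by linarith [(hbound x hx.2).2.2.2.2]) ?_ (fun ρ s => k ρ (T - s)) tb T
    htbT ?_ ?_ ρta ρt0 hρta (by rw [hρt0]; exact le_max_left _ _)
  · intro s hs
    rw [neg_neg]
    rcases le_total (T - s) 0 with h | h
    · simp only [(hconst (T - s) h).2.2.2.2.2.2.2.2]
      exact hxm (⟨le_rfl, hT.le⟩ : (0:ℝ) ∈ Icc 0 T)
    · exact hxm (⟨h, by linarith⟩ : T - s ∈ Icc 0 T)
  · intro ρ S hS hlt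
    have hd : ∀ s, s ≤ S → tb ρ < ((T - s : ℝ) : EReal) := fun s hs =>
      hlt.trans_le (EReal.coe_le_coe_iff.2 (by linarith))
    refine Sol_s17.of_interior (by fun_prop) (by fun_prop) (by fun_prop) (by fun_prop) ?_ ?_ ?_
    · exact (hcont ρ).comp (f := fun s => T - s) (by fun_prop)
        (fun s hs => ⟨hd s hs.2, by linarith [hs.1]⟩)
    · intro s hs
      have := (hode ρ (T - s) (hd s hs.2.le) (by linarith [hs.1])).comp_const_sub T s
      refine HasDerivAt.congr_deriv this ?_
      unfold GG ricD
      ring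
    · simpa using hterm ρ
  · intro ρ hρ M
    have hb := hblow ρ hρ
    set τ := (tb ρ).toReal with hτ
    have hreal : ((τ : ℝ) : EReal) = tb ρ :=
      EReal.coe_toReal ((htbT ρ).trans_le le_top).ne hρ.ne'
    have hτT : τ < T := by
      rw [← EReal.coe_lt_coe_iff, hreal]; exact htbT ρ
    have h1 := (hb.eventually_ge_atTop M).and (Ioo_mem_nhdsGT hτT)
    obtain ⟨u, hu, hsub⟩ := mem_nhdsGT_iff_exists_Ioc_subset.1 h1
    have hu : τ < u := hu
    have huT : u < T := (hsub ⟨hu, le_rfl⟩).2.2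
    refine ⟨T - u, by linarith, by linarith, fun s hs => ?_⟩
    exact (hsub (⟨by linarith [hs.2], by linarith [hs.1]⟩ : T - s ∈ Ioc τ u)).1
end
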